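/- Let U be a definably connected definable solvable group. Then the derived subgroup U^{(1)} = [U, U] is a nilpotent normal subgroup of U, and d(U^{(1)}), the smallest definable subgroup of U containing U^{(1)}, is a definable nilpotent normal subgroup of U. -/

import Mathlib

open Filter Set Topology

universe u

section OMinPreamble

variable {N : Type u}

section Basic
variable [LinearOrder N]

/-- A finite union of singletons and open intervals (with possibly infinite endpoints). -/
def IsFinUnionPtsIntervals (A : Set N) : Prop :=
  ∃ (k : ℕ) (f : Fin k → Set N),
    (∀ i, (∃ a, f i = {a}) ∨ (∃ a b, f i = Set.Ioo a b) ∨ (∃ a, f i = Set.Ioi a) ∨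
        (∃ b, f i = Set.Iio b) ∨ f i = Set.univ) ∧
    A = ⋃ i, f i

/-- An o-minimal structure on the ordered set `N`: an assignment, to each arity `m`,
of a collection of "definable" subsets of `N^m`, closed under the boolean and
first-order operations, containing the order and all points (parameters), and such
that every definable subset of `N` is a finite union of points and open intervals. -/
structure Struc (N : Type u) [LinearOrder N] where
  Def : ∀ m : ℕ, Set (Fin m → N) → Prop
  def_inter : ∀ {m : ℕ} {A B : Set (Fin m → N)}, Def m A → Def m B → Def m (A ∩ B)
  def_compl : ∀ {m : ℕ} {A : Set (Fin m → N)}, Def m A → Def m Aᶜ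
  def_univ : ∀ m : ℕ, Def m Set.univ
  def_reindex : ∀ {m k : ℕ} (g : Fin m → Fin k) {A : Set (Fin m → N)},
      Def m A → Def k {x | x ∘ g ∈ A}
  def_proj : ∀ {m : ℕ} {A : Set (Fin (m + 1) → N)},
      Def (m + 1) A → Def m {x | ∃ t : N, Fin.snoc x t ∈ A}
  def_lt : Def 2 {x | x 0 < x 1}
  def_pt : ∀ a : N, Def 1 {x | x 0 = a}
  o_min : ∀ {A : Set (Fin 1 → N)}, Def 1 A →
      IsFinUnionPtsIntervals {t : N | (fun _ : Fin 1 => t) ∈ A}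

/-- Index of the pair `(i,j)` in `Fin (n*m)`. -/
def finIdx {n m : ℕ} (i : Fin n) (j : Fin m) : Fin (n * m) :=
  ⟨i.1 * m + j.1, by
    have hi := i.isLt
    have hj := j.isLt
    calc i.1 * m + j.1 < i.1 * m + m := by omega
      _ = (i.1 + 1) * m := by ring
      _ ≤ n * m := Nat.mul_le_mul hi (le_refl m)⟩

def pFst {a b : ℕ} (p : Fin (a * b)) : Fin a :=
  ⟨p.1 / b, by
    have h := p.isLt
    have hb : 0 < b := by
      rcases Nat.eq_zero_or_pos b with h0 | h0
      · subst h0; simp at h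
      · exact h0
    exact (Nat.div_lt_iff_lt_mul hb).mpr h⟩

def pSnd {a b : ℕ} (p : Fin (a * b)) : Fin b :=
  ⟨p.1 % b, by
    have h := p.isLt
    have hb : 0 < b := by
      rcases Nat.eq_zero_or_pos b with h0 | h0
      · subst h0; simp at h
      · exact h0
    exact Nat.mod_lt _ hb⟩

/-- Horner evaluation of the polynomial with coefficients `c` (constant term first)
at `x`, relative to abstract operations. -/
def polyEval {α : Type*} (add mul : α → α → α) (zero : α) {n : ℕ} (c : Fin n → α)
    (x : α) : α :=
  (List.ofFn c).foldr (fun a acc => add a (mul x acc)) zero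

/-- `n`-th power relative to an abstract operation with identity `z`. -/
def opPow {α : Type*} (op : α → α → α) (z : α) (a : α) : ℕ → α
  | 0 => z
  | n + 1 => op a (opPow op z a n)

namespace Struc
variable (S : Struc N)

/-- The function `f`, restricted to the definable set `A ⊆ N^m` and with values in
`N^n`, is definable: its graph is a definable set. -/
def DefFunOn {m n : ℕ} (A : Set (Fin m → N)) (f : (Fin m → N) → (Fin n → N)) : Prop :=
  S.Def (m + n) {z | (z ∘ Fin.castAdd n) ∈ A ∧ f (z ∘ Fin.castAdd n) = z ∘ Fin.natAdd m}

/-- A definable function of two tuple variables. -/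
def DefFun2 {m n k : ℕ} (A : Set (Fin m → N)) (B : Set (Fin n → N))
    (f : (Fin m → N) → (Fin n → N) → (Fin k → N)) : Prop :=
  S.Def (m + n + k) {z |
    (z ∘ Fin.castAdd k ∘ Fin.castAdd n) ∈ A ∧
    (z ∘ Fin.castAdd k ∘ Fin.natAdd m) ∈ B ∧
    f (z ∘ Fin.castAdd k ∘ Fin.castAdd n) (z ∘ Fin.castAdd k ∘ Fin.natAdd m) =
      z ∘ Fin.natAdd (m + n)}

/-- A definable unary function `N → N` on the set `J ⊆ N`. -/
def DefFun1 (J : Set N) (f : N → N) : Prop :=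
  S.Def 2 {z | z 0 ∈ J ∧ f (z 0) = z 1}

/-- A definable curve in `N^k` defined on the set `J ⊆ N`. -/
def DefCurve {k : ℕ} (J : Set N) (σ : N → (Fin k → N)) : Prop :=
  S.DefFunOn {x : Fin 1 → N | x 0 ∈ J} (fun x => σ (x 0))

/-- A definable function of `n` tuple variables from `A^n ⊆ (N^m)^n` to `N^k`. -/
def DefFunN {m k : ℕ} (n : ℕ) (A : Set (Fin m → N))
    (c : (Fin n → (Fin m → N)) → (Fin k → N)) : Prop :=
  S.Def (n * m + k) {z |
    (∀ i : Fin n, (fun j : Fin m => z (Fin.castAdd k (finIdx i j))) ∈ A) ∧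
    c (fun i j => z (Fin.castAdd k (finIdx i j))) = fun j => z (Fin.natAdd (n * m) j)}

end Struc

/-- The filter of neighbourhoods of the "left end" of the set `J ⊆ N`. -/
def leftEndFilter (J : Set N) : Filter N := ⨅ x ∈ J, Filter.principal (J ∩ Set.Iio x)

/-- The filter of neighbourhoods of the "right end" of the set `J ⊆ N`
(for `J` unbounded above this is "`→ +∞` inside `J`"). -/
def rightEndFilter (J : Set N) : Filter N := ⨅ x ∈ J, Filter.principal (J ∩ Set.Ioi x)

/-- `J` is an open interval, with possibly infinite endpoints. -/
def IsOpenIntervalSet (J : Set N) : Prop :=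
  (∃ a b, a < b ∧ J = Set.Ioo a b) ∨ (∃ a, J = Set.Ioi a) ∨ (∃ b, J = Set.Iio b) ∨
    J = Set.univ

end Basic

section Groups
variable [LinearOrder N] [TopologicalSpace N]

/-- The o-minimal dimension of `A ⊆ N^m`: the largest `k` such that the image of `A`
under some projection onto `k` coordinates has nonempty interior in `N^k`
(`N` carrying the order topology and `N^k` the product topology). -/
noncomputable def odim {m : ℕ} (A : Set (Fin m → N)) : ℕ :=
  sSup {k | ∃ p : Fin k → Fin m, Function.Injective p ∧
    (interior ((fun x : Fin m → N => x ∘ p) '' A)).Nonempty}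

/-- A definable group: a definable subset of `N^m` with a group operation whose graph
is definable, together with its (unique) definable manifold topology, i.e. a group
topology which agrees with the ambient topology on a large definable subset. -/
structure DefGroup (S : Struc N) (m : ℕ) where
  carrier : Set (Fin m → N)
  carrier_def : S.Def m carrier
  mul : (Fin m → N) → (Fin m → N) → (Fin m → N)
  one : Fin m → N
  inv : (Fin m → N) → (Fin m → N)
  one_mem : one ∈ carrier
  mul_mem : ∀ ⦃x y : Fin m → N⦄, x ∈ carrier → y ∈ carrier → mul x y ∈ carrier
  inv_mem : ∀ ⦃x : Fin m → N⦄, x ∈ carrier → inv x ∈ carrier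
  mul_assoc' : ∀ ⦃x y z : Fin m → N⦄, x ∈ carrier → y ∈ carrier → z ∈ carrier →
      mul (mul x y) z = mul x (mul y z)
  one_mul' : ∀ ⦃x : Fin m → N⦄, x ∈ carrier → mul one x = x
  inv_mul' : ∀ ⦃x : Fin m → N⦄, x ∈ carrier → mul (inv x) x = one
  mul_graph_def : S.DefFun2 carrier carrier mul
  inv_graph_def : S.DefFunOn carrier inv
  top : TopologicalSpace (Fin m → N)
  contMul : @ContinuousOn ((Fin m → N) × (Fin m → N)) (Fin m → N)
      (@instTopologicalSpaceProd _ _ top top) top (fun p => mul p.1 p.2)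
      (carrier ×ˢ carrier)
  contInv : @ContinuousOn (Fin m → N) (Fin m → N) top top inv carrier
  pillay : ∃ V : Set (Fin m → N), V ⊆ carrier ∧ S.Def m V ∧
      (carrier \ V = ∅ ∨ odim (carrier \ V) < odim carrier) ∧
      (∃ O : Set (Fin m → N), IsOpen[top] O ∧ O ∩ carrier = V) ∧
      ∀ x ∈ V, @nhdsWithin (Fin m → N) top x carrier = nhdsWithin x V

variable {S : Struc N}

/-- The elements of a definable group, as a type. -/
def DefGroup.Elt {m : ℕ} (G : DefGroup S m) : Type u := {x : Fin m → N // x ∈ G.carrier}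

namespace DefGroup

instance {m : ℕ} {G : DefGroup S m} : Mul G.Elt :=
  ⟨fun a b => ⟨G.mul a.1 b.1, G.mul_mem a.2 b.2⟩⟩

instance {m : ℕ} {G : DefGroup S m} : One G.Elt := ⟨⟨G.one, G.one_mem⟩⟩

instance {m : ℕ} {G : DefGroup S m} : Inv G.Elt := ⟨fun a => ⟨G.inv a.1, G.inv_mem a.2⟩⟩

instance instGroupElt {m : ℕ} {G : DefGroup S m} : Group G.Elt :=
  Group.ofLeftAxioms
    (fun a b c => Subtype.ext (G.mul_assoc' a.2 b.2 c.2))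
    (fun a => Subtype.ext (G.one_mul' a.2))
    (fun a => Subtype.ext (G.inv_mul' a.2))

variable {m : ℕ} (G : DefGroup S m)

/-- `H` is a definable subgroup of `G`. -/
def IsDefSubgroup (H : Set (Fin m → N)) : Prop :=
  H ⊆ G.carrier ∧ S.Def m H ∧ G.one ∈ H ∧
    (∀ x ∈ H, ∀ y ∈ H, G.mul x y ∈ H) ∧ (∀ x ∈ H, G.inv x ∈ H)

/-- `H` is a definable normal subgroup of `G`. -/
def IsNormalDefSubgroup (H : Set (Fin m → N)) : Prop :=
  G.IsDefSubgroup H ∧ ∀ g ∈ G.carrier, ∀ h ∈ H, G.mul (G.mul g h) (G.inv g) ∈ H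

/-- The left coset `g·H`. -/
def lcoset (g : Fin m → N) (H : Set (Fin m → N)) : Set (Fin m → N) :=
  {y | ∃ h ∈ H, y = G.mul g h}

/-- `H` has finite index in `G`: finitely many left cosets cover `G`. -/
def FiniteIndex (H : Set (Fin m → N)) : Prop :=
  ∃ F : Finset (Fin m → N), ↑F ⊆ G.carrier ∧ G.carrier ⊆ ⋃ g ∈ F, G.lcoset g H

/-- `G` is definably connected: it has no proper definable subgroup of finite index. -/
def DefinablyConnected : Prop :=
  ∀ H : Set (Fin m → N), G.IsDefSubgroup H → G.FiniteIndex H → H = G.carrier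

def IsAbelian : Prop := ∀ x ∈ G.carrier, ∀ y ∈ G.carrier, G.mul x y = G.mul y x

/-- The center of `G`, as a definable subset. -/
def center : Set (Fin m → N) :=
  {x | x ∈ G.carrier ∧ ∀ y ∈ G.carrier, G.mul x y = G.mul y x}

def TorsionFree : Prop := ∀ x : G.Elt, x ≠ 1 → ∀ n : ℕ, 0 < n → x ^ n ≠ 1

/-- `G` is definably compact: every definable continuous embedding of an open
interval into `G` has limits at both ends of the interval (with respect to the
group's definable manifold topology). -/
def DefinablyCompact : Prop :=
  ∀ J : Set N, IsOpenIntervalSet J → ∀ σ : N → (Fin m → N),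
    S.DefCurve J σ → (∀ t ∈ J, σ t ∈ G.carrier) → Set.InjOn σ J →
    @ContinuousOn N (Fin m → N) _ G.top σ J →
    (∃ c ∈ G.carrier, Filter.Tendsto σ (leftEndFilter J) (@nhds _ G.top c)) ∧
    (∃ d ∈ G.carrier, Filter.Tendsto σ (rightEndFilter J) (@nhds _ G.top d))

/-- `G` is definably semisimple: it has no infinite proper abelian definable normal
subgroup. -/
def DefinablySemisimple : Prop :=
  ¬ ∃ H : Set (Fin m → N), G.IsNormalDefSubgroup H ∧ H.Infinite ∧ H ≠ G.carrier ∧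
      ∀ x ∈ H, ∀ y ∈ H, G.mul x y = G.mul y x

/-- The product of a list of elements of `G`. -/
def listProd : List (Fin m → N) → (Fin m → N)
  | [] => G.one
  | x :: xs => G.mul x (listProd xs)

end DefGroup

/-- A definable homomorphism between definable groups. -/
def IsDefHom {m n : ℕ} (G : DefGroup S m) (H : DefGroup S n)
    (f : (Fin m → N) → (Fin n → N)) : Prop :=
  (∀ x ∈ G.carrier, f x ∈ H.carrier) ∧ S.DefFunOn G.carrier f ∧
  ∀ x ∈ G.carrier, ∀ y ∈ G.carrier, f (G.mul x y) = H.mul (f x) (f y)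

/-- `π` realizes `Q` as the quotient of the subgroup `H` of `U` by the normal
subgroup `V ⊆ H`: a definable surjective homomorphism `H → Q` with fibers the
cosets of `V` (kernel exactly `V`). -/
def IsQuotMap {m k : ℕ} (U : DefGroup S m) (H V : Set (Fin m → N)) (Q : DefGroup S k)
    (π : (Fin m → N) → (Fin k → N)) : Prop :=
  (∀ x ∈ H, π x ∈ Q.carrier) ∧ S.DefFunOn H π ∧
  (∀ x ∈ H, ∀ y ∈ H, π (U.mul x y) = Q.mul (π x) (π y)) ∧
  π '' H = Q.carrier ∧ ∀ x ∈ H, (π x = Q.one ↔ x ∈ V)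

/-- A definable extension `1 → A → U → G → 1`. -/
def IsDefExtension {mA mU mG : ℕ} (A : DefGroup S mA) (U : DefGroup S mU)
    (G : DefGroup S mG) (i : (Fin mA → N) → (Fin mU → N))
    (j : (Fin mU → N) → (Fin mG → N)) : Prop :=
  IsDefHom A U i ∧ IsDefHom U G j ∧ Set.InjOn i A.carrier ∧
  j '' U.carrier = G.carrier ∧
  ∀ u ∈ U.carrier, (j u = G.one ↔ ∃ a ∈ A.carrier, u = i a)

/-- A definable `G`-module: a definable abelian group `A` together with a definable
action of `G` on `A` by (definable) automorphisms. -/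
structure DefModule {mG mA : ℕ} (G : DefGroup S mG) (A : DefGroup S mA) where
  abelian : A.IsAbelian
  act : (Fin mG → N) → (Fin mA → N) → (Fin mA → N)
  act_mem : ∀ ⦃x a⦄, x ∈ G.carrier → a ∈ A.carrier → act x a ∈ A.carrier
  act_one : ∀ ⦃a⦄, a ∈ A.carrier → act G.one a = a
  act_mul : ∀ ⦃x y⦄, x ∈ G.carrier → y ∈ G.carrier → ∀ ⦃a⦄, a ∈ A.carrier →
      act (G.mul x y) a = act x (act y a)
  act_hom : ∀ ⦃x⦄, x ∈ G.carrier → ∀ ⦃a b⦄, a ∈ A.carrier → b ∈ A.carrier →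
      act x (A.mul a b) = A.mul (act x a) (act x b)
  act_def : S.DefFun2 G.carrier A.carrier act

/-- The module `(A, γ)` is trivial. -/
def DefModule.IsTrivial {mG mA : ℕ} {G : DefGroup S mG} {A : DefGroup S mA}
    (γ : DefModule G A) : Prop :=
  ∀ x ∈ G.carrier, ∀ a ∈ A.carrier, γ.act x a = a

/-- The definable extension `1 → A → U → G → 1` is compatible with the `G`-module
`(A, γ)`: conjugation in `U` induces the action `γ` on `A`. -/
def ExtCompatible {mG mA mU : ℕ} {G : DefGroup S mG} {A : DefGroup S mA}
    (γ : DefModule G A) (U : DefGroup S mU) (i : (Fin mA → N) → (Fin mU → N))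
    (j : (Fin mU → N) → (Fin mG → N)) : Prop :=
  ∀ u ∈ U.carrier, ∀ a ∈ A.carrier, i (γ.act (j u) a) = U.mul (U.mul u (i a)) (U.inv u)

/-- Alternating "sum" `x₁ - (x₂ - (x₃ - ⋯))` in a (multiplicatively written abelian)
definable group. -/
def altSum {k : ℕ} (A : DefGroup S k) : List (Fin k → N) → (Fin k → N)
  | [] => A.one
  | x :: xs => A.mul x (A.inv (altSum A xs))

/-- The `i`-th term (`1 ≤ i ≤ n+1`) in the coboundary formula:
`c(g₁,…,g_i g_{i+1},…,g_{n+1})` for `1 ≤ i ≤ n`, and `c(g₁,…,g_n)` for `i = n+1`. -/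
def cobTerm {mG kA : ℕ} (G : DefGroup S mG) {n : ℕ}
    (c : (Fin n → (Fin mG → N)) → (Fin kA → N))
    (g : Fin (n + 1) → (Fin mG → N)) (i : ℕ) : Fin kA → N :=
  if i ≤ n then
    c (fun j : Fin n =>
      if j.1 + 1 < i then g (Fin.castSucc j)
      else if j.1 + 1 = i then G.mul (g (Fin.castSucc j)) (g j.succ)
      else g j.succ)
  else c (fun j : Fin n => g (Fin.castSucc j))

/-- The coboundary `δb` of the definable `n`-cochain `b`:
`δb(g₁,…,g_{n+1}) = γ(g₁)(b(g₂,…,g_{n+1})) + Σ_{i=1}^{n} (−1)^i b(…,g_i g_{i+1},…)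
+ (−1)^{n+1} b(g₁,…,g_n)` (written multiplicatively in the abelian group `A`). -/
def cob {mG kA : ℕ} {G : DefGroup S mG} {A : DefGroup S kA} (γ : DefModule G A)
    {n : ℕ} (b : (Fin n → (Fin mG → N)) → (Fin kA → N))
    (g : Fin (n + 1) → (Fin mG → N)) : Fin kA → N :=
  A.mul (γ.act (g 0) (b (Fin.tail g)))
    (A.inv (altSum A (List.ofFn fun i : Fin (n + 1) => cobTerm G b g (i.1 + 1))))

/-- There is no definable bijection between `X ⊆ N^m` and `Y ⊆ N^k`. -/
def NoDefBijection (S : Struc N) {m k : ℕ} (X : Set (Fin m → N))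
    (Y : Set (Fin k → N)) : Prop :=
  ¬ ∃ f : (Fin m → N) → (Fin k → N), S.DefFunOn X f ∧ (∀ x ∈ X, f x ∈ Y) ∧
      Set.InjOn f X ∧ f '' X = Y

/-- The subgroup `W` of `U` is definably isomorphic to a (finite) direct product of
copies of the one-dimensional group `(J, op)`. -/
def IsProdOfCopies {m : ℕ} (U : DefGroup S m) (W : Set (Fin m → N)) (J : Set N)
    (op : N → N → N) : Prop :=
  ∃ (d : ℕ) (φ : (Fin m → N) → (Fin d → N)),
    S.DefFunOn W φ ∧ Set.InjOn φ W ∧ φ '' W = {z | ∀ i, z i ∈ J} ∧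
    ∀ x ∈ W, ∀ y ∈ W, φ (U.mul x y) = fun i => op (φ x i) (φ y i)

/-- `V` is the internal direct product of the list `parts` of definable subgroups
of `U`: the parts commute pairwise and every element of `V` is uniquely a product
of elements of the parts. -/
def IsInternalDPList {m : ℕ} (U : DefGroup S m) (V : Set (Fin m → N))
    (parts : List (Set (Fin m → N))) : Prop :=
  (∀ P ∈ parts, U.IsDefSubgroup P) ∧
  List.Pairwise (fun P Q => ∀ x ∈ P, ∀ y ∈ Q, U.mul x y = U.mul y x) parts ∧
  (∀ v, v ∈ V ↔ ∃ f : Fin parts.length → (Fin m → N),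
      (∀ i, f i ∈ parts.get i) ∧ v = U.listProd (List.ofFn f)) ∧
  ∀ f g : Fin parts.length → (Fin m → N),
    (∀ i, f i ∈ parts.get i) → (∀ i, g i ∈ parts.get i) →
    U.listProd (List.ofFn f) = U.listProd (List.ofFn g) → f = g

/-- `K` is a definable subgroup of `U`, equipped with its group structure and with
the submanifold topology inherited from `U`. -/
def IsDefSubgroupGrp {m : ℕ} (U K : DefGroup S m) : Prop :=
  K.carrier ⊆ U.carrier ∧ K.one = U.one ∧
  (∀ x ∈ K.carrier, ∀ y ∈ K.carrier, K.mul x y = U.mul x y) ∧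
  (∀ x ∈ K.carrier, K.inv x = U.inv x) ∧
  ∀ x ∈ K.carrier, @nhdsWithin (Fin m → N) K.top x K.carrier
      = @nhdsWithin (Fin m → N) U.top x K.carrier

/-- The abelian definable group `U` has no definably compact parts: there is a chain
of definable subgroups each of whose successive quotients is a one-dimensional
definably connected torsion-free definable group. -/
def NoCompactParts {m : ℕ} (U : DefGroup S m) : Prop :=
  ∃ (n : ℕ) (ch : Fin (n + 1) → Set (Fin m → N)),
    ch 0 = {U.one} ∧ ch (Fin.last n) = U.carrier ∧
    (∀ j, U.IsDefSubgroup (ch j)) ∧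
    (∀ j : Fin n, ch j.castSucc ⊆ ch j.succ) ∧
    ∀ j : Fin n, ∃ (k : ℕ) (Q : DefGroup S k) (π : (Fin m → N) → (Fin k → N)),
      IsQuotMap U (ch j.succ) (ch j.castSucc) Q π ∧
      odim Q.carrier = 1 ∧ Q.DefinablyConnected ∧ Q.TorsionFree

/-- `H` is the definably connected component of the identity of `G`: the smallest
definable subgroup of finite index. -/
def IsIdentityComponent {m : ℕ} (G : DefGroup S m) (H : Set (Fin m → N)) : Prop :=
  G.IsDefSubgroup H ∧ G.FiniteIndex H ∧
    ∀ H' : Set (Fin m → N), G.IsDefSubgroup H' → G.FiniteIndex H' → H ⊆ H'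

/-- A definable (not necessarily unital or associative) ring: a definable abelian
group together with a definable bi-additive multiplication. -/
structure DefRing (S : Struc N) (m : ℕ) where
  grp : DefGroup S m
  comm : grp.IsAbelian
  rmul : (Fin m → N) → (Fin m → N) → (Fin m → N)
  rmul_mem : ∀ ⦃x y⦄, x ∈ grp.carrier → y ∈ grp.carrier → rmul x y ∈ grp.carrier
  left_distrib' : ∀ ⦃x y z⦄, x ∈ grp.carrier → y ∈ grp.carrier → z ∈ grp.carrier →
      rmul x (grp.mul y z) = grp.mul (rmul x y) (rmul x z)
  right_distrib' : ∀ ⦃x y z⦄, x ∈ grp.carrier → y ∈ grp.carrier → z ∈ grp.carrier →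
      rmul (grp.mul x y) z = grp.mul (rmul x z) (rmul y z)
  rmul_graph_def : S.DefFun2 grp.carrier grp.carrier rmul

/-- `H` is a definable left ideal of the definable ring `R`. -/
def DefRing.IsLeftIdeal {m : ℕ} (R : DefRing S m) (H : Set (Fin m → N)) : Prop :=
  R.grp.IsDefSubgroup H ∧ ∀ u ∈ R.grp.carrier, ∀ h ∈ H, R.rmul u h ∈ H

/-- `π` realizes `Q` as the quotient ring of `R` by the (two-sided) ideal `V`. -/
def IsRingQuotMap {m k : ℕ} (R : DefRing S m) (V : Set (Fin m → N)) (Q : DefRing S k)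
    (π : (Fin m → N) → (Fin k → N)) : Prop :=
  IsQuotMap R.grp R.grp.carrier V Q.grp π ∧
  ∀ x ∈ R.grp.carrier, ∀ y ∈ R.grp.carrier, π (R.rmul x y) = Q.rmul (π x) (π y)

/-- The two-sided annihilator of the definable ring `R`. -/
def ringAnn {m : ℕ} (R : DefRing S m) : Set (Fin m → N) :=
  {v | v ∈ R.grp.carrier ∧
    ∀ w ∈ R.grp.carrier, R.rmul v w = R.grp.one ∧ R.rmul w v = R.grp.one}

/-- Iterated ring product `((a·x₁)·x₂)⋯`. -/
def rFold {m : ℕ} (R : DefRing S m) : (Fin m → N) → List (Fin m → N) → (Fin m → N)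
  | a, [] => a
  | a, x :: xs => rFold R (R.rmul a x) xs

/-- An o-minimal expansion of an ordered group, definable in the ambient structure:
a definable subset `J ⊆ N` with a definable ordered abelian group structure
(the induced structure on `J` being the relevant o-minimal expansion). -/
structure OMinGrpExp (S : Struc N) where
  J : Set N
  Jdef : S.Def 1 {x | x 0 ∈ J}
  add : N → N → N
  zero : N
  neg : N → N
  zero_mem : zero ∈ J
  add_mem : ∀ ⦃a b⦄, a ∈ J → b ∈ J → add a b ∈ J
  neg_mem : ∀ ⦃a⦄, a ∈ J → neg a ∈ J
  add_assoc' : ∀ ⦃a b c⦄, a ∈ J → b ∈ J → c ∈ J → add (add a b) c = add a (add b c)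
  add_comm' : ∀ ⦃a b⦄, a ∈ J → b ∈ J → add a b = add b a
  zero_add' : ∀ ⦃a⦄, a ∈ J → add zero a = a
  neg_add' : ∀ ⦃a⦄, a ∈ J → add (neg a) a = zero
  add_lt' : ∀ ⦃a b c⦄, a ∈ J → b ∈ J → c ∈ J → b < c → add a b < add a c
  add_graph_def : S.Def 3 {z | z 0 ∈ J ∧ z 1 ∈ J ∧ add (z 0) (z 1) = z 2}

namespace OMinGrpExp
variable {S : Struc N} (E : OMinGrpExp S)

/-- A subset of `J^k` bounded in `J`. -/
def BoundedSet {k : ℕ} (B : Set (Fin k → N)) : Prop :=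
  ∃ lo ∈ E.J, ∃ hi ∈ E.J, ∀ x ∈ B, ∀ i, lo ≤ x i ∧ x i ≤ hi

/-- The induced structure on `J` is semi-bounded: every definable subset of `J^k`
belongs to every family of sets (closed under the first-order operations relative
to `J`) containing the ordered group structure, all bounded definable sets, and
all definable endomorphisms of `(J, 0, +)`. -/
def SemiBounded : Prop :=
  ∀ (D : ∀ k : ℕ, Set (Fin k → N) → Prop),
    (∀ {k : ℕ} {A B : Set (Fin k → N)}, D k A → D k B → D k (A ∩ B)) →
    (∀ {k : ℕ} {A : Set (Fin k → N)}, D k A → D k ({x | ∀ i, x i ∈ E.J} \ A)) →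
    (∀ k : ℕ, D k {x | ∀ i, x i ∈ E.J}) →
    (∀ {k l : ℕ} (g : Fin k → Fin l) {A : Set (Fin k → N)}, D k A →
        D l {x | (∀ i, x i ∈ E.J) ∧ x ∘ g ∈ A}) →
    (∀ {k : ℕ} {A : Set (Fin (k + 1) → N)}, D (k + 1) A →
        D k {x | (∀ i, x i ∈ E.J) ∧ ∃ t ∈ E.J, Fin.snoc x t ∈ A}) →
    (D 2 {x | (∀ i, x i ∈ E.J) ∧ x 0 < x 1}) →
    (∀ a ∈ E.J, D 1 {x | x 0 = a}) →
    (D 3 {z | (∀ i, z i ∈ E.J) ∧ E.add (z 0) (z 1) = z 2}) →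
    (∀ {k : ℕ} {B : Set (Fin k → N)}, S.Def k B → (∀ x ∈ B, ∀ i, x i ∈ E.J) →
        E.BoundedSet B → D k B) →
    (∀ f : N → N, S.DefFun1 E.J f → (∀ a ∈ E.J, f a ∈ E.J) →
        (∀ ⦃a b⦄, a ∈ E.J → b ∈ E.J → f (E.add a b) = E.add (f a) (f b)) →
        D 2 {z | z 0 ∈ E.J ∧ z 1 ∈ E.J ∧ f (z 0) = z 1}) →
    ∀ {k : ℕ} {A : Set (Fin k → N)}, S.Def k A → (∀ x ∈ A, ∀ i, x i ∈ E.J) → D k A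

end OMinGrpExp

/-- An o-minimal expansion of a real closed field, definable in the ambient
structure: a definable subset `J ⊆ N` with a definable real closed ordered field
structure. -/
structure OMinFieldExp (S : Struc N) where
  J : Set N
  Jdef : S.Def 1 {x | x 0 ∈ J}
  add : N → N → N
  mul : N → N → N
  zero : N
  one : N
  neg : N → N
  inv : N → N
  zero_mem : zero ∈ J
  one_mem : one ∈ J
  zero_ne_one : zero ≠ one
  add_mem : ∀ ⦃a b⦄, a ∈ J → b ∈ J → add a b ∈ J
  mul_mem : ∀ ⦃a b⦄, a ∈ J → b ∈ J → mul a b ∈ J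
  neg_mem : ∀ ⦃a⦄, a ∈ J → neg a ∈ J
  inv_mem : ∀ ⦃a⦄, a ∈ J → inv a ∈ J
  add_assoc' : ∀ ⦃a b c⦄, a ∈ J → b ∈ J → c ∈ J → add (add a b) c = add a (add b c)
  add_comm' : ∀ ⦃a b⦄, a ∈ J → b ∈ J → add a b = add b a
  zero_add' : ∀ ⦃a⦄, a ∈ J → add zero a = a
  neg_add' : ∀ ⦃a⦄, a ∈ J → add (neg a) a = zero
  mul_assoc' : ∀ ⦃a b c⦄, a ∈ J → b ∈ J → c ∈ J → mul (mul a b) c = mul a (mul b c)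
  mul_comm' : ∀ ⦃a b⦄, a ∈ J → b ∈ J → mul a b = mul b a
  one_mul' : ∀ ⦃a⦄, a ∈ J → mul one a = a
  mul_inv' : ∀ ⦃a⦄, a ∈ J → a ≠ zero → mul (inv a) a = one
  distrib' : ∀ ⦃a b c⦄, a ∈ J → b ∈ J → c ∈ J →
      mul a (add b c) = add (mul a b) (mul a c)
  add_lt' : ∀ ⦃a b c⦄, a ∈ J → b ∈ J → c ∈ J → b < c → add a b < add a c
  mul_pos' : ∀ ⦃a b⦄, a ∈ J → b ∈ J → zero < a → zero < b → zero < mul a b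
  sq_root : ∀ ⦃a⦄, a ∈ J → zero ≤ a → ∃ b ∈ J, mul b b = a
  odd_root : ∀ n : ℕ, Odd n → ∀ c : Fin (n + 1) → N, (∀ i, c i ∈ J) →
      c (Fin.last n) ≠ zero → ∃ x ∈ J, polyEval add mul zero c x = zero
  add_graph_def : S.Def 3 {z | z 0 ∈ J ∧ z 1 ∈ J ∧ add (z 0) (z 1) = z 2}
  mul_graph_def : S.Def 3 {z | z 0 ∈ J ∧ z 1 ∈ J ∧ mul (z 0) (z 1) = z 2}

/-- The linearly bounded one-dimensional torsion-free definable group of an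
o-minimal expansion of a real closed field: a definable ordered torsion-free group
structure on `J` with respect to which the induced structure is linearly bounded. -/
structure LinBddGrp {S : Struc N} (E : OMinFieldExp S) where
  op : N → N → N
  z : N
  opneg : N → N
  z_mem : z ∈ E.J
  op_mem : ∀ ⦃a b⦄, a ∈ E.J → b ∈ E.J → op a b ∈ E.J
  opneg_mem : ∀ ⦃a⦄, a ∈ E.J → opneg a ∈ E.J
  op_assoc : ∀ ⦃a b c⦄, a ∈ E.J → b ∈ E.J → c ∈ E.J → op (op a b) c = op a (op b c)
  op_comm : ∀ ⦃a b⦄, a ∈ E.J → b ∈ E.J → op a b = op b a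
  z_op : ∀ ⦃a⦄, a ∈ E.J → op z a = a
  opneg_op : ∀ ⦃a⦄, a ∈ E.J → op (opneg a) a = z
  op_lt : ∀ ⦃a b c⦄, a ∈ E.J → b ∈ E.J → c ∈ E.J → b < c → op a b < op a c
  op_graph_def : S.Def 3 {w | w 0 ∈ E.J ∧ w 1 ∈ E.J ∧ op (w 0) (w 1) = w 2}
  torsion_free : ∀ a ∈ E.J, a ≠ z → ∀ n : ℕ, 0 < n → opPow op z a n ≠ z
  lin_bdd : ∀ f : N → N, S.DefFun1 E.J f → (∀ a ∈ E.J, f a ∈ E.J) →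
      ∃ r : N → N, S.DefFun1 E.J r ∧ (∀ a ∈ E.J, r a ∈ E.J) ∧
        (∀ ⦃a b⦄, a ∈ E.J → b ∈ E.J → r (op a b) = op (r a) (r b)) ∧
        ∃ cst ∈ E.J, Filter.Tendsto (fun x => op (f x) (opneg (r x)))
            (rightEndFilter E.J) (nhds cst)

/-- Multiplication of `n × n` matrices with entries in the definable field `E`. -/
def matMul {S : Struc N} (E : OMinFieldExp S) (n : ℕ) (x y : Fin (n * n) → N) :
    Fin (n * n) → N :=
  fun p =>
    (List.ofFn (fun l : Fin n =>
        E.mul (x (finIdx (pFst p) l)) (y (finIdx l (pSnd p))))).foldr E.add E.zero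

/-- The identity `n × n` matrix with entries in the definable field `E`. -/
def matId {S : Struc N} (E : OMinFieldExp S) (n : ℕ) : Fin (n * n) → N :=
  fun p => if pFst p = pSnd p then E.one else E.zero

/-- The three kinds of division algebras over a real closed field. -/
inductive DivKind : Type
  | real : DivKind
  | cplx : DivKind
  | quat : DivKind

@[reducible] def dkDim : DivKind → ℕ
  | .real => 1
  | .cplx => 2
  | .quat => 4

/-- Multiplication in the division algebra of kind `d` (the field itself, the field
with `√-1` adjoined, or the quaternions), with coordinates in the definable field
`E`. -/
def dkMul {S : Struc N} (E : OMinFieldExp S) :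
    (d : DivKind) → (Fin (dkDim d) → N) → (Fin (dkDim d) → N) → (Fin (dkDim d) → N)
  | .real => fun x y _ => E.mul (x 0) (y 0)
  | .cplx => fun x y i =>
      if i.1 = 0 then E.add (E.mul (x 0) (y 0)) (E.neg (E.mul (x 1) (y 1)))
      else E.add (E.mul (x 0) (y 1)) (E.mul (x 1) (y 0))
  | .quat => fun x y i =>
      if i.1 = 0 then
        E.add (E.mul (x 0) (y 0)) (E.neg (E.add (E.mul (x 1) (y 1))
          (E.add (E.mul (x 2) (y 2)) (E.mul (x 3) (y 3)))))
      else if i.1 = 1 then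
        E.add (E.mul (x 0) (y 1)) (E.add (E.mul (x 1) (y 0))
          (E.add (E.mul (x 2) (y 3)) (E.neg (E.mul (x 3) (y 2)))))
      else if i.1 = 2 then
        E.add (E.mul (x 0) (y 2)) (E.add (E.neg (E.mul (x 1) (y 3)))
          (E.add (E.mul (x 2) (y 0)) (E.mul (x 3) (y 1))))
      else
        E.add (E.mul (x 0) (y 3)) (E.add (E.mul (x 1) (y 2))
          (E.add (E.neg (E.mul (x 2) (y 1))) (E.mul (x 3) (y 0))))

/-- Multiplication in the matrix algebra `M_k(D)` where `D` is the division algebra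
of kind `d` over the definable field `E`; elements are encoded as tuples in
`N^(k·k·dim D)`. -/
def matAlgMul {S : Struc N} (E : OMinFieldExp S) (d : DivKind) (k : ℕ)
    (x y : Fin (k * k * dkDim d) → N) : Fin (k * k * dkDim d) → N :=
  fun p =>
    ((List.ofFn (fun l : Fin k =>
        dkMul E d (fun cc => x (finIdx (finIdx (pFst (pFst p)) l) cc))
          (fun cc => y (finIdx (finIdx l (pSnd (pFst p))) cc)))).foldr
      (fun v w i => E.add (v i) (w i)) (fun _ => E.zero)) (pSnd p)

/-- `(F, +, ·, 0, 1, −, ⁻¹, <)` is a real closed ordered field structure on the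
subset `F ⊆ N^k`. -/
def IsRCFOn {k : ℕ} (F : Set (Fin k → N))
    (fadd fmul : (Fin k → N) → (Fin k → N) → (Fin k → N)) (fzero fone : Fin k → N)
    (fneg finv : (Fin k → N) → (Fin k → N))
    (flt : (Fin k → N) → (Fin k → N) → Prop) : Prop :=
  fzero ∈ F ∧ fone ∈ F ∧ fzero ≠ fone ∧
  (∀ x ∈ F, ∀ y ∈ F, fadd x y ∈ F ∧ fmul x y ∈ F) ∧
  (∀ x ∈ F, fneg x ∈ F ∧ finv x ∈ F) ∧
  (∀ x ∈ F, ∀ y ∈ F, ∀ z ∈ F, fadd (fadd x y) z = fadd x (fadd y z)) ∧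
  (∀ x ∈ F, ∀ y ∈ F, fadd x y = fadd y x) ∧
  (∀ x ∈ F, fadd fzero x = x) ∧
  (∀ x ∈ F, fadd (fneg x) x = fzero) ∧
  (∀ x ∈ F, ∀ y ∈ F, ∀ z ∈ F, fmul (fmul x y) z = fmul x (fmul y z)) ∧
  (∀ x ∈ F, ∀ y ∈ F, fmul x y = fmul y x) ∧
  (∀ x ∈ F, fmul fone x = x) ∧
  (∀ x ∈ F, x ≠ fzero → fmul (finv x) x = fone) ∧
  (∀ x ∈ F, ∀ y ∈ F, ∀ z ∈ F, fmul x (fadd y z) = fadd (fmul x y) (fmul x z)) ∧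
  (∀ x ∈ F, ∀ y ∈ F, flt x y ∨ x = y ∨ flt y x) ∧
  (∀ x ∈ F, ¬ flt x x) ∧
  (∀ x ∈ F, ∀ y ∈ F, ∀ z ∈ F, flt x y → flt y z → flt x z) ∧
  (∀ x ∈ F, ∀ y ∈ F, ∀ z ∈ F, flt y z → flt (fadd x y) (fadd x z)) ∧
  (∀ x ∈ F, ∀ y ∈ F, flt fzero x → flt fzero y → flt fzero (fmul x y)) ∧
  (∀ x ∈ F, (flt fzero x ∨ x = fzero) → ∃ y ∈ F, fmul y y = x) ∧
  (∀ n : ℕ, Odd n → ∀ c : Fin (n + 1) → (Fin k → N), (∀ i, c i ∈ F) →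
      c (Fin.last n) ≠ fzero → ∃ x ∈ F, polyEval fadd fmul fzero c x = fzero)

end Groups

end OMinPreamble

universe v w

namespace OMin

set_option linter.unusedSectionVars false

section Toolkit

set_option linter.style.haveILetI false
variable {N : Type u} [LinearOrder N] {S : Struc N}

theorem def_union {m : ℕ} {A B : Set (Fin m → N)} (hA : S.Def m A) (hB : S.Def m B) :
    S.Def m (A ∪ B) := by
  have := S.def_compl (S.def_inter (S.def_compl hA) (S.def_compl hB))
  rwa [Set.compl_inter, compl_compl, compl_compl] at this

theorem def_congr {m : ℕ} {A B : Set (Fin m → N)} (h : S.Def m A) (e : ∀ x, x ∈ B ↔ x ∈ A) :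
    S.Def m B := by
  have : B = A := Set.ext e
  rwa [this]

theorem def_diff {m : ℕ} {A B : Set (Fin m → N)} (hA : S.Def m A) (hB : S.Def m B) :
    S.Def m (A \ B) := S.def_inter hA (S.def_compl hB)

theorem def_iInter_fin {m k : ℕ} {A : Fin k → Set (Fin m → N)} (h : ∀ i, S.Def m (A i)) :
    S.Def m {x | ∀ i, x ∈ A i} := by
  induction k with
  | zero => exact def_congr (S.def_univ m) (by simp)
  | succ k ih =>
    refine def_congr (S.def_inter (h 0) (ih fun i => h i.succ)) fun x => ?_
    simp [Fin.forall_fin_succ]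

theorem def_eq_coord {m : ℕ} (i j : Fin m) : S.Def m {x | x i = x j} := by
  have h1 := S.def_compl (S.def_reindex (![i, j] : Fin 2 → Fin m) S.def_lt)
  have h2 := S.def_compl (S.def_reindex (![j, i] : Fin 2 → Fin m) S.def_lt)
  refine def_congr (S.def_inter h1 h2) fun x => ?_
  simp [le_antisymm_iff, and_comm]

theorem def_coord_pt {m : ℕ} (i : Fin m) (c : N) : S.Def m {x | x i = c} :=
  def_congr (S.def_reindex (fun _ : Fin 1 => i) (S.def_pt c)) fun x => by simp

theorem def_projN {m n : ℕ} {A : Set (Fin (m + n) → N)} (h : S.Def (m + n) A) :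
    S.Def m {x | ∃ t : Fin n → N, Fin.append x t ∈ A} := by
  induction n with
  | zero =>
    refine def_congr (A := A) h fun x => ?_
    constructor
    · rintro ⟨t, ht⟩
      convert ht
      ext i
      exact (Fin.append_left x t i).symm
    · intro hx
      refine ⟨Fin.elim0, ?_⟩
      convert hx
      ext i
      exact Fin.append_left x _ i
  | succ n ih =>
    refine def_congr (ih (S.def_proj (m := m + n) h)) fun x => ?_
    constructor
    · rintro ⟨t, ht⟩
      refine ⟨Fin.init t, t (Fin.last n), ?_⟩
      rw [← Fin.append_snoc, Fin.snoc_init_self]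
      exact ht
    · rintro ⟨t, s, hs⟩
      refine ⟨Fin.snoc t s, ?_⟩
      rw [Fin.append_snoc]
      exact hs

@[simp] theorem append_comp_castAdd {m n : ℕ} {α : Type*} (x : Fin m → α) (y : Fin n → α) :
    Fin.append x y ∘ Fin.castAdd n = x := by
  ext i; simp

@[simp] theorem append_comp_natAdd {m n : ℕ} {α : Type*} (x : Fin m → α) (y : Fin n → α) :
    Fin.append x y ∘ Fin.natAdd m = y := by
  ext i; simp

theorem def_subst {m n : ℕ} {A : Set (Fin (m + n) → N)} (h : S.Def (m + n) A) (b : Fin n → N) :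
    S.Def m {x | Fin.append x b ∈ A} := by
  have h1 : S.Def (m + n) {z | ∀ i, z ∈ {z : Fin (m + n) → N | z (Fin.natAdd m i) = b i}} :=
    def_iInter_fin fun i => def_coord_pt _ _
  refine def_congr (def_projN (S.def_inter h h1)) fun x => ?_
  constructor
  · intro hx
    exact ⟨b, hx, by simp⟩
  · rintro ⟨t, ht, ht'⟩
    have : t = b := by
      ext i
      simpa using ht' i
    subst this
    exact ht

theorem comp_addCases_castAdd {α : Type*} {a b k : ℕ} (f : Fin a → Fin k) (g : Fin b → Fin k)
    (x : Fin k → α) :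
    (x ∘ Fin.addCases (motive := fun _ => Fin k) f g) ∘ Fin.castAdd b = x ∘ f := by
  ext i; simp

theorem comp_addCases_natAdd {α : Type*} {a b k : ℕ} (f : Fin a → Fin k) (g : Fin b → Fin k)
    (x : Fin k → α) :
    (x ∘ Fin.addCases (motive := fun _ => Fin k) f g) ∘ Fin.natAdd a = x ∘ g := by
  ext i; simp only [Function.comp_apply, Fin.addCases_right]

/-- An interpretation of the type `Γ` in the structure `S`: elements are represented by tuples,
with definable equality of represented elements. -/
class Interp (S : Struc N) (Γ : Type v) where
  n : ℕ
  rel : (Fin n → N) → Γ → Prop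
  surj : ∀ γ, ∃ a, rel a γ
  uniq : ∀ {a γ γ'}, rel a γ → rel a γ' → γ = γ'
  eq_def : S.Def (n + n) {z | ∃ γ, rel (z ∘ Fin.castAdd n) γ ∧ rel (z ∘ Fin.natAdd n) γ}

/-- The arity of an interpretation. -/
abbrev ar (S : Struc N) (Γ : Type v) [Interp S Γ] : ℕ := Interp.n S Γ

/-- The representation relation. -/
abbrev rp (S : Struc N) {Γ : Type v} [Interp S Γ] (a : Fin (ar S Γ) → N) (γ : Γ) : Prop :=
  Interp.rel a γ

/-- Definable predicates on interpreted types. -/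
def DefP (S : Struc N) {Γ : Type v} [Interp S Γ] (P : Γ → Prop) : Prop :=
  S.Def (ar S Γ) {a | ∃ γ, rp S a γ ∧ P γ}

/-- Definable maps between interpreted types. -/
@[fun_prop]
def DefMap (S : Struc N) {Γ : Type v} {Δ : Type w} [Interp S Γ] [Interp S Δ] (f : Γ → Δ) : Prop :=
  S.Def (ar S Γ + ar S Δ)
    {z | ∃ γ, rp S (z ∘ Fin.castAdd _) γ ∧ rp S (z ∘ Fin.natAdd _) (f γ)}

section Basic
variable {Γ : Type*} {Δ : Type*} {E : Type*} [Interp S Γ] [Interp S Δ] [Interp S E]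

theorem def_dom (S : Struc N) (Γ : Type*) [Interp S Γ] :
    S.Def (ar S Γ) {a | ∃ γ : Γ, rp S a γ} := by
  refine def_congr (S.def_reindex (Fin.addCases id id) (Interp.eq_def (S := S) (Γ := Γ)))
    fun x => ?_
  have h1 : (x ∘ Fin.addCases id id) ∘ Fin.castAdd (Interp.n S Γ) = x := comp_addCases_castAdd _ _ x
  have h2 : (x ∘ Fin.addCases id id) ∘ Fin.natAdd (Interp.n S Γ) = x := comp_addCases_natAdd _ _ x
  simp only [Set.mem_ofPred_eq, h1, h2, and_self]

theorem def_rel_const (c : Γ) : S.Def (ar S Γ) {a | rp S a c} := by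
  obtain ⟨b, hb⟩ := Interp.surj (S := S) c
  refine def_congr (def_subst (Interp.eq_def (S := S) (Γ := Γ)) b) fun x => ?_
  simp only [Set.mem_ofPred_eq, append_comp_castAdd, append_comp_natAdd]
  constructor
  · intro h; exact ⟨c, h, hb⟩
  · rintro ⟨γ, h, h'⟩
    rw [Interp.uniq hb h']; exact h

instance instInterpProd : Interp S (Γ × Δ) where
  n := ar S Γ + ar S Δ
  rel a p := rp S (a ∘ Fin.castAdd _) p.1 ∧ rp S (a ∘ Fin.natAdd _) p.2
  surj := fun ⟨γ, δ⟩ => by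
    obtain ⟨a, ha⟩ := Interp.surj (S := S) γ
    obtain ⟨b, hb⟩ := Interp.surj (S := S) δ
    exact ⟨Fin.append a b, by simpa using ha, by simpa using hb⟩
  uniq := fun h h' => Prod.ext (Interp.uniq h.1 h'.1) (Interp.uniq h.2 h'.2)
  eq_def := by
    have h1 := S.def_reindex (Fin.addCases (fun i => Fin.castAdd _ (Fin.castAdd _ i))
      (fun i => Fin.natAdd _ (Fin.castAdd _ i)) :
        Fin (ar S Γ + ar S Γ) → Fin ((ar S Γ + ar S Δ) + (ar S Γ + ar S Δ)))
        (Interp.eq_def (S := S) (Γ := Γ))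
    have h2 := S.def_reindex (Fin.addCases (fun i => Fin.castAdd _ (Fin.natAdd _ i))
      (fun i => Fin.natAdd _ (Fin.natAdd _ i)) :
        Fin (ar S Δ + ar S Δ) → Fin ((ar S Γ + ar S Δ) + (ar S Γ + ar S Δ)))
        (Interp.eq_def (S := S) (Γ := Δ))
    refine def_congr (S.def_inter h1 h2) fun x => ?_
    simp only [Set.mem_ofPred_eq, Set.mem_inter_iff, comp_addCases_castAdd, comp_addCases_natAdd]
    constructor
    · rintro ⟨p, ⟨h1, h2⟩, h3, h4⟩
      exact ⟨⟨p.1, h1, h3⟩, ⟨p.2, h2, h4⟩⟩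
    · rintro ⟨⟨a, h1, h3⟩, ⟨b, h2, h4⟩⟩
      exact ⟨(a, b), ⟨h1, h2⟩, h3, h4⟩

theorem DefP.congr {P Q : Γ → Prop} (h : DefP S P) (e : ∀ x, Q x ↔ P x) : DefP S Q := by
  have : Q = P := funext fun x => propext (e x)
  rwa [this]

theorem DefP.and {P Q : Γ → Prop} (h : DefP S P) (h' : DefP S Q) : DefP S fun x => P x ∧ Q x := by
  refine def_congr (S.def_inter h h') fun a => ?_
  constructor
  · rintro ⟨γ, h1, h2, h3⟩; exact ⟨⟨γ, h1, h2⟩, γ, h1, h3⟩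
  · rintro ⟨⟨γ, h1, h2⟩, γ', h1', h3⟩
    obtain rfl := Interp.uniq h1 h1'
    exact ⟨γ, h1, h2, h3⟩

theorem DefP.not {P : Γ → Prop} (h : DefP S P) : DefP S fun x => ¬ P x := by
  refine def_congr (def_diff (def_dom S Γ) h) fun a => ?_
  constructor
  · rintro ⟨γ, h1, h2⟩
    refine ⟨⟨γ, h1⟩, ?_⟩
    rintro ⟨γ', h1', h3⟩
    obtain rfl := Interp.uniq h1 h1'
    exact h2 h3
  · rintro ⟨⟨γ, h1⟩, h2⟩
    exact ⟨γ, h1, fun h => h2 ⟨γ, h1, h⟩⟩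

theorem DefP.or {P Q : Γ → Prop} (h : DefP S P) (h' : DefP S Q) : DefP S fun x => P x ∨ Q x :=
  (h.not.and h'.not).not.congr fun x => by tauto

theorem DefP.imp {P Q : Γ → Prop} (h : DefP S P) (h' : DefP S Q) : DefP S fun x => P x → Q x :=
  (h.and h'.not).not.congr fun x => by tauto

theorem DefP.iff {P Q : Γ → Prop} (h : DefP S P) (h' : DefP S Q) : DefP S fun x => P x ↔ Q x :=
  ((h.imp h').and (h'.imp h)).congr fun x => by tauto

theorem DefP.exists' {P : Γ × Δ → Prop} (h : DefP S P) : DefP S fun x => ∃ y, P (x, y) := by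
  refine def_congr (def_projN h) fun a => ?_
  constructor
  · rintro ⟨γ, h1, δ, h2⟩
    obtain ⟨b, hb⟩ := Interp.surj (S := S) δ
    exact ⟨b, (γ, δ), ⟨by simpa using h1, by simpa using hb⟩, h2⟩
  · rintro ⟨b, ⟨γ, δ⟩, ⟨h1, h2⟩, h3⟩
    exact ⟨γ, by simpa using h1, δ, h3⟩

theorem DefP.forall' {P : Γ × Δ → Prop} (h : DefP S P) : DefP S fun x => ∀ y, P (x, y) :=
  (DefP.exists' h.not).not.congr fun x => by simp

theorem DefP.eq : DefP S fun p : Γ × Γ => p.1 = p.2 := by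
  refine def_congr (Interp.eq_def (S := S) (Γ := Γ)) fun a => ?_
  constructor
  · rintro ⟨⟨x, y⟩, ⟨h1, h2⟩, h3⟩
    obtain rfl : x = y := h3
    exact ⟨x, h1, h2⟩
  · rintro ⟨x, h1, h2⟩
    exact ⟨(x, x), ⟨h1, h2⟩, rfl⟩

theorem DefP.comp {P : Δ → Prop} {f : Γ → Δ} (hP : DefP S P) (hf : DefMap S f) :
    DefP S fun x => P (f x) := by
  refine def_congr (def_projN (S.def_inter hf (S.def_reindex (Fin.natAdd _) hP))) fun a => ?_
  constructor
  · rintro ⟨γ, h1, h2⟩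
    obtain ⟨b, hb⟩ := Interp.surj (S := S) (f γ)
    exact ⟨b, ⟨γ, by simpa using h1, by simpa using hb⟩, ⟨f γ, by simpa using hb, h2⟩⟩
  · rintro ⟨b, ⟨γ, h1, h2⟩, ⟨δ, h3, h4⟩⟩
    simp only [append_comp_castAdd, append_comp_natAdd] at h1 h2 h3
    obtain rfl := Interp.uniq h2 h3
    exact ⟨γ, h1, h4⟩

@[fun_prop]
theorem DefMap.id : DefMap S (fun x : Γ => x) := Interp.eq_def

@[fun_prop]
theorem DefMap.const (c : Δ) : DefMap S (fun _ : Γ => c) := by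
  refine def_congr (S.def_inter (S.def_reindex (Fin.castAdd _) (def_dom S Γ))
    (S.def_reindex (Fin.natAdd _) (def_rel_const c))) fun z => ?_
  simp only [Set.mem_ofPred_eq, Set.mem_inter_iff, exists_and_right]

@[fun_prop]
theorem DefMap.comp {f : Δ → E} {g : Γ → Δ} (hf : DefMap S f) (hg : DefMap S g) :
    DefMap S (fun x => f (g x)) := by
  have h1 := S.def_reindex (Fin.addCases (fun i => Fin.castAdd _ (Fin.castAdd _ i))
      (fun i => Fin.natAdd _ i) :
        Fin (ar S Γ + ar S Δ) → Fin ((ar S Γ + ar S E) + ar S Δ)) hg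
  have h2 := S.def_reindex (Fin.addCases (fun i => Fin.natAdd _ i)
      (fun i => Fin.castAdd _ (Fin.natAdd _ i)) :
        Fin (ar S Δ + ar S E) → Fin ((ar S Γ + ar S E) + ar S Δ)) hf
  refine def_congr (def_projN (S.def_inter h1 h2)) fun z => ?_
  have e3 : ∀ t : Fin (ar S Δ) → N, (Fin.append z t ∘
      fun i => Fin.castAdd (ar S Δ) (Fin.castAdd (ar S E) i)) = z ∘ Fin.castAdd (ar S E) := by
    intro t; ext i; simp
  have e4 : ∀ t : Fin (ar S Δ) → N, (Fin.append z t ∘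
      fun i => Fin.castAdd (ar S Δ) (Fin.natAdd (ar S Γ) i)) = z ∘ Fin.natAdd (ar S Γ) := by
    intro t; ext i; simp
  have e5 : ∀ t : Fin (ar S Δ) → N, (Fin.append z t ∘
      fun i => Fin.natAdd (ar S Γ + ar S E) i) = t := by
    intro t; ext i; simp
  simp only [Set.mem_ofPred_eq, Set.mem_inter_iff, comp_addCases_castAdd, comp_addCases_natAdd, e3, e4, e5]
  constructor
  · rintro ⟨γ, h1, h2⟩
    obtain ⟨b, hb⟩ := Interp.surj (S := S) (g γ)
    exact ⟨b, ⟨γ, h1, hb⟩, ⟨g γ, hb, h2⟩⟩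
  · rintro ⟨b, ⟨γ, h1, h2⟩, ⟨δ, h3, h4⟩⟩
    obtain rfl := Interp.uniq h2 h3
    exact ⟨γ, h1, h4⟩

theorem DefMap.prodMk {f : Γ → Δ} {g : Γ → E} (hf : DefMap S f) (hg : DefMap S g) :
    DefMap S (fun x => (f x, g x)) := by
  have h1 := S.def_reindex (Fin.addCases (fun i => Fin.castAdd _ i)
      (fun i => Fin.natAdd _ (Fin.castAdd _ i)) :
        Fin (ar S Γ + ar S Δ) → Fin (ar S Γ + (ar S Δ + ar S E))) hf
  have h2 := S.def_reindex (Fin.addCases (fun i => Fin.castAdd _ i)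
      (fun i => Fin.natAdd _ (Fin.natAdd _ i)) :
        Fin (ar S Γ + ar S E) → Fin (ar S Γ + (ar S Δ + ar S E))) hg
  refine def_congr (S.def_inter h1 h2) fun z => ?_
  simp only [Set.mem_ofPred_eq, Set.mem_inter_iff, comp_addCases_castAdd, comp_addCases_natAdd]
  constructor
  · rintro ⟨γ, h1, h2, h3⟩
    exact ⟨⟨γ, h1, h2⟩, ⟨γ, h1, h3⟩⟩
  · rintro ⟨⟨γ, h1, h2⟩, ⟨γ', h3, h4⟩⟩
    obtain rfl := Interp.uniq h1 h3
    exact ⟨γ, h1, h2, h4⟩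

theorem DefMap.fst' : DefMap S (fun p : Γ × Δ => p.1) := by
  have h1 := S.def_reindex (Fin.castAdd (ar S Γ)) (def_dom S (Γ × Δ))
  have h2 := S.def_reindex (Fin.addCases (fun i => Fin.castAdd _ (Fin.castAdd _ i))
      (fun i => Fin.natAdd _ i) :
        Fin (ar S Γ + ar S Γ) → Fin ((ar S Γ + ar S Δ) + ar S Γ))
        (Interp.eq_def (S := S) (Γ := Γ))
  refine def_congr (S.def_inter h1 h2) fun z => ?_
  simp only [Set.mem_ofPred_eq, Set.mem_inter_iff, comp_addCases_castAdd, comp_addCases_natAdd]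
  constructor
  · rintro ⟨γ, h1, h2⟩
    exact ⟨⟨γ, h1⟩, ⟨γ.1, h1.1, h2⟩⟩
  · rintro ⟨⟨γ, h1⟩, ⟨γ', h3, h4⟩⟩
    obtain rfl := Interp.uniq h1.1 h3
    exact ⟨γ, h1, h4⟩

theorem DefMap.snd' : DefMap S (fun p : Γ × Δ => p.2) := by
  have h1 := S.def_reindex (Fin.castAdd (ar S Δ)) (def_dom S (Γ × Δ))
  have h2 := S.def_reindex (Fin.addCases (fun i => Fin.castAdd _ (Fin.natAdd _ i))
      (fun i => Fin.natAdd _ i) :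
        Fin (ar S Δ + ar S Δ) → Fin ((ar S Γ + ar S Δ) + ar S Δ))
        (Interp.eq_def (S := S) (Γ := Δ))
  refine def_congr (S.def_inter h1 h2) fun z => ?_
  simp only [Set.mem_ofPred_eq, Set.mem_inter_iff, comp_addCases_castAdd, comp_addCases_natAdd]
  constructor
  · rintro ⟨γ, h1, h2⟩
    exact ⟨⟨γ, h1⟩, ⟨γ.2, h1.2, h2⟩⟩
  · rintro ⟨⟨γ, h1⟩, ⟨γ', h3, h4⟩⟩
    obtain rfl := Interp.uniq h1.2 h3
    exact ⟨γ, h1, h4⟩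

attribute [fun_prop] DefMap.prodMk

@[fun_prop]
theorem DefMap.fst {f : Γ → Δ × E} (h : DefMap S f) : DefMap S (fun x => (f x).1) :=
  DefMap.comp DefMap.fst' h

@[fun_prop]
theorem DefMap.snd {f : Γ → Δ × E} (h : DefMap S f) : DefMap S (fun x => (f x).2) :=
  DefMap.comp DefMap.snd' h

/-- A map with definable graph predicate is definable. -/
theorem DefMap.of_graph {f : Γ → Δ} (h : DefP S fun p : Γ × Δ => f p.1 = p.2) : DefMap S f := by
  refine def_congr h fun z => ?_
  constructor
  · rintro ⟨γ, h1, h2⟩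
    exact ⟨(γ, f γ), ⟨h1, h2⟩, rfl⟩
  · rintro ⟨⟨γ, δ⟩, ⟨h1, h2⟩, h3⟩
    obtain rfl : f γ = δ := h3
    exact ⟨γ, h1, h2⟩

/-- The interpretation of a definable subset. -/
@[reducible] def Interp.sub (P : Γ → Prop) (h : DefP S P) : Interp S {γ // P γ} where
  n := ar S Γ
  rel a γ := rp S a γ.1
  surj γ := Interp.surj γ.1
  uniq h h' := Subtype.ext (Interp.uniq h h')
  eq_def := by
    refine def_congr (S.def_inter (Interp.eq_def (S := S) (Γ := Γ))
      (S.def_reindex (Fin.castAdd _) h)) fun z => ?_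
    constructor
    · rintro ⟨γ, h1, h2⟩
      exact ⟨⟨γ.1, h1, h2⟩, ⟨γ.1, h1, γ.2⟩⟩
    · rintro ⟨⟨γ, h1, h2⟩, ⟨γ', h3, h4⟩⟩
      obtain rfl := Interp.uniq h1 h3
      exact ⟨⟨γ, h4⟩, h1, h2⟩

theorem DefMap.val {P : Γ → Prop} (h : DefP S P) :
    letI := Interp.sub P h; DefMap S (fun x : {γ // P γ} => x.1) := by
  letI := Interp.sub P h
  exact def_congr (Interp.eq_def (S := S) (Γ := {γ // P γ})) fun z => by
    constructor
    · rintro ⟨γ, h1, h2⟩; exact ⟨γ, h1, h2⟩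
    · rintro ⟨γ, h1, h2⟩; exact ⟨γ, h1, h2⟩

/-- The interpretation of a definable quotient. -/
@[reducible] def Interp.ofSurj (f : Γ → E) (hf : Function.Surjective f)
    (h : DefP S fun p : Γ × Γ => f p.1 = f p.2) : Interp S E where
  n := ar S Γ
  rel a e := ∃ γ, rp S a γ ∧ f γ = e
  surj e := by
    obtain ⟨γ, rfl⟩ := hf e
    obtain ⟨a, ha⟩ := Interp.surj (S := S) γ
    exact ⟨a, γ, ha, rfl⟩
  uniq := by
    rintro a e e' ⟨γ, h1, rfl⟩ ⟨γ', h2, rfl⟩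
    rw [Interp.uniq h1 h2]
  eq_def := by
    refine def_congr h fun z => ?_
    constructor
    · rintro ⟨e, ⟨γ, h1, rfl⟩, ⟨γ', h2, h3⟩⟩
      exact ⟨(γ, γ'), ⟨h1, h2⟩, h3.symm⟩
    · rintro ⟨⟨γ, γ'⟩, ⟨h1, h2⟩, h3⟩
      exact ⟨f γ, ⟨γ, h1, rfl⟩, ⟨γ', h2, h3.symm⟩⟩

theorem DefMap.ofSurj (f : Γ → E) (hf : Function.Surjective f)
    (h : DefP S fun p : Γ × Γ => f p.1 = f p.2) :
    letI := Interp.ofSurj f hf h; DefMap S f := by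
  letI := Interp.ofSurj f hf h
  refine def_congr (h : S.Def (ar S Γ + ar S Γ) _) fun z => ?_
  constructor
  · rintro ⟨γ, h1, ⟨γ', h2, h3⟩⟩
    exact ⟨(γ, γ'), ⟨h1, h2⟩, h3.symm⟩
  · rintro ⟨⟨γ, γ'⟩, ⟨h1, h2⟩, h3⟩
    exact ⟨γ, h1, ⟨γ', h2, h3.symm⟩⟩

instance instInterpTuple (k : ℕ) : Interp S (Fin k → N) where
  n := k
  rel a γ := a = γ
  surj γ := ⟨γ, rfl⟩
  uniq h h' := h ▸ h'
  eq_def := by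
    refine def_congr (def_iInter_fin fun i : Fin k =>
      def_eq_coord (S := S) (Fin.castAdd k i) (Fin.natAdd k i)) fun z => ?_
    simp only [Set.mem_ofPred_eq]
    constructor
    · rintro ⟨γ, h1, h2⟩ i
      have := h1.trans h2.symm
      exact congrFun this i
    · intro h
      exact ⟨_, rfl, (funext h).symm⟩

instance instInterpBase : Interp S N where
  n := 1
  rel a t := a 0 = t
  surj t := ⟨fun _ => t, rfl⟩
  uniq h h' := h ▸ h'
  eq_def := by
    refine def_congr (def_eq_coord (S := S) (Fin.castAdd 1 0) (Fin.natAdd 1 0)) fun z => ?_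
    simp only [Set.mem_ofPred_eq]
    constructor
    · rintro ⟨γ, h1, h2⟩
      exact h1.trans h2.symm
    · intro h
      exact ⟨_, rfl, h.symm⟩

theorem defP_tuple {k : ℕ} {P : (Fin k → N) → Prop} : DefP S P ↔ S.Def k {x | P x} := by
  constructor
  · intro h
    exact def_congr h fun x => ⟨fun h => ⟨x, rfl, h⟩, by rintro ⟨_, rfl, h⟩; exact h⟩
  · intro h
    exact def_congr h fun x => ⟨by rintro ⟨_, rfl, h⟩; exact h, fun h => ⟨x, rfl, h⟩⟩

theorem defP_base {P : N → Prop} : DefP S P ↔ S.Def 1 {x | P (x 0)} := by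
  constructor
  · intro h
    exact def_congr h fun x => ⟨fun h => ⟨x 0, rfl, h⟩, by rintro ⟨_, rfl, h⟩; exact h⟩
  · intro h
    exact def_congr h fun x => ⟨by rintro ⟨_, rfl, h⟩; exact h, fun h => ⟨x 0, rfl, h⟩⟩

@[fun_prop]
theorem DefMap.tuple {k : ℕ} {f : Γ → Fin k → N} (h : ∀ i, DefMap S fun x => f x i) :
    DefMap S f := by
  have h1 := def_iInter_fin fun i : Fin k => S.def_reindex (Fin.addCases (fun i => Fin.castAdd _ i)
      (fun _ => Fin.natAdd _ i) : Fin (ar S Γ + 1) → Fin (ar S Γ + k)) (h i)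
  refine def_congr (S.def_inter (S.def_reindex (Fin.castAdd k) (def_dom S Γ)) h1) fun z => ?_
  constructor
  · rintro ⟨γ, h1, h2⟩
    refine ⟨⟨γ, h1⟩, fun i => ⟨γ, ?_, ?_⟩⟩
    · exact (congrArg (rp S · γ) (comp_addCases_castAdd _ _ z)).mpr h1
    · exact (congrArg (rp S · (f γ i)) (comp_addCases_natAdd _ _ z)).mpr (congrFun h2 i)
  · rintro ⟨⟨γ, h1⟩, h2⟩
    refine ⟨γ, h1, ?_⟩
    ext i
    obtain ⟨γ', h3, h4⟩ := h2 i
    replace h3 := (congrArg (rp S · γ') (comp_addCases_castAdd _ _ z)).mp h3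
    replace h4 := (congrArg (rp S · (f γ' i)) (comp_addCases_natAdd _ _ z)).mp h4
    obtain rfl := Interp.uniq h1 h3
    exact h4

@[fun_prop]
theorem DefMap.coord' {k : ℕ} (i : Fin k) : DefMap S fun x : Fin k → N => x i := by
  refine def_congr (def_eq_coord (S := S) (Fin.castAdd 1 i) (Fin.natAdd k 0)) fun z => ?_
  constructor
  · rintro ⟨x, rfl, h⟩
    exact h.symm
  · intro h
    exact ⟨_, rfl, Eq.symm h⟩

theorem DefMap.coord {k : ℕ} {f : Γ → Fin k → N} (hf : DefMap S f) (i : Fin k) :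
    DefMap S fun x => f x i := DefMap.comp (DefMap.coord' i) hf

theorem DefP.lt' : DefP S fun p : N × N => p.1 < p.2 := by
  refine def_congr S.def_lt fun z => ?_
  constructor
  · rintro ⟨⟨x, y⟩, ⟨h1, h2⟩, h3⟩
    obtain rfl : z 0 = x := h1
    obtain rfl : z 1 = y := h2
    exact h3
  · intro h
    exact ⟨(z 0, z 1), ⟨rfl, rfl⟩, h⟩

end Basic

section PropMaps
variable [Nontrivial N]
variable {Γ : Type*} {Δ : Type*} {E : Type*} [Interp S Γ] [Interp S Δ] [Interp S E]

instance instInterpProp : Interp S Prop where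
  n := 2
  rel a p := p ↔ a 0 = a 1
  surj p := by
    obtain ⟨x, y, h⟩ := exists_pair_ne N
    by_cases hp : p
    · exact ⟨fun _ => x, by simp [hp]⟩
    · exact ⟨![x, y], by simp [hp, h]⟩
  uniq h h' := propext (h.trans h'.symm)
  eq_def := by
    have h1 := def_eq_coord (S := S) (Fin.castAdd 2 (0 : Fin 2)) (Fin.castAdd 2 1)
    have h2 := def_eq_coord (S := S) (Fin.natAdd 2 (0 : Fin 2)) (Fin.natAdd 2 1)
    refine def_congr (def_union (S.def_inter h1 h2)
      (S.def_inter (S.def_compl h1) (S.def_compl h2))) fun z => ?_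
    simp only [Set.mem_ofPred_eq, Set.mem_union, Set.mem_inter_iff, Set.mem_compl_iff,
      Function.comp_apply]
    constructor
    · rintro ⟨p, h1, h2⟩
      rw [← h1, ← h2]
      tauto
    · intro h
      refine ⟨_, Iff.rfl, ?_⟩
      tauto

theorem defP_iff {P : Γ → Prop} : DefP S P ↔ DefMap S P := by
  constructor
  · intro h
    have h1 := S.def_reindex (Fin.castAdd 2) h
    have h0 := S.def_reindex (Fin.castAdd 2) (def_dom S Γ)
    have h2 := def_eq_coord (S := S) (Fin.natAdd (ar S Γ) 0) (Fin.natAdd (ar S Γ) (1 : Fin 2))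
    refine def_congr (def_union (S.def_inter h1 h2)
      (S.def_inter (def_diff h0 h1) (S.def_compl h2))) fun z => ?_
    constructor
    · rintro ⟨γ, h1, h2⟩
      by_cases hp : P γ
      · exact Or.inl ⟨⟨γ, h1, hp⟩, h2.1 hp⟩
      · refine Or.inr ⟨⟨⟨γ, h1⟩, ?_⟩, fun h => hp (h2.2 h)⟩
        rintro ⟨γ', h3, h4⟩
        obtain rfl := Interp.uniq h1 h3
        exact hp h4
    · rintro (⟨⟨γ, h1, h2⟩, h3⟩ | ⟨⟨⟨γ, h1⟩, h2⟩, h3⟩)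
      · exact ⟨γ, h1, ⟨fun _ => h3, fun _ => h2⟩⟩
      · exact ⟨γ, h1, ⟨fun h => absurd ⟨γ, h1, h⟩ h2, fun h => absurd h h3⟩⟩
  · intro h
    have h3 : DefP S fun p : Prop => p := by
      refine def_congr (def_eq_coord (S := S) (m := 2) 0 1) fun z => ?_
      constructor
      · rintro ⟨p, h1, h2⟩
        exact h1.1 h2
      · intro h
        exact ⟨True, ⟨fun _ => h, fun _ => trivial⟩, trivial⟩
    exact DefP.comp (P := fun p : Prop => p) (f := P) h3 h

@[fun_prop]
theorem DefMap.and {P Q : Γ → Prop} (h : DefMap S P) (h' : DefMap S Q) :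
    DefMap S fun x => P x ∧ Q x := defP_iff.1 ((defP_iff.2 h).and (defP_iff.2 h'))
@[fun_prop]
theorem DefMap.or {P Q : Γ → Prop} (h : DefMap S P) (h' : DefMap S Q) :
    DefMap S fun x => P x ∨ Q x := defP_iff.1 ((defP_iff.2 h).or (defP_iff.2 h'))
@[fun_prop]
theorem DefMap.not {P : Γ → Prop} (h : DefMap S P) :
    DefMap S fun x => ¬ P x := defP_iff.1 (defP_iff.2 h).not
@[fun_prop]
theorem DefMap.iff {P Q : Γ → Prop} (h : DefMap S P) (h' : DefMap S Q) :
    DefMap S fun x => P x ↔ Q x := defP_iff.1 ((defP_iff.2 h).iff (defP_iff.2 h'))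
@[fun_prop]
theorem DefMap.imp {P Q : Γ → Prop} (h : DefMap S P) (h' : DefMap S Q) :
    DefMap S fun x => P x → Q x := defP_iff.1 ((defP_iff.2 h).imp (defP_iff.2 h'))
@[fun_prop]
theorem DefMap.ex {P : Γ → Δ → Prop} (h : DefMap S fun p : Γ × Δ => P p.1 p.2) :
    DefMap S fun x => ∃ y, P x y := defP_iff.1 (DefP.exists' (defP_iff.2 h))
@[fun_prop]
theorem DefMap.all {P : Γ → Δ → Prop} (h : DefMap S fun p : Γ × Δ => P p.1 p.2) :
    DefMap S fun x => ∀ y, P x y := defP_iff.1 (DefP.forall' (defP_iff.2 h))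
@[fun_prop]
theorem DefMap.eq {f g : Γ → Δ} (hf : DefMap S f) (hg : DefMap S g) :
    DefMap S fun x => f x = g x := defP_iff.1 (DefP.comp DefP.eq (hf.prodMk hg))
@[fun_prop]
theorem DefMap.ne {f g : Γ → Δ} (hf : DefMap S f) (hg : DefMap S g) :
    DefMap S fun x => f x ≠ g x := (hf.eq hg).not
@[fun_prop]
theorem DefMap.lt {f g : Γ → N} (hf : DefMap S f) (hg : DefMap S g) :
    DefMap S fun x => f x < g x := defP_iff.1 (DefP.comp DefP.lt' (hf.prodMk hg))
@[fun_prop]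
theorem DefMap.le {f g : Γ → N} (hf : DefMap S f) (hg : DefMap S g) :
    DefMap S fun x => f x ≤ g x := by
  have := (hg.lt hf).not
  simpa only [not_lt] using this

theorem DefMap.snoc {d : ℕ} {f : Γ → Fin d → N} {g : Γ → N} (hf : DefMap S f) (hg : DefMap S g) :
    DefMap S fun x => (Fin.snoc (f x) (g x) : Fin (d + 1) → N) := by
  refine DefMap.tuple fun i => ?_
  refine Fin.lastCases ?_ (fun i => ?_) i
  · simpa using hg
  · simpa using hf.coord i

theorem DefMap.congrP {P Q : Γ → Prop} (h : DefMap S P) (e : ∀ x, Q x ↔ P x) : DefMap S Q := by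
  have : Q = P := funext fun x => propext (e x)
  rwa [this]

theorem DefMap.allFin {k : ℕ} {P : Γ → Fin k → Prop} (h : ∀ i, DefMap S fun x => P x i) :
    DefMap S fun x => ∀ i, P x i := by
  induction k with
  | zero => exact (DefMap.const True).congrP (by simp)
  | succ k ih =>
    exact ((h 0).and (ih fun i => h i.succ)).congrP fun x => by simp [Fin.forall_fin_succ]

theorem DefMap.exFin {k : ℕ} {P : Γ → Fin k → Prop} (h : ∀ i, DefMap S fun x => P x i) :
    DefMap S fun x => ∃ i, P x i :=
  (DefMap.allFin fun i => (h i).not).not.congrP fun x => by simp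

theorem DefMap.update {d : ℕ} {f : Γ → Fin d → N} {g : Γ → N} (hf : DefMap S f) (l : Fin d)
    (hg : DefMap S g) : DefMap S fun x => Function.update (f x) l (g x) := by
  refine DefMap.tuple fun i => ?_
  by_cases h : i = l
  · subst h; simpa using hg
  · simpa [Function.update_of_ne h] using hf.coord i

attribute [fun_prop] DefMap.snoc DefMap.update

end PropMaps

end Toolkit

section OneVar

variable {N : Type u} [LinearOrder N] [DenselyOrdered N] [NoMinOrder N] [NoMaxOrder N] [Nonempty N]
  {S : Struc N}

/-- Membership in `A` is constant on intervals avoiding a finite set. -/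
def Tame (A : Set N) : Prop :=
  ∃ F : Set N, F.Finite ∧ ∀ a b, a ≤ b → (∀ f ∈ F, ¬ (a ≤ f ∧ f ≤ b)) → (a ∈ A ↔ b ∈ A)

theorem Tame.of_isFinUnion {A : Set N} (h : IsFinUnionPtsIntervals A) : Tame A := by
  obtain ⟨k, f, hf, rfl⟩ := h
  have key : ∀ i, Tame (f i) := by
    intro i
    rcases hf i with ⟨a, h⟩ | ⟨a, b, h⟩ | ⟨a, h⟩ | ⟨b, h⟩ | h
    · refine ⟨{a}, Set.finite_singleton _, fun x y hxy h' => ?_⟩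
      have := h' a rfl
      rw [h, Set.mem_singleton_iff, Set.mem_singleton_iff]
      constructor <;> rintro rfl <;> exact absurd ⟨by order, by order⟩ this
    · refine ⟨{a, b}, by simp, fun x y hxy h' => ?_⟩
      have h1 := h' a (by simp)
      have h2 := h' b (by simp)
      rw [h, Set.mem_Ioo, Set.mem_Ioo]
      rw [not_and_or, not_le, not_le] at h1 h2
      constructor
      · rintro ⟨h3, h4⟩
        rcases h1 with h1 | h1 <;> rcases h2 with h2 | h2 <;> constructor <;> order
      · rintro ⟨h3, h4⟩
        rcases h1 with h1 | h1 <;> rcases h2 with h2 | h2 <;> constructor <;> order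
    · refine ⟨{a}, by simp, fun x y hxy h' => ?_⟩
      have h1 := h' a (by simp)
      rw [h, Set.mem_Ioi, Set.mem_Ioi]
      rw [not_and_or, not_le, not_le] at h1
      constructor
      · intro h3
        rcases h1 with h1 | h1 <;> order
      · intro h3
        rcases h1 with h1 | h1 <;> order
    · refine ⟨{b}, by simp, fun x y hxy h' => ?_⟩
      have h1 := h' b (by simp)
      rw [h, Set.mem_Iio, Set.mem_Iio]
      rw [not_and_or, not_le, not_le] at h1
      constructor
      · intro h3
        rcases h1 with h1 | h1 <;> order
      · intro h3
        rcases h1 with h1 | h1 <;> order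
    · exact ⟨∅, by simp, fun x y _ _ => by simp [h]⟩
  choose F hF hF' using key
  refine ⟨⋃ i, F i, Set.finite_iUnion hF, fun a b hab h => ?_⟩
  simp only [Set.mem_iUnion]
  exact exists_congr fun i => hF' i a b hab fun f hf => h f (Set.mem_iUnion.2 ⟨i, hf⟩)

theorem tame {P : N → Prop} (hP : DefMap S P) : Tame {x | P x} :=
  Tame.of_isFinUnion (S.o_min (defP_base.1 (defP_iff.2 hP)))

/-- Between two points with the same cut in `F` there are no elements of `F`. -/
theorem no_mem_of_cut_eq {F : Set N} {x y : N}
    (h : F ∩ Iio x = F ∩ Iio y) : ∀ f ∈ F, ¬ (x ≤ f ∧ f < y) := by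
  rintro f hf ⟨h1, h2⟩
  have : f ∈ F ∩ Iio x := by rw [h]; exact ⟨hf, h2⟩
  exact absurd this.2 (not_lt.2 h1)

theorem exists_interval {P : N → Prop} (hP : DefMap S P) (hi : {x | P x}.Infinite) :
    ∃ a b, a < b ∧ ∀ x, a < x → x < b → P x := by
  obtain ⟨F, hF, hF'⟩ := tame hP
  have h1 : ({x | P x} \ F).Infinite := hi.sdiff hF
  have h2 : Set.MapsTo (fun x => F ∩ Iio x) ({x | P x} \ F) (𝒫 F) := fun x _ => inter_subset_left
  obtain ⟨x, hx, y, hy, hne, hxy⟩ := h1.exists_ne_map_eq_of_mapsTo h2 hF.finite_subsets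
  wlog hlt : x < y generalizing x y
  · exact this y hy x hx hne.symm hxy.symm (lt_of_le_of_ne (not_lt.1 hlt) hne.symm)
  refine ⟨x, y, hlt, fun z hz hz' => ?_⟩
  refine (hF' x z hz.le fun f hf hh => ?_).1 hx.1
  exact no_mem_of_cut_eq hxy f hf ⟨hh.1, hh.2.trans_lt hz'⟩

theorem infinite_iff {P : N → Prop} (hP : DefMap S P) :
    {x | P x}.Infinite ↔ ∃ a b, a < b ∧ ∀ x, a < x → x < b → P x := by
  refine ⟨exists_interval hP, ?_⟩
  rintro ⟨a, b, hab, h⟩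
  exact (Set.Ioo_infinite hab).mono fun x hx => h x hx.1 hx.2

section Fam
variable {Γ : Type*} [Interp S Γ]

theorem DefMap.section' {Δ : Type*} [Interp S Δ] {P : Γ → Δ → Prop} (h : DefMap S fun p : Γ × Δ => P p.1 p.2)
    (x : Γ) : DefMap S (P x) := by
  have : DefMap S fun y => (fun p : Γ × Δ => P p.1 p.2) (x, y) := by fun_prop
  exact this

@[fun_prop]
theorem DefMap.inf {P : Γ → N → Prop} (h : DefMap S fun p : Γ × N => P p.1 p.2) :
    DefMap S fun x => {y | P x y}.Infinite := by
  refine DefMap.congrP (P := fun x => ∃ a b, a < b ∧ ∀ y, a < y → y < b → P x y) (by fun_prop)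
    fun x => infinite_iff (h.section' x)

end Fam

theorem germ_right {P : N → Prop} (hP : DefMap S P) (x : N) :
    ∃ y, x < y ∧ ((∀ z, x < z → z < y → P z) ∨ (∀ z, x < z → z < y → ¬ P z)) := by
  obtain ⟨F, hF, hF'⟩ := tame hP
  have h1 : ∃ y, x < y ∧ ∀ f ∈ F, x < f → y ≤ f := by
    by_cases h : (F ∩ Ioi x).Nonempty
    · obtain ⟨f, hf, hf'⟩ := (hF.subset inter_subset_left).exists_minimal h
      refine ⟨f, hf.2, fun g hg hg' => ?_⟩
      by_contra hlt
      exact hlt (hf' ⟨hg, hg'⟩ (not_le.1 hlt).le)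
    · obtain ⟨y, hy⟩ := exists_gt x
      exact ⟨y, hy, fun f hf hf' => absurd ⟨f, hf, hf'⟩ h⟩
  obtain ⟨y, hy, hy'⟩ := h1
  have key : ∀ z w, x < z → z ≤ w → w < y → (P z ↔ P w) := fun z w h1 h2 h3 =>
    hF' z w h2 fun f hf hh => by
      have := hy' f hf (h1.trans_le hh.1)
      have := hh.2
      order
  refine ⟨y, hy, ?_⟩
  obtain ⟨c, hc, hc'⟩ := exists_between hy
  have key2 : ∀ z, x < z → z < y → (P z ↔ P c) := fun z h1 h2 => by
    rcases le_total z c with h | h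
    · exact key z c h1 h hc'
    · exact (key c z hc h h2).symm
  by_cases h : P c
  · exact Or.inl fun z h1 h2 => (key2 z h1 h2).2 h
  · exact Or.inr fun z h1 h2 hz => h ((key2 z h1 h2).1 hz)

theorem germ_left {P : N → Prop} (hP : DefMap S P) (x : N) :
    ∃ y, y < x ∧ ((∀ z, y < z → z < x → P z) ∨ (∀ z, y < z → z < x → ¬ P z)) := by
  obtain ⟨F, hF, hF'⟩ := tame hP
  have h1 : ∃ y, y < x ∧ ∀ f ∈ F, f < x → f ≤ y := by
    by_cases h : (F ∩ Iio x).Nonempty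
    · obtain ⟨f, hf, hf'⟩ := (hF.subset inter_subset_left).exists_maximal h
      refine ⟨f, hf.2, fun g hg hg' => ?_⟩
      by_contra hlt
      exact hlt (hf' ⟨hg, hg'⟩ (not_le.1 hlt).le)
    · obtain ⟨y, hy⟩ := exists_lt x
      exact ⟨y, hy, fun f hf hf' => absurd ⟨f, hf, hf'⟩ h⟩
  obtain ⟨y, hy, hy'⟩ := h1
  have key : ∀ z w, y < z → z ≤ w → w < x → (P z ↔ P w) := fun z w h1 h2 h3 =>
    hF' z w h2 fun f hf hh => by
      have := hy' f hf (hh.2.trans_lt h3)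
      have := hh.1
      order
  refine ⟨y, hy, ?_⟩
  obtain ⟨c, hc, hc'⟩ := exists_between hy
  have key2 : ∀ z, y < z → z < x → (P z ↔ P c) := fun z h1 h2 => by
    rcases le_total z c with h | h
    · exact key z c h1 h hc'
    · exact (key c z hc h h2).symm
  by_cases h : P c
  · exact Or.inl fun z h1 h2 => (key2 z h1 h2).2 h
  · exact Or.inr fun z h1 h2 hz => h ((key2 z h1 h2).1 hz)

theorem exists_dominate {α : Type*} [LinearOrder α] {P : α → Prop} (hne : ∃ x, P x) {F : Set α}
    (hF : F.Finite) (h : ∀ f ∈ F, ∃ x, P x ∧ f < x) : ∃ x, P x ∧ ∀ f ∈ F, f < x := by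
  induction F, hF using Set.Finite.induction_on with
  | empty => obtain ⟨a, ha⟩ := hne; exact ⟨a, ha, by simp⟩
  | @insert g F _ _ ih =>
    obtain ⟨a, h1, h2⟩ := ih fun f hf => h f (Set.mem_insert_of_mem _ hf)
    obtain ⟨x, hx, hgx⟩ := h g (Set.mem_insert _ _)
    rcases le_total x a with h | h
    · refine ⟨a, h1, ?_⟩
      rintro f (rfl | hf)
      · order
      · exact h2 f hf
    · refine ⟨x, hx, ?_⟩
      rintro f (rfl | hf)
      · exact hgx
      · exact (h2 f hf).trans_le h

theorem exists_lub {P : N → Prop} (hP : DefMap S P) (hne : ∃ x, P x) (hb : ∃ b, ∀ x, P x → x ≤ b) :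
    ∃ s, IsLUB {x | P x} s := by
  obtain ⟨F, hF, hF'⟩ := tame hP
  by_contra hno
  push Not at hno
  have hnomax : ∀ x, P x → ∃ y, P y ∧ x < y := by
    intro x hx
    by_contra hcon
    push Not at hcon
    exact hno x ⟨fun y hy => hcon y hy, fun u hu => hu hx⟩
  obtain ⟨a, ha, haF⟩ := exists_dominate hne (hF.subset (Set.sep_subset F fun f => ∃ x, P x ∧ f < x))
    fun f hf => hf.2
  obtain ⟨b, hb, hbF⟩ := exists_dominate (α := Nᵒᵈ) (P := fun b => ∀ x : N, P x → x ≤ b) hb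
    (hF.subset (Set.sep_subset F fun f => ∀ x, P x → x ≤ f)) fun f hf => by
      by_contra hcon
      push Not at hcon
      refine hno f ⟨fun y hy => hf.2 y hy, fun u hu => ?_⟩
      have := hcon u fun x hx => hu hx
      exact this
  replace hbF : ∀ f ∈ {f ∈ F | ∀ x, P x → x ≤ f}, @LT.lt N _ b f := hbF
  have hab := hb a ha
  have : P b := (hF' a b hab fun f hf hh => by
    by_cases h : ∃ x, P x ∧ f < x
    · have := haF f ⟨hf, h⟩
      exact absurd hh.1 (not_le.2 this)
    · push Not at h
      exact absurd hh.2 (not_le.2 (hbF f ⟨hf, h⟩))).1 ha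
  obtain ⟨y, hy, hby⟩ := hnomax b this
  exact absurd (hb y hy) (not_le.2 hby)

theorem exists_glb {P : N → Prop} (hP : DefMap S P) (hne : ∃ x, P x) (hb : ∃ b, ∀ x, P x → b ≤ x) :
    ∃ s, IsGLB {x | P x} s := by
  obtain ⟨s, hs⟩ := exists_lub (S := S) (P := fun b => ∀ x, P x → b ≤ x) (by fun_prop) hb
    (by obtain ⟨x, hx⟩ := hne; exact ⟨x, fun b hb => hb x hx⟩)
  exact ⟨s, isLUB_lowerBounds.1 hs⟩

theorem const_of_loc {P : N → Prop} (hP : DefMap S P) {x y : N} (hxy : x ≤ y)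
    (h : ∀ z, x ≤ z → z ≤ y → ∃ a b, a < z ∧ z < b ∧ ∀ t, x ≤ t → t ≤ y → a < t → t < b → (P t ↔ P z)) :
    P x ↔ P y := by
  obtain ⟨s, hs⟩ := exists_lub (S := S)
    (P := fun z => x ≤ z ∧ z ≤ y ∧ ∀ t, x ≤ t → t ≤ z → (P t ↔ P x)) (by fun_prop)
    ⟨x, le_rfl, hxy, fun t h1 h2 => by rw [le_antisymm h2 h1]⟩ ⟨y, fun z hz => hz.2.1⟩
  have hxs : x ≤ s := hs.1 ⟨le_rfl, hxy, fun t h1 h2 => by rw [le_antisymm h2 h1]⟩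
  have hsy : s ≤ y := hs.2 fun z hz => hz.2.1
  obtain ⟨a, b, has, hsb, hab⟩ := h s hxs hsy
  have h1 : ∃ z, a < z ∧ z ≤ s ∧ x ≤ z ∧ z ≤ y ∧ ∀ t, x ≤ t → t ≤ z → (P t ↔ P x) := by
    by_contra hcon
    push Not at hcon
    have : s ≤ a := hs.2 fun z hz => by
      by_contra hza
      obtain ⟨t, h1, h2, h3⟩ := hcon z (not_le.1 hza) (hs.1 hz) hz.1 hz.2.1
      have := hz.2.2 t h1 h2
      tauto
    order
  obtain ⟨z, haz, hzs, hxz, hzy, hz⟩ := h1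
  have hPs : P s ↔ P x := by rw [← hab z hxz hzy haz (by order), hz z hxz le_rfl]
  have hall : ∀ t, x ≤ t → t ≤ y → t < b → (P t ↔ P x) := fun t h1 h2 h3 => by
    rcases le_total t z with h | h
    · exact hz t h1 h
    · rw [hab t h1 h2 (by order) h3, hPs]
  rcases hsy.eq_or_lt with h | h
  · rw [← h, hPs]
  · obtain ⟨t, ht, ht'⟩ := exists_between (lt_min h hsb)
    have h2 : t ≤ s := hs.1 ⟨by order, (lt_min_iff.1 ht').1.le, fun r h1 h2 =>
      hall r h1 (h2.trans (lt_min_iff.1 ht').1.le) (h2.trans_lt (lt_min_iff.1 ht').2)⟩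
    order

/-- A finite set of representatives meeting all infinite locally constant definable subsets. -/
theorem exists_rep {A : N → Prop} (hA : DefMap S A) : ∃ R : Set N, R.Finite ∧ (∀ r ∈ R, A r) ∧
    ∀ C : N → Prop, DefMap S C → {x | C x ∧ A x}.Infinite →
      (∀ z, A z → ∃ a b, a < z ∧ z < b ∧ ∀ t, a < t → t < b → A t → (C t ↔ C z)) →
      ∃ r ∈ R, C r := by
  obtain ⟨F, hF, hF'⟩ := tame hA
  have h0 : ((fun x => F ∩ Iio x) '' ({x | A x} \ F)).Finite :=
    hF.finite_subsets.subset (by rintro _ ⟨x, _, rfl⟩; exact inter_subset_left)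
  obtain ⟨R, hRs, hRf, hR⟩ := Set.exists_subset_image_finite_and.1 ⟨_, subset_rfl, h0, rfl⟩
  refine ⟨R, hRf, fun r hr => (hRs hr).1, fun C hC hi hloc => ?_⟩
  obtain ⟨x, ⟨hxC, hxA⟩, hxF⟩ := (hi.sdiff hF).nonempty
  have : F ∩ Iio x ∈ (fun x => F ∩ Iio x) '' R := by
    rw [← hR]; exact ⟨x, ⟨hxA, hxF⟩, rfl⟩
  obtain ⟨r, hr, hrx⟩ := this
  refine ⟨r, hr, ?_⟩
  have key : ∀ u v, u ∉ F → v ∉ F → A u → F ∩ Iio u = F ∩ Iio v → u ≤ v → (C u ↔ C v) := by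
    intro u v hu hv hAu huv hle
    have hA' : ∀ t, u ≤ t → t ≤ v → A t := fun t h1 h2 => (hF' u t h1 fun f hf hh => by
      rcases (hh.2.trans h2).eq_or_lt with h | h
      · exact hv (h ▸ hf)
      · exact no_mem_of_cut_eq huv f hf ⟨hh.1, h⟩).1 hAu
    refine const_of_loc hC hle fun z h1 h2 => ?_
    obtain ⟨a, b, h3, h4, h5⟩ := hloc z (hA' z h1 h2)
    exact ⟨a, b, h3, h4, fun t h6 h7 h8 h9 => h5 t h8 h9 (hA' t h6 h7)⟩
  rcases le_total r x with h | h
  · exact (key r x (hRs hr).2 hxF (hRs hr).1 hrx h).2 hxC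
  · exact (key x r hxF (hRs hr).2 hxA hrx.symm h).1 hxC

end OneVar

section Box

variable {N : Type u} [LinearOrder N] [DenselyOrdered N] [NoMinOrder N] [NoMaxOrder N] [Nonempty N]
  {S : Struc N}

/-- If an interval of points satisfies `P`, either `P` holds on a whole end of the line or the
interval can be extended to a right end. -/
theorem exists_right_end {P : N → Prop} (hP : DefMap S P) (hi : {x | P x}.Infinite) :
    (∃ a, ∀ z, a < z → P z) ∨
      ∃ e, (∃ y, y < e ∧ ∀ z, y < z → z < e → P z) ∧
        ¬ (P e ∧ ∃ y, e < y ∧ ∀ z, e < z → z < y → P z) := by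
  obtain ⟨a, b, hab, h⟩ := exists_interval hP hi
  by_cases hb : ∃ u, ∀ t, (∀ z, a < z → z < t → P z) → t ≤ u
  · obtain ⟨e, he⟩ := exists_lub (S := S) (P := fun t => ∀ z, a < z → z < t → P z) (by fun_prop)
      ⟨b, h⟩ hb
    have hbe : b ≤ e := he.1 h
    have hae : ∀ z, a < z → z < e → P z := fun z hz hze => by
      by_contra hcon
      have : e ≤ z := he.2 fun t ht => by
        by_contra hlt
        exact hcon (ht z hz (not_le.1 hlt))
      order
    refine Or.inr ⟨e, ⟨a, by order, hae⟩, ?_⟩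
    rintro ⟨h1, y, hy, h2⟩
    have : y ≤ e := he.1 fun z h3 h4 => by
      rcases lt_trichotomy z e with h | h | h
      · exact hae z h3 h
      · exact h ▸ h1
      · exact h2 z h h4
    order
  · push Not at hb
    refine Or.inl ⟨a, fun z hz => ?_⟩
    obtain ⟨t, ht, hzt⟩ := hb z
    exact ht z hz hzt

theorem finite_of_disjoint {R : N → N → Prop} (hR : DefMap S fun p : N × N => R p.1 p.2)
    (hd : ∀ x x' y, R x y → R x' y → x = x') : {x | {y | R x y}.Infinite}.Finite := by
  by_contra hinf
  rw [Set.not_finite] at hinf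
  have lg : ∀ x x' e, (∃ y, y < e ∧ ∀ z, y < z → z < e → R x z) →
      (∃ y, y < e ∧ ∀ z, y < z → z < e → R x' z) → x = x' := by
    rintro x x' e ⟨y, hy, h⟩ ⟨y', hy', h'⟩
    obtain ⟨z, hz, hze⟩ := exists_between (max_lt hy hy')
    exact hd x x' z (h z (max_lt_iff.1 hz).1 hze) (h' z (max_lt_iff.1 hz).2 hze)
  let E : N → N → Prop := fun x e => (∃ y, y < e ∧ ∀ z, y < z → z < e → R x z) ∧
        ¬ (R x e ∧ ∃ y, e < y ∧ ∀ z, e < z → z < y → R x z)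
  have hT : DefMap S fun e => ∃ x, E x e := by simp only [E]; fun_prop
  by_cases hfin : {e | ∃ x, E x e}.Finite
  · have h1 : ({x | {y | R x y}.Infinite} \ {x | ∃ a, ∀ z, a < z → R x z}).Infinite := by
      refine hinf.sdiff (Set.Subsingleton.finite ?_)
      rintro x ⟨a, ha⟩ x' ⟨a', ha'⟩
      obtain ⟨z, hz⟩ := exists_gt (max a a')
      exact hd x x' z (ha z (max_lt_iff.1 hz).1) (ha' z (max_lt_iff.1 hz).2)
    have h2 : ∀ x, ∃ e, x ∈ ({x | {y | R x y}.Infinite} \ {x | ∃ a, ∀ z, a < z → R x z}) → E x e := by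
      intro x
      by_cases hx : x ∈ ({x | {y | R x y}.Infinite} \ {x | ∃ a, ∀ z, a < z → R x z})
      · rcases exists_right_end (hR.section' x) hx.1 with h | ⟨e, he⟩
        · exact absurd h hx.2
        · exact ⟨e, fun _ => he⟩
      · exact ⟨x, fun h => absurd h hx⟩
    choose f hf using h2
    obtain ⟨x, hx, y, hy, hne, hxy⟩ := h1.exists_ne_map_eq_of_mapsTo
      (f := f) (t := {e | ∃ x, E x e}) (fun x hx => ⟨x, hf x hx⟩) hfin
    refine hne (lg x y (f x) (hf x hx).1 ?_)
    rw [hxy]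
    exact (hf y hy).1
  · obtain ⟨c, d, hcd, h⟩ := exists_interval hT hfin
    obtain ⟨e, hce, hed⟩ := exists_between hcd
    obtain ⟨x, ⟨y, hy, hxy⟩, -⟩ := h e hce hed
    obtain ⟨z, hz, hze⟩ := exists_between (max_lt hy hce)
    obtain ⟨hyz, hcz⟩ := max_lt_iff.1 hz
    obtain ⟨x', h1, h2⟩ := h z hcz (hze.trans hed)
    have : x = x' := lg x x' z ⟨y, hyz, fun t h3 h4 => hxy t h3 (h4.trans hze)⟩ h1
    subst this
    exact h2 ⟨hxy z hyz hze, e, hze, fun t h3 h4 => hxy t (hyz.trans h3) h4⟩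

theorem finite_of_upclosed {I : Type*} [Interp S I] {K : I → N → Prop}
    (hK : DefMap S fun p : I × N => K p.1 p.2) (D : N → Prop) (Q : I → Prop) (hQ : DefMap S Q)
    (hD : ∀ a, D a → ∃ b, D b ∧ a < b) (p : N) (hp : ∀ a, D a → p ≤ a)
    (hKD : ∀ c, Q c → ∀ a, K c a → D a) (hne : ∀ c, Q c → ∃ a, K c a)
    (hup : ∀ c, Q c → ∀ a b, K c a → a < b → D b → K c b)
    (hfin : ∀ a, D a → {c | Q c ∧ K c a}.Finite) : {c | Q c}.Finite := by
  have hglb : ∀ c, ∃ s, Q c → IsGLB {x | K c x} s := by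
    intro c
    by_cases hc : Q c
    · obtain ⟨s, hs⟩ := exists_glb (hK.section' c) (hne c hc) ⟨p, fun x hx => hp x (hKD c hc x hx)⟩
      exact ⟨s, fun _ => hs⟩
    · exact ⟨p, fun h => absurd h hc⟩
  choose s hs using hglb
  have hIm : DefMap S fun t => ∃ c, Q c ∧ ((∀ x, K c x → t ≤ x) ∧
      ∀ u, (∀ x, K c x → u ≤ x) → u ≤ t) := by fun_prop
  have hIm' : ∀ t, (∃ c, Q c ∧ ((∀ x, K c x → t ≤ x) ∧
      ∀ u, (∀ x, K c x → u ≤ x) → u ≤ t)) ↔ ∃ c, Q c ∧ s c = t := by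
    refine fun t => exists_congr fun c => and_congr_right fun hc => ?_
    constructor
    · intro h
      have : IsGLB {x | K c x} t := ⟨fun x hx => h.1 x hx, fun u hu => h.2 u fun x hx => hu hx⟩
      exact (hs c hc).unique this
    · rintro rfl
      exact ⟨fun x hx => (hs c hc).1 hx, fun u hu => (hs c hc).2 fun x hx => hu x hx⟩
  replace hIm := hIm.congrP (Q := fun t => ∃ c, Q c ∧ s c = t) fun t => (hIm' t).symm
  have lt_mem : ∀ c, Q c → ∀ a, D a → s c < a → K c a := fun c hc a ha h => by
    by_contra hcon
    have : a ≤ s c := (hs c hc).2 fun x hx => by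
      by_contra hxa
      exact hcon (hup c hc x a hx (not_le.1 hxa) ha)
    order
  by_contra hinf
  rw [Set.not_finite] at hinf
  by_cases hfinI : {t | ∃ c, Q c ∧ s c = t}.Finite
  · have : ∃ t ∈ {t | ∃ c, Q c ∧ s c = t}, ({c | Q c} ∩ s ⁻¹' {t}).Infinite := by
      by_contra hcon
      push Not at hcon
      refine hinf ((hfinI.biUnion fun t ht => Set.not_infinite.1 (by simpa using hcon t ht)).subset
        fun c hc => Set.mem_biUnion (show s c ∈ {t | ∃ c, Q c ∧ s c = t} from ⟨c, hc, rfl⟩)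
          (show c ∈ {c | Q c} ∩ s ⁻¹' {s c} from ⟨hc, rfl⟩))
    obtain ⟨t, ⟨c, hc, rfl⟩, ht⟩ := this
    obtain ⟨k, hk⟩ := hne c hc
    obtain ⟨a, ha, hka⟩ := hD k (hKD c hc k hk)
    refine ht ((hfin a ha).subset fun c' hc' => ⟨hc'.1, ?_⟩)
    refine lt_mem c' hc'.1 a ha ?_
    have h1 : s c' = s c := hc'.2
    rw [h1]
    exact ((hs c hc).1 hk).trans_lt hka
  · obtain ⟨s1, s2, h12, h⟩ := exists_interval hIm hfinI
    obtain ⟨t, ht1, ht2⟩ := exists_between h12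
    obtain ⟨t', ht1', ht2'⟩ := exists_between ht1
    obtain ⟨c, hc, rfl⟩ := h t ht1 ht2
    obtain ⟨k, hk⟩ := hne c hc
    have hkD := hKD c hc k hk
    have hk' : s c ≤ k := (hs c hc).1 hk
    have : Set.Ioo s1 t' ⊆ s '' {c | Q c ∧ K c k} := by
      rintro r ⟨h1, h2⟩
      obtain ⟨c', hc', rfl⟩ := h r h1 (by order)
      exact ⟨c', ⟨hc', lt_mem c' hc' k hkD (by order)⟩, rfl⟩
    exact (Set.Ioo_infinite ht1') (((hfin k hkD).image s).subset this)

/-- Exchange of "infinitely many" with "there is". -/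
theorem exists_infinite_fiber {A : N → N → Prop} (hA : DefMap S fun p : N × N => A p.1 p.2)
    (hinf : {x | {y | A x y}.Infinite}.Infinite) : ∃ y, {x | A x y}.Infinite := by
  by_contra hcon
  push Not at hcon
  replace hcon : ∀ y, {x | A x y}.Finite := fun y => by simpa using hcon y
  obtain ⟨j1, j2, hj, hJ⟩ := exists_interval (hA.inf) hinf
  let Z : N → N → N → Prop := fun a x y => A x y ∧ ∀ x', a < x' → x' < x → ¬ A x' y
  let Bad : N → N → Prop := fun a x => {y | Z a x y}.Infinite
  have hZ : DefMap S fun p : N × N × N => Z p.1 p.2.1 p.2.2 := by simp only [Z]; fun_prop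
  have hBad : DefMap S fun p : N × N => Bad p.1 p.2 := by simp only [Bad]; fun_prop
  have badFin : ∀ a, {x | a < x ∧ Bad a x}.Finite := by
    intro a
    have := finite_of_disjoint (S := S) (R := fun x y => a < x ∧ Z a x y) (by fun_prop) (by
      rintro x x' y ⟨h1, h2⟩ ⟨h3, h4⟩
      rcases lt_trichotomy x x' with h | h | h
      · exact absurd h2.1 (h4.2 x h1 h)
      · exact h
      · exact absurd h4.1 (h2.2 x' h3 h))
    refine this.subset ?_
    rintro x ⟨h1, h2⟩
    exact h2.mono fun y hy => ⟨h1, hy⟩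
  have badUp : ∀ a b x, Bad a x → a < b → Bad b x := fun a b x h hab =>
    h.mono fun y hy => ⟨hy.1, fun x' h1 h2 => hy.2 x' (hab.trans h1) h2⟩
  by_cases hcase : ∃ x, j1 < x ∧ x < j2 ∧ ∀ a, j1 < a → a < x → ¬ Bad a x
  · obtain ⟨x, hx1, hx2, hx⟩ := hcase
    refine hJ x hx1 hx2 ?_
    refine finite_of_upclosed (S := S) (I := N) (K := fun y a => (j1 < a ∧ a < x) ∧ Z a x y)
      (by fun_prop) (fun a => j1 < a ∧ a < x) (fun y => A x y) (by fun_prop) ?_ j1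
      (fun a ha => ha.1.le) (fun c _ a h => h.1) ?_ ?_ ?_
    · rintro a ⟨h1, h2⟩
      obtain ⟨b, hb, hb'⟩ := exists_between h2
      exact ⟨b, ⟨h1.trans hb, hb'⟩, hb⟩
    · intro y hy
      obtain ⟨a, ha, ha'⟩ := exists_dominate (P := fun a => j1 < a ∧ a < x)
        (F := {x' | A x' y} ∩ Iio x ∩ Ioi j1)
        (exists_between hx1) (((hcon y).inter_of_left _).inter_of_left _) (by
          rintro f ⟨⟨-, hf⟩, hf'⟩
          obtain ⟨b, hb, hb'⟩ := exists_between (show f < x from hf)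
          exact ⟨b, ⟨lt_trans hf' hb, hb'⟩, hb⟩)
      refine ⟨a, ha, hy, fun x' h1 h2 h3 => ?_⟩
      have := ha' x' ⟨⟨h3, h2⟩, ha.1.trans h1⟩
      order
    · rintro y hy a b ⟨h1, h2⟩ hab hb
      exact ⟨hb, h2.1, fun x' h3 h4 => h2.2 x' (hab.trans h3) h4⟩
    · rintro a ⟨h1, h2⟩
      have := hx a h1 h2
      simp only [Bad, Set.not_infinite] at this
      exact this.subset fun y hy => hy.2.2
  · push Not at hcase
    let K : N → N → Prop := fun x a => j1 < a ∧ a < x ∧ Bad a x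
    have hK : DefMap S fun p : N × N => K p.1 p.2 := by simp only [K]; fun_prop
    let B : N → Prop := fun x => (j1 < x ∧ x < j2) ∧
      ∀ y, x < y → y < j2 → ∃ a, K x a ∧ ¬ K y a
    have hB : DefMap S B := by simp only [B]; fun_prop
    by_cases hfin : {x | B x}.Finite
    · obtain ⟨c, hc, hc'⟩ := exists_dominate (P := fun a => j1 < a ∧ a < j2) (F := {x | B x})
        (exists_between hj) hfin (by
          rintro f ⟨⟨h1, h2⟩, -⟩
          obtain ⟨b, hb, hb'⟩ := exists_between h2
          exact ⟨b, ⟨h1.trans hb, hb'⟩, hb⟩)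
      have hcB : ∀ x, c ≤ x → x < j2 → ∃ y, x < y ∧ y < j2 ∧ ∀ a, K x a → K y a := by
        intro x hx hx2
        by_contra hno
        push Not at hno
        have : B x := ⟨⟨hc.1.trans_le hx, hx2⟩, hno⟩
        have := hc' x this
        order
      obtain ⟨a, ha⟩ : ∃ a, K c a := by
        obtain ⟨a, h1, h2, h3⟩ := hcase c hc.1 hc.2
        exact ⟨a, h1, h2, h3⟩
      have hfin2 : {y | c < y ∧ y < j2 ∧ ∀ a, K c a → K y a}.Finite :=
        (badFin a).subset fun y hy => ⟨(hy.2.2 a ha).2.1, (hy.2.2 a ha).2.2⟩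
      obtain ⟨y0, hy0, hmax⟩ := hfin2.exists_maximal (hcB c le_rfl hc.2)
      obtain ⟨y1, h1, h2, h3⟩ := hcB y0 hy0.1.le hy0.2.1
      have := hmax ⟨hy0.1.trans h1, h2, fun a ha => h3 a (hy0.2.2 a ha)⟩ h1.le
      order
    · obtain ⟨c, d, hcd, h⟩ := exists_interval hB hfin
      obtain ⟨y, hcy, hyd⟩ := exists_between hcd
      have hyJ := (h y hcy hyd).1
      obtain ⟨a1, h1, h2, h3⟩ := hcase y hyJ.1 hyJ.2
      obtain ⟨a0, h4, h5⟩ := exists_between (max_lt h2 hcy)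
      obtain ⟨h6, h7⟩ := max_lt_iff.1 h4
      have hK0 : K y a0 := ⟨h1.trans h6, h5, badUp _ _ _ h3 h6⟩
      obtain ⟨x, ⟨hx1, hx2⟩, hx⟩ := ((Set.Ioo_infinite h5).sdiff (badFin a0)).nonempty
      replace hx : ¬ Bad a0 x := fun hb => hx ⟨hx1, hb⟩
      obtain ⟨a, ha, ha'⟩ := (h x (h7.trans hx1) (hx2.trans hyd)).2 y hx2 hyJ.2
      rcases lt_or_ge a a0 with hlt | hge
      · exact hx (badUp _ _ _ ha.2.2 hlt)
      · rcases hge.eq_or_lt with rfl | hlt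
        · exact ha' hK0
        · exact ha' ⟨ha.1, ha.2.1.trans hx2, badUp _ _ _ hK0.2.2 hlt⟩

theorem infinite_swap {A : N → N → Prop} (hA : DefMap S fun p : N × N => A p.1 p.2)
    (hinf : {x | {y | A x y}.Infinite}.Infinite) : {y | {x | A x y}.Infinite}.Infinite := by
  intro hfin
  obtain ⟨y, hy⟩ := exists_infinite_fiber (S := S)
    (A := fun x y => A x y ∧ ¬ {x | A x y}.Infinite) (by fun_prop) (hinf.mono fun x hx => by
      refine ((show {y | A x y}.Infinite from hx).sdiff hfin).mono fun y hy => ⟨hy.1, hy.2⟩)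
  obtain ⟨x, -, hx⟩ := hy.nonempty
  exact hx (hy.mono fun x hx => hx.1)

end Box

section Large

variable {N : Type u} [LinearOrder N] [DenselyOrdered N] [NoMinOrder N] [NoMaxOrder N] [Nonempty N]
  {S : Struc N}

/-- `P` is large in `N^d`: iterated "infinitely many" along the coordinates. -/
def Lg : (d : ℕ) → ((Fin d → N) → Prop) → Prop
  | 0, P => ∃ w, P w
  | d + 1, P => Lg d fun w => {t : N | P (Fin.snoc w t)}.Infinite

theorem Lg.mono {d : ℕ} {P Q : (Fin d → N) → Prop} (h : Lg d P) (hPQ : ∀ w, P w → Q w) : Lg d Q := by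
  induction d with
  | zero => exact h.imp hPQ
  | succ d ih => exact ih h fun w hw => hw.mono fun t ht => hPQ _ ht

theorem lg_congr {d : ℕ} {P Q : (Fin d → N) → Prop} (hPQ : ∀ w, P w ↔ Q w) : Lg d P ↔ Lg d Q := by
  rw [show P = Q from funext fun w => propext (hPQ w)]

theorem Lg.or {d : ℕ} {P Q : (Fin d → N) → Prop} (h : Lg d fun w => P w ∨ Q w) : Lg d P ∨ Lg d Q := by
  induction d with
  | zero => 
    obtain ⟨w, h | h⟩ := h
    · exact Or.inl ⟨w, h⟩
    · exact Or.inr ⟨w, h⟩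
  | succ d ih => exact ih (Lg.mono (d := d) h fun w hw => Set.infinite_union.1 hw)

theorem Lg.exists {d : ℕ} {P : (Fin d → N) → Prop} (h : Lg d P) : ∃ w, P w := by
  induction d with
  | zero => exact h
  | succ d ih =>
    obtain ⟨w, hw⟩ := ih h
    obtain ⟨t, ht⟩ := hw.nonempty
    exact ⟨_, ht⟩

theorem Lg.exists_of_finite {d : ℕ} {ι : Type*} {F : Set ι} (hF : F.Finite)
    {P : ι → (Fin d → N) → Prop} (h : Lg d fun w => ∃ i ∈ F, P i w) : ∃ i ∈ F, Lg d (P i) := by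
  induction F, hF using Set.Finite.induction_on with
  | empty => obtain ⟨w, i, hi, -⟩ := h.exists; exact absurd hi (Set.notMem_empty i)
  | @insert a F _ _ ih =>
    rcases (h.mono (Q := fun w => P a w ∨ ∃ i ∈ F, P i w) (by
      rintro w ⟨i, rfl | hi, h'⟩
      · exact Or.inl h'
      · exact Or.inr ⟨i, hi, h'⟩)).or with h | h
    · exact ⟨a, Set.mem_insert _ _, h⟩
    · obtain ⟨i, hi, h⟩ := ih h
      exact ⟨i, Set.mem_insert_of_mem _ hi, h⟩

/-- The complement of a small set is large, relative to a large set. -/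
theorem Lg.and_not {d : ℕ} {P Q : (Fin d → N) → Prop} (h : Lg d P) (hQ : ¬ Lg d Q) :
    Lg d fun w => P w ∧ ¬ Q w := by
  rcases (h.mono (Q := fun w => (P w ∧ ¬ Q w) ∨ Q w) fun w hw => by tauto).or with h | h
  · exact h
  · exact absurd h hQ

@[fun_prop]
theorem DefMap.lg {Γ : Type*} [Interp S Γ] {d : ℕ} {P : Γ → (Fin d → N) → Prop}
    (h : DefMap S fun p : Γ × (Fin d → N) => P p.1 p.2) : DefMap S fun x => Lg d (P x) := by
  induction d with
  | zero => simp only [Lg]; fun_prop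
  | succ d ih =>
    simp only [Lg]
    exact ih (P := fun x w => {t : N | P x (Fin.snoc w t)}.Infinite) (by fun_prop)

theorem lg_fubini_one {d : ℕ} {A : (Fin d → N) → N → Prop}
    (hA : DefMap S fun p : (Fin d → N) × N => A p.1 p.2) :
    Lg d (fun w => {t | A w t}.Infinite) ↔ {t | Lg d fun w => A w t}.Infinite := by
  induction d with
  | zero =>
    simp only [Lg]
    have e : ∀ P : (Fin 0 → N) → Prop, (∃ w, P w) ↔ P Fin.elim0 := fun P =>
      ⟨fun ⟨w, hw⟩ => Subsingleton.elim w Fin.elim0 ▸ hw, fun h => ⟨_, h⟩⟩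
    simp only [e]
  | succ d ih =>
    simp only [Lg]
    rw [← ih (A := fun w t => {s | A (Fin.snoc w s) t}.Infinite) (by fun_prop)]
    refine lg_congr fun w => ⟨fun h => ?_, fun h => ?_⟩
    · exact infinite_swap (S := S) (A := fun s t => A (Fin.snoc w s) t) (by fun_prop) h
    · exact infinite_swap (S := S) (A := fun t s => A (Fin.snoc w s) t) (by fun_prop) h

theorem lg_fubini {d e : ℕ} {A : (Fin d → N) → (Fin e → N) → Prop}
    (hA : DefMap S fun p : (Fin d → N) × (Fin e → N) => A p.1 p.2) :
    Lg d (fun w => Lg e fun z => A w z) ↔ Lg e fun z => Lg d fun w => A w z := by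
  induction e with
  | zero =>
    simp only [Lg]
    have e : ∀ P : (Fin 0 → N) → Prop, (∃ w, P w) ↔ P Fin.elim0 := fun P =>
      ⟨fun ⟨w, hw⟩ => Subsingleton.elim w Fin.elim0 ▸ hw, fun h => ⟨_, h⟩⟩
    simp only [e]
  | succ e ih =>
    simp only [Lg]
    rw [ih (A := fun w z => {t | A w (Fin.snoc z t)}.Infinite) (by fun_prop)]
    exact lg_congr fun z => lg_fubini_one (A := fun w t => A w (Fin.snoc z t)) (by fun_prop)

/-- A set all of whose lines in direction `l` are finite is small. -/
theorem not_lg_of_line {d : ℕ} (l : Fin d) {B : (Fin d → N) → Prop} (hB : DefMap S B)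
    (h : ∀ w, {t | B (Function.update w l t)}.Finite) : ¬ Lg d B := by
  induction d with
  | zero => exact l.elim0
  | succ d ih =>
    have x0 : N := Classical.arbitrary N
    refine Fin.lastCases (motive := fun l => (∀ w, {t | B (Function.update w l t)}.Finite) →
      ¬ Lg (d + 1) B) ?_ (fun l => ?_) l h
    · intro h hL
      obtain ⟨w, hw⟩ := Lg.exists (d := d) (P := fun w => {t : N | B (Fin.snoc w t)}.Infinite) hL
      refine hw ((h (Fin.snoc w x0)).subset fun t ht => ?_)
      simpa [Fin.update_snoc_last] using ht
    · intro h hL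
      obtain ⟨t, ht⟩ := ((lg_fubini_one (S := S) (A := fun w t => B (Fin.snoc w t)) (by fun_prop)).1 hL).nonempty
      refine ih l (B := fun w => B (Fin.snoc w t)) (by fun_prop) (fun w => ?_) ht
      simpa [Fin.snoc_update] using h (Fin.snoc w t)

theorem lg_box {d : ℕ} {a b : Fin d → N} (h : ∀ i, a i < b i) :
    Lg d fun w => ∀ i, a i < w i ∧ w i < b i := by
  induction d with
  | zero => exact ⟨Fin.elim0, fun i => i.elim0⟩
  | succ d ih =>
    refine (ih fun i => h i.castSucc).mono fun w hw => ?_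
    refine (Set.Ioo_infinite (h (Fin.last d))).mono fun t ht i => ?_
    refine Fin.lastCases ?_ (fun i => ?_) i
    · simpa using ht
    · simpa using hw i

section Fin
variable {I : Type*} [Interp S I]

theorem finite_of_pointwise_finite_one {C : I → N → Prop} (hC : DefMap S fun p : I × N => C p.1 p.2)
    (Q : I → Prop) (hQ : DefMap S Q) (hinf : ∀ c, Q c → {t | C c t}.Infinite)
    (hfin : ∀ t, {c | Q c ∧ C c t}.Finite) : {c | Q c}.Finite := by
  let E : I → N → Prop := fun c e => (∃ y, y < e ∧ ∀ z, y < z → z < e → C c z) ∧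
        ¬ (C c e ∧ ∃ y, e < y ∧ ∀ z, e < z → z < y → C c z)
  have hE : DefMap S fun p : I × N => E p.1 p.2 := by simp only [E]; fun_prop
  let T : I → Prop := fun c => ∃ a, ∀ z, a < z → C c z
  have hT : DefMap S T := by simp only [T]; fun_prop
  have hTfin : {c | Q c ∧ T c}.Finite := by
    have p : N := Classical.arbitrary N
    refine finite_of_upclosed (S := S) (K := fun c a => p ≤ a ∧ ∀ z, a ≤ z → C c z) (by fun_prop)
      (fun a => p ≤ a) _ (by fun_prop) ?_ p (fun a => id) (fun c _ a h => h.1) ?_ ?_ ?_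
    · intro a ha
      obtain ⟨b, hb⟩ := exists_gt a
      exact ⟨b, ha.trans hb.le, hb⟩
    · rintro c ⟨-, a, ha⟩
      obtain ⟨b, hb⟩ := exists_gt (max a p)
      exact ⟨b, (max_lt_iff.1 hb).2.le, fun z hz => ha z ((max_lt_iff.1 hb).1.trans_le hz)⟩
    · rintro c - a b ⟨-, h⟩ hab hb
      exact ⟨hb, fun z hz => h z (hab.le.trans hz)⟩
    · rintro a -
      exact (hfin a).subset fun c hc => ⟨hc.1.1, hc.2.2 a le_rfl⟩
  have hEfin : ∀ e, {c | Q c ∧ E c e}.Finite := by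
    intro e
    obtain ⟨p, hp⟩ := exists_lt e
    refine finite_of_upclosed (S := S) (K := fun c a => (p ≤ a ∧ a < e) ∧ ∀ z, a ≤ z → z < e → C c z)
      (by fun_prop)
      (fun a => p ≤ a ∧ a < e) _ (by fun_prop) ?_ p (fun a h => h.1) (fun c _ a h => h.1) ?_ ?_ ?_
    · rintro a ⟨ha, hae⟩
      obtain ⟨b, hb, hbe⟩ := exists_between hae
      exact ⟨b, ⟨ha.trans hb.le, hbe⟩, hb⟩
    · rintro c ⟨-, ⟨y, hy, h⟩, -⟩
      obtain ⟨b, hb, hb'⟩ := exists_between (max_lt hy hp)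
      exact ⟨b, ⟨(max_lt_iff.1 hb).2.le, hb'⟩,
        fun z hz hz' => h z ((max_lt_iff.1 hb).1.trans_le hz) hz'⟩
    · rintro c - a b ⟨-, h⟩ hab hb
      exact ⟨hb, fun z hz => h z (hab.le.trans hz)⟩
    · rintro a ⟨-, ha⟩
      exact (hfin a).subset fun c hc => ⟨hc.1.1, hc.2.2 a le_rfl ha⟩
  have hBd : {e | ∃ c, Q c ∧ E c e}.Finite := by
    by_contra hcon
    obtain ⟨t, ht⟩ := exists_infinite_fiber (S := S)
      (A := fun e t => ∃ c, Q c ∧ E c e ∧ C c t ∧ t < e ∧ ∀ z, t ≤ z → z < e → C c z) (by fun_prop)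
      (Set.Infinite.mono (s := {e | ∃ c, Q c ∧ E c e}) (by
        rintro e ⟨c, hc, hce⟩
        obtain ⟨y, hy, h⟩ := hce.1
        refine (Set.Ioo_infinite hy).mono ?_
        rintro t ⟨h1, h2⟩
        exact ⟨c, hc, hce, h t h1 h2, h2, fun z hz hz' => h z (h1.trans_le hz) hz'⟩) hcon)
    have hf : ∀ e, ∃ c, (∃ c, Q c ∧ E c e ∧ C c t ∧ t < e ∧ ∀ z, t ≤ z → z < e → C c z) →
        (Q c ∧ E c e ∧ C c t ∧ t < e ∧ ∀ z, t ≤ z → z < e → C c z) := by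
      intro e
      by_cases h : ∃ c, Q c ∧ E c e ∧ C c t ∧ t < e ∧ ∀ z, t ≤ z → z < e → C c z
      · exact h.imp fun c hc _ => hc
      · obtain ⟨e', he'⟩ := ht.nonempty
        exact ⟨he'.choose, fun h' => absurd h' h⟩
    choose f hf using hf
    refine Set.infinite_of_injOn_mapsTo (f := f) (t := {c | Q c ∧ C c t}) ?_ ?_ ht (hfin t)
    · intro e he e' he' hee
      have h1 := hf e he
      have h2 := hf e' he'
      rw [← hee] at h2
      by_contra hne
      rcases lt_or_gt_of_ne hne with h | h
      · exact h1.2.1.2 ⟨h2.2.2.2.2 e h1.2.2.2.1.le h, e', h,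
          fun z hz hz' => h2.2.2.2.2 z (h1.2.2.2.1.le.trans hz.le) hz'⟩
      · exact h2.2.1.2 ⟨h1.2.2.2.2 e' h2.2.2.2.1.le h, e, h,
          fun z hz hz' => h1.2.2.2.2 z (h2.2.2.2.1.le.trans hz.le) hz'⟩
    · intro e he
      exact ⟨(hf e he).1, (hf e he).2.2.1⟩
  refine (hTfin.union (hBd.biUnion fun e _ => hEfin e)).subset fun c hc => ?_
  rcases exists_right_end (hC.section' c) (hinf c hc) with h | ⟨e, he⟩
  · exact Or.inl ⟨hc, h⟩
  · exact Or.inr (Set.mem_biUnion (show e ∈ {e | ∃ c, Q c ∧ E c e} from ⟨c, hc, he⟩)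
      (show c ∈ {c | Q c ∧ E c e} from ⟨hc, he⟩))

/-- A definable family of large sets in which every point lies in finitely many members is finite. -/
theorem finite_of_pointwise_finite {d : ℕ} {C : I → (Fin d → N) → Prop}
    (hC : DefMap S fun p : I × (Fin d → N) => C p.1 p.2)
    (Q : I → Prop) (hQ : DefMap S Q) (hinf : ∀ c, Q c → Lg d (C c))
    (hfin : ∀ t, {c | Q c ∧ C c t}.Finite) : {c | Q c}.Finite := by
  induction d with
  | zero =>
    refine (hfin Fin.elim0).subset fun c hc => ⟨hc, ?_⟩
    obtain ⟨w, hw⟩ := hinf c hc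
    exact Subsingleton.elim w Fin.elim0 ▸ hw
  | succ d ih =>
    refine ih (C := fun c w => {t | C c (Fin.snoc w t)}.Infinite) (by fun_prop) hinf fun w => ?_
    exact finite_of_pointwise_finite_one (S := S) (C := fun c t => C c (Fin.snoc w t)) (by fun_prop)
      (fun c => Q c ∧ {t | C c (Fin.snoc w t)}.Infinite) (by fun_prop) (fun c hc => hc.2)
      fun t => (hfin (Fin.snoc w t)).subset fun c hc => ⟨hc.1.1, hc.2⟩

end Fin

end Large

section Dim

variable {N : Type u} [LinearOrder N] [DenselyOrdered N] [NoMinOrder N] [NoMaxOrder N] [Nonempty N]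
  {S : Struc N}
variable {Γ : Type*} {I : Type*} [Interp S Γ] [Interp S I]

theorem DefMap.rp' : DefMap S fun p : (Fin (ar S Γ) → N) × Γ => rp S p.1 p.2 := by
  refine defP_iff.1 (def_congr (Interp.eq_def (S := S) (Γ := Γ)) fun z => ?_)
  constructor
  · rintro ⟨⟨a, γ⟩, ⟨h1, h2⟩, h3⟩
    have h1 : z ∘ Fin.castAdd _ = a := h1
    subst h1
    exact ⟨γ, h3, h2⟩
  · rintro ⟨γ, h1, h2⟩
    exact ⟨(z ∘ Fin.castAdd _, γ), ⟨rfl, h2⟩, h1⟩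

@[fun_prop]
theorem DefMap.rp {Δ : Type*} [Interp S Δ] {f : Δ → Fin (ar S Γ) → N} {g : Δ → Γ} (hf : DefMap S f)
    (hg : DefMap S g) : DefMap S fun x => rp S (f x) (g x) :=
  DefMap.comp (DefMap.rp' (S := S) (Γ := Γ)) (hf.prodMk hg)

variable (S) in
/-- The dimension of the set `Y` of representatives is at least `d`. -/
def DimGE (d : ℕ) (Y : Γ → Prop) : Prop :=
  ∃ p : Fin d → Fin (ar S Γ), Lg d fun w => ∃ a γ, rp S a γ ∧ Y γ ∧ (fun i => a (p i)) = w

theorem DimGE.mono {d : ℕ} {Y Z : Γ → Prop} (h : DimGE S d Y) (hYZ : ∀ γ, Y γ → Z γ) :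
    DimGE S d Z := by
  obtain ⟨p, hp⟩ := h
  exact ⟨p, hp.mono fun w ⟨a, γ, h1, h2, h3⟩ => ⟨a, γ, h1, hYZ _ h2, h3⟩⟩

theorem DimGE.or {d : ℕ} {Y Z : Γ → Prop} (h : DimGE S d fun γ => Y γ ∨ Z γ) :
    DimGE S d Y ∨ DimGE S d Z := by
  obtain ⟨p, hp⟩ := h
  rcases (hp.mono (Q := fun w => (∃ a γ, rp S a γ ∧ Y γ ∧ (fun i => a (p i)) = w) ∨
      (∃ a γ, rp S a γ ∧ Z γ ∧ (fun i => a (p i)) = w)) (by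
    rintro w ⟨a, γ, h1, h2 | h2, h3⟩
    · exact Or.inl ⟨a, γ, h1, h2, h3⟩
    · exact Or.inr ⟨a, γ, h1, h2, h3⟩)).or with h | h
  · exact Or.inl ⟨p, h⟩
  · exact Or.inr ⟨p, h⟩

theorem DimGE.le {d : ℕ} {Y : Γ → Prop} (h : DimGE S d Y) : d ≤ ar S Γ := by
  obtain ⟨p, hp⟩ := h
  suffices Function.Injective p by simpa using Fintype.card_le_of_injective p this
  intro i j hij
  by_contra hne
  refine not_lg_of_line (S := S) i (B := fun w => w i = w j) (by fun_prop) (fun w => ?_)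
    (hp.mono ?_)
  · refine (Set.finite_singleton (w j)).subset fun t ht => ?_
    simpa [Function.update_of_ne (Ne.symm hne)] using ht
  · rintro w ⟨a, γ, -, -, rfl⟩
    simp [hij]

theorem DimGE.of_nonempty {Y : Γ → Prop} (h : ∃ γ, Y γ) : DimGE S 0 Y := by
  obtain ⟨γ, hγ⟩ := h
  obtain ⟨a, ha⟩ := Interp.surj (S := S) γ
  exact ⟨Fin.elim0, fun i => a i.elim0, a, γ, ha, hγ, funext fun i => i.elim0⟩

/-- Infinitely many disjoint sets of dimension at least `d` have a union of dimension at least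
`d + 1`. -/
theorem DimGE.iUnion {d : ℕ} {C : I → Γ → Prop} (hC : DefMap S fun p : I × Γ => C p.1 p.2)
    {Q : I → Prop} (hQ : DefMap S Q) (hinf : {i | Q i}.Infinite)
    (hdim : ∀ i, Q i → DimGE S d (C i))
    (hdisj : ∀ i j γ, Q i → Q j → C i γ → C j γ → i = j) :
    DimGE S (d + 1) fun γ => ∃ i, Q i ∧ C i γ := by
  let A : I → (Fin (ar S Γ) → N) → Prop := fun i a => ∃ γ, OMin.rp S a γ ∧ C i γ
  have hA : DefMap S fun p : I × (Fin (ar S Γ) → N) => A p.1 p.2 := by simp only [A]; fun_prop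
  obtain ⟨p, hp⟩ : ∃ p : Fin d → Fin (ar S Γ),
      {i | Q i ∧ Lg d fun w => ∃ a, A i a ∧ ∀ j, a (p j) = w j}.Infinite := by
    by_contra hcon
    push Not at hcon
    refine hinf ((Set.finite_iUnion fun p => hcon p).subset fun i hi => ?_)
    obtain ⟨p, hp⟩ := hdim i hi
    exact Set.mem_iUnion.2 ⟨p, hi, hp.mono fun w ⟨a, γ, h1, h2, h3⟩ =>
      ⟨a, ⟨γ, h1, h2⟩, fun j => congrFun h3 j⟩⟩
  let Q' : I → Prop := fun i => Q i ∧ Lg d fun w => ∃ a, A i a ∧ ∀ j, a (p j) = w j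
  have hQ' : DefMap S Q' := by
    have : DefMap S fun q : (I × (Fin d → N)) × (Fin (ar S Γ) → N) => ∀ j, q.2 (p j) = q.1.2 j :=
      DefMap.allFin fun j => by fun_prop
    simp only [Q']; fun_prop
  let Z : Fin (ar S Γ) → (Fin d → N) → N → Prop := fun l z t =>
    ∃ a i, Q' i ∧ A i a ∧ (∀ j, a (p j) = z j) ∧ a l = t
  have hpj : ∀ {Δ : Type _} [Interp S Δ] (f : Δ → Fin d → N) (g : Δ → Fin (ar S Γ) → N),
      DefMap S f → DefMap S g → DefMap S fun x => ∀ j, g x (p j) = f x j :=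
    fun f g hf hg => DefMap.allFin fun j => by fun_prop
  have hZ : ∀ l, DefMap S fun q : (Fin d → N) × N => Z l q.1 q.2 := by
    intro l
    have := hpj (fun q : (((Fin d → N) × N) × (Fin (ar S Γ) → N)) × I => q.1.1.1) (fun q => q.1.2)
      (by fun_prop) (by fun_prop)
    simp only [Z]; fun_prop
  by_cases hL : Lg d fun z => ∃ l ∈ Set.univ, {t | Z l z t}.Infinite
  · obtain ⟨l, -, hl⟩ := Lg.exists_of_finite Set.finite_univ hL
    refine ⟨Fin.snoc p l, Lg.mono (d := d + 1) (P := fun w => Z l (Fin.init w) (w (Fin.last d)))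
      (hl.mono fun w hw => by simpa using hw) ?_⟩
    rintro w ⟨a, i, hi, ⟨γ, h1, h2⟩, h3, h4⟩
    refine ⟨a, γ, h1, ⟨i, hi.1, h2⟩, funext fun j => ?_⟩
    refine Fin.lastCases ?_ (fun j => ?_) j
    · simpa using h4
    · simpa [Fin.init] using h3 j
  · refine absurd ?_ hp
    have hL' : DefMap S fun z => ∃ l ∈ (Set.univ : Set (Fin (ar S Γ))), {t | Z l z t}.Infinite :=
      (DefMap.exFin (P := fun z l => {t | Z l z t}.Infinite) fun l => by
        have := hZ l; fun_prop).congrP fun z => by simp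
    refine finite_of_pointwise_finite (S := S) (d := d)
      (C := fun i z => (∃ a, A i a ∧ ∀ j, a (p j) = z j) ∧
        ¬ ∃ l ∈ (Set.univ : Set (Fin (ar S Γ))), {t | Z l z t}.Infinite) ?_ Q' hQ'
      (fun i hi => hi.2.and_not hL) fun z => ?_
    · have := hpj (fun q : (I × (Fin d → N)) × (Fin (ar S Γ) → N) => q.1.2) (fun q => q.2)
        (by fun_prop) (by fun_prop)
      have h3 : DefMap S fun q : I × (Fin d → N) =>
          ∃ l ∈ (Set.univ : Set (Fin (ar S Γ))), {t | Z l q.2 t}.Infinite := hL'.comp DefMap.snd'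
      fun_prop
    · by_cases hz : ∃ l ∈ (Set.univ : Set (Fin (ar S Γ))), {t | Z l z t}.Infinite
      · exact Set.finite_empty.subset fun i hi => hi.2.2 hz
      · push Not at hz
        have hfin : {a | ∃ i, Q' i ∧ A i a ∧ ∀ j, a (p j) = z j}.Finite := by
          refine (Set.Finite.pi (fun l => hz l (Set.mem_univ l))).subset fun a ha l _ => ?_
          obtain ⟨i, h1, h2, h3⟩ := ha
          exact ⟨a, i, h1, h2, h3, rfl⟩
        have hf : ∀ i, ∃ a, (Q' i ∧ ∃ a, A i a ∧ ∀ j, a (p j) = z j) →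
            (Q' i ∧ A i a ∧ ∀ j, a (p j) = z j) := by
          intro i
          by_cases h : ∃ a, A i a ∧ ∀ j, a (p j) = z j
          · exact ⟨h.choose, fun h' => ⟨h'.1, h.choose_spec⟩⟩
          · exact ⟨fun _ => Classical.arbitrary N, fun h' => absurd h'.2 h⟩
        choose f hf using hf
        refine Set.Finite.of_injOn (f := f) (t := {a | ∃ i, Q' i ∧ A i a ∧ ∀ j, a (p j) = z j})
          ?_ ?_ hfin
        · intro i hi
          exact ⟨i, hf i ⟨hi.1, hi.2.1⟩⟩
        · intro i hi j hj hij
          obtain ⟨-, ⟨γ, h1, h2⟩, -⟩ := hf i ⟨hi.1, hi.2.1⟩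
          obtain ⟨-, ⟨γ', h1', h2'⟩, -⟩ := hf j ⟨hj.1, hj.2.1⟩
          rw [← hij] at h1'
          obtain rfl := Interp.uniq h1 h1'
          exact hdisj i j γ hi.1.1 hj.1.1 h2 h2'

/-- A set mapping definably onto a large subset of `N^e` has dimension at least `e`. -/
theorem DimGE.of_surj {e : ℕ} {Y : Γ → Prop} (hY : DefMap S Y) {R : Γ → (Fin e → N) → Prop}
    (hR : DefMap S fun p : Γ × (Fin e → N) => R p.1 p.2)
    (hfun : ∀ γ w w', Y γ → R γ w → R γ w' → w = w') (h : Lg e fun w => ∃ γ, Y γ ∧ R γ w) :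
    DimGE S e Y := by
  induction e generalizing Y with
  | zero =>
    obtain ⟨w, γ, hγ, -⟩ := h
    exact DimGE.of_nonempty ⟨γ, hγ⟩
  | succ e ih =>
    have h2 := (lg_fubini_one (S := S) (A := fun w t => ∃ γ, Y γ ∧ R γ (Fin.snoc w t)) (by fun_prop)).1 h
    refine (DimGE.iUnion (S := S) (I := N) (C := fun t γ => Y γ ∧ ∃ w : Fin e → N, R γ (Fin.snoc w t))
      (by fun_prop) (by fun_prop) h2 (fun t ht => ?_) ?_).mono ?_
    · refine ih (Y := fun γ => Y γ ∧ ∃ w : Fin e → N, R γ (Fin.snoc w t)) (by fun_prop)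
        (R := fun γ w => R γ (Fin.snoc w t)) (by fun_prop) ?_ (ht.mono ?_)
      · intro γ w w' hγ h1 h2
        have := hfun γ _ _ hγ.1 h1 h2
        simpa using congrArg Fin.init this
      · rintro w ⟨γ, h1, h2⟩
        exact ⟨γ, ⟨h1, w, h2⟩, h2⟩
    · rintro t t' γ - - ⟨hγ, w, h1⟩ ⟨-, w', h2⟩
      simpa using congrFun (hfun γ _ _ hγ h1 h2) (Fin.last e)
    · rintro γ ⟨t, -, h, -⟩
      exact h

end Dim

section Comp

variable {N : Type u} [LinearOrder N] [DenselyOrdered N] [NoMinOrder N] [NoMaxOrder N] [Nonempty N]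
  {S : Struc N}

attribute [fun_prop] DefMap.allFin DefMap.exFin

/-- A large definable set contains an open box. -/
theorem Lg.exists_box {e : ℕ} {Z : (Fin e → N) → Prop} (hZ : DefMap S Z) (h : Lg e Z) :
    ∃ a b : Fin e → N, (∀ i, a i < b i) ∧ ∀ w, (∀ i, a i < w i ∧ w i < b i) → Z w := by
  induction e with
  | zero =>
    obtain ⟨w, hw⟩ := h
    exact ⟨Fin.elim0, Fin.elim0, fun i => i.elim0, fun v _ => Subsingleton.elim w v ▸ hw⟩
  | succ e ih =>
    have h2 : Lg e fun w => Lg 2 fun O : Fin 2 → N =>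
        O 0 < O 1 ∧ ∀ t, O 0 < t → t < O 1 → Z (Fin.snoc w t) := by
      refine Lg.mono (d := e) h fun w hw => ?_
      obtain ⟨a, b, hab, hI⟩ := exists_interval (S := S) (P := fun t => Z (Fin.snoc w t)) (by fun_prop) hw
      obtain ⟨c, hac, hcb⟩ := exists_between hab
      refine (lg_box (a := ![a, c]) (b := ![c, b]) (by
        intro i; fin_cases i <;> simpa)).mono fun O hO => ?_
      have h0 := hO 0
      have h1 := hO 1
      simp only [Matrix.cons_val_zero, Matrix.cons_val_one] at h0 h1
      exact ⟨h0.2.trans h1.1, fun t h3 h4 => hI t (h0.1.trans h3) (h4.trans h1.2)⟩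
    obtain ⟨O, hO⟩ := ((lg_fubini (S := S) (A := fun w O =>
      O 0 < O 1 ∧ ∀ t, O 0 < t → t < O 1 → Z (Fin.snoc w t)) (by fun_prop)).1 h2).exists
    obtain ⟨a, b, hab, hI⟩ := ih (Z := fun w =>
      O 0 < O 1 ∧ ∀ t, O 0 < t → t < O 1 → Z (Fin.snoc w t)) (by fun_prop) hO
    obtain ⟨w, hw, hw'⟩ := hO.exists
    refine ⟨Fin.snoc a (O 0), Fin.snoc b (O 1), fun i => ?_, fun w h => ?_⟩
    · refine Fin.lastCases ?_ (fun i => ?_) i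
      · simpa using hw
      · simpa using hab i
    · have h1 := h (Fin.last e)
      simp only [Fin.snoc_last] at h1
      have := (hI (Fin.init w) fun i => by
        have := h i.castSucc
        simpa [Fin.init] using this).2 (w (Fin.last e)) h1.1 h1.2
      simpa using this

theorem finite_of_param {Bad : N → Prop} (hB : DefMap S Bad) {k : ℕ} {Φ : N → (Fin k → N) → Prop}
    (hΦ : DefMap S fun p : N × (Fin k → N) => Φ p.1 p.2) (h1 : ∀ t, Bad t → Lg k (Φ t))
    (h2 : ∀ t O a b, Bad t → a < t → t < b → ¬ ∀ s, a < s → s < b → Φ s O) : {t | Bad t}.Finite := by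
  by_contra hinf
  obtain ⟨O, hO⟩ := ((lg_fubini_one (S := S) (A := fun O t => Bad t ∧ Φ t O) (by fun_prop)).2
    (Set.Infinite.mono (s := {t | Bad t}) (fun t ht => (h1 t ht).mono fun w hw => ⟨ht, hw⟩) hinf)).exists
  obtain ⟨a, b, hab, hI⟩ := exists_interval (S := S) (P := fun t => Bad t ∧ Φ t O) (by fun_prop) hO
  obtain ⟨t, ht, ht'⟩ := exists_between hab
  exact h2 t O a b (hI t ht ht').1 ht ht' fun s hs hs' => (hI s hs hs').2

/-- `P` is locally constant at `x`. -/
def LocC (P : N → Prop) (x : N) : Prop := ∃ a b, a < x ∧ x < b ∧ ∀ t, a < t → t < b → (P t ↔ P x)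

@[fun_prop]
theorem DefMap.locC {Γ : Type*} [Interp S Γ] {P : Γ → N → Prop} {f : Γ → N}
    (h : DefMap S fun p : Γ × N => P p.1 p.2) (hf : DefMap S f) :
    DefMap S fun x => LocC (P x) (f x) := by
  simp only [LocC]; fun_prop

theorem finite_not_locC {P : N → Prop} (hP : DefMap S P) : {x | ¬ LocC P x}.Finite := by
  have key : ∀ P : N → Prop, DefMap S P → {x | ¬ LocC P x ∧ P x}.Finite := by
    intro P hP
    by_contra hinf
    obtain ⟨a, b, hab, hI⟩ := exists_interval (S := S) (P := fun x => ¬ LocC P x ∧ P x) (by fun_prop) hinf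
    obtain ⟨t, ht, ht'⟩ := exists_between hab
    exact (hI t ht ht').1 ⟨a, b, ht, ht', fun s hs hs' => iff_of_true (hI s hs hs').2 (hI t ht ht').2⟩
  refine ((key P hP).union (key (fun x => ¬ P x) (by fun_prop))).subset fun x hx => ?_
  by_cases h : P x
  · exact Or.inl ⟨hx, h⟩
  · refine Or.inr ⟨fun hh => hx ?_, h⟩
    simpa [LocC, not_iff_not] using hh

theorem const_of_locC {P : N → Prop} (hP : DefMap S P) {x y : N} (hxy : x ≤ y)
    (h : ∀ z, x ≤ z → z ≤ y → LocC P z) : P x ↔ P y :=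
  const_of_loc hP hxy fun z h1 h2 => by
    obtain ⟨a, b, ha, hb, hI⟩ := h z h1 h2
    exact ⟨a, b, ha, hb, fun t _ _ h3 h4 => hI t h3 h4⟩

theorem lg_nbhd {m : ℕ} {x u v : Fin m → N} (hu : ∀ i, u i < x i) (hv : ∀ i, x i < v i) :
    Lg (m + m) fun O => ∀ i, (u i < O (Fin.castAdd m i) ∧ O (Fin.castAdd m i) < x i) ∧
      (x i < O (Fin.natAdd m i) ∧ O (Fin.natAdd m i) < v i) := by
  refine (lg_box (a := Fin.append u x) (b := Fin.append x v) fun i => ?_).mono fun O hO i => ?_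
  · refine Fin.addCases (fun i => ?_) (fun i => ?_) i
    · simpa only [Fin.append_left] using hu i
    · simpa only [Fin.append_right] using hv i
  · have h1 := hO (Fin.castAdd m i)
    have h2 := hO (Fin.natAdd m i)
    simp only [Fin.append_left, Fin.append_right] at h1 h2
    exact ⟨h1, h2⟩

/-- The family `Y` is bounded near `t`. -/
def BddNear (Y : N → N → Prop) (t : N) : Prop :=
  ∃ M M' a b, a < t ∧ t < b ∧ ∀ s, a < s → s < b → ∀ y, Y s y → M < y ∧ y < M'

/-- The members of the family `Y` near `t` are locally uniformly isolated. -/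
def SepNear (Y : N → N → Prop) (t : N) : Prop :=
  ∀ x, ∃ u v, u < x ∧ x < v ∧ ∃ a b, a < t ∧ t < b ∧ ∀ s, a < s → s < b →
    ∀ y y', u < y → y < v → u < y' → y' < v → Y s y → Y s y' → y = y'

@[fun_prop]
theorem DefMap.bddNear {Γ : Type*} [Interp S Γ] {Y : Γ → N → N → Prop} {f : Γ → N}
    (h : DefMap S fun p : Γ × N × N => Y p.1 p.2.1 p.2.2) (hf : DefMap S f) :
    DefMap S fun x => BddNear (Y x) (f x) := by
  simp only [BddNear]; fun_prop

@[fun_prop]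
theorem DefMap.sepNear {Γ : Type*} [Interp S Γ] {Y : Γ → N → N → Prop} {f : Γ → N}
    (h : DefMap S fun p : Γ × N × N => Y p.1 p.2.1 p.2.2) (hf : DefMap S f) :
    DefMap S fun x => SepNear (Y x) (f x) := by
  simp only [SepNear]; fun_prop

theorem exists_bounds {F : Set N} (hF : F.Finite) : ∃ u v, u < v ∧ ∀ y ∈ F, u < y ∧ y < v := by
  obtain ⟨p⟩ := ‹Nonempty N›
  have hF' : (insert p F).Finite := hF.insert p
  obtain ⟨m, hm⟩ := hF'.bddBelow
  obtain ⟨M, hM⟩ := hF'.bddAbove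
  obtain ⟨u, hu⟩ := exists_lt m
  obtain ⟨v, hv⟩ := exists_gt M
  have h : ∀ y ∈ insert p F, u < y ∧ y < v := fun y hy => ⟨hu.trans_le (hm hy), (hM hy).trans_lt hv⟩
  exact ⟨u, v, (h p (mem_insert _ _)).1.trans (h p (mem_insert _ _)).2, fun y hy => h y (mem_insert_of_mem _ hy)⟩

theorem exists_isolating {F : Set N} (hF : F.Finite) (x : N) :
    ∃ u v, u < x ∧ x < v ∧ ∀ y ∈ F, u < y → y < v → y = x := by
  obtain ⟨u, hu, hu'⟩ := exists_dominate (P := fun u => u < x) (F := F ∩ Iio x) (exists_lt x)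
    (hF.inter_of_left _) fun f hf => exists_between hf.2 |>.imp fun b hb => ⟨hb.2, hb.1⟩
  obtain ⟨v, hv, hv'⟩ : ∃ v, x < v ∧ ∀ f ∈ F ∩ Ioi x, v < f := by
    rcases (F ∩ Ioi x).eq_empty_or_nonempty with h0 | h0
    · obtain ⟨v, hv⟩ := exists_gt x
      exact ⟨v, hv, by simp [h0]⟩
    · obtain ⟨c, hc, hmin⟩ := Set.exists_min_image _ id (hF.inter_of_left _) h0
      obtain ⟨v, hv, hv'⟩ := exists_between (show x < c from hc.2)
      exact ⟨v, hv, fun f hf => hv'.trans_le (hmin f hf)⟩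
  refine ⟨u, v, hu, hv, fun y hy h1 h2 => ?_⟩
  rcases lt_trichotomy y x with h | h | h
  · exact absurd (hu' y ⟨hy, h⟩) (by simpa using h1.le)
  · exact h
  · exact absurd (hv' y ⟨hy, h⟩) (by simpa using h2.le)

variable {Y : N → N → Prop}

theorem finite_not_bddNear (hY : DefMap S fun p : N × N => Y p.1 p.2) (hfin : ∀ t, {y | Y t y}.Finite) :
    {t | ¬ BddNear Y t}.Finite := by
  refine finite_of_param (S := S) (k := 2) (Φ := fun t O => ∀ y, Y t y → O 0 < y ∧ y < O 1)
    (by fun_prop) (by fun_prop) (fun t _ => ?_) ?_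
  · obtain ⟨u, v, -, h⟩ := exists_bounds (hfin t)
    obtain ⟨u', hu⟩ := exists_lt u
    obtain ⟨v', hv⟩ := exists_gt v
    refine (lg_box (a := ![u', v]) (b := ![u, v']) (by
        intro i; fin_cases i <;> simpa)).mono fun O hO y hy => ?_
    have h0 := hO 0
    have h1 := hO 1
    simp only [Matrix.cons_val_zero, Matrix.cons_val_one] at h0 h1
    exact ⟨h0.2.trans (h y hy).1, (h y hy).2.trans h1.1⟩
  · intro t O a b hbad ha hb hI
    exact hbad ⟨O 0, O 1, a, b, ha, hb, hI⟩

theorem finite_not_sepNear (hY : DefMap S fun p : N × N => Y p.1 p.2) (hfin : ∀ t, {y | Y t y}.Finite) :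
    {t | ¬ SepNear Y t}.Finite := by
  let Bx : N → N → Prop := fun t x => ∀ u v, u < x → x < v → ∀ a b, a < t → t < b →
    ∃ s, a < s ∧ s < b ∧ ∃ y y', u < y ∧ y < v ∧ u < y' ∧ y' < v ∧ Y s y ∧ Y s y' ∧ y ≠ y'
  have hBx : DefMap S fun p : N × N => Bx p.1 p.2 := by simp only [Bx]; fun_prop
  have e : ∀ t, ¬ SepNear Y t ↔ ∃ x, Bx t x := by
    intro t; simp only [SepNear, Bx]; push Not; rfl
  simp only [e]
  refine finite_of_param (S := S) (k := 2) (Φ := fun t O => (∃ x, O 0 < x ∧ x < O 1 ∧ Bx t x) ∧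
    ∀ y y', O 0 < y → y < O 1 → O 0 < y' → y' < O 1 → Y t y → Y t y' → y = y')
    (by fun_prop) (by fun_prop) ?_ ?_
  · rintro t ⟨x, hx⟩
    obtain ⟨u, v, hu, hv, h⟩ := exists_isolating (hfin t) x
    refine (lg_box (a := ![u, x]) (b := ![x, v]) (by
        intro i; fin_cases i <;> simpa)).mono fun O hO => ?_
    have h0 := hO 0
    have h1 := hO 1
    simp only [Matrix.cons_val_zero, Matrix.cons_val_one] at h0 h1
    refine ⟨⟨x, h0.2, h1.1, hx⟩, fun y y' h2 h3 h4 h5 h6 h7 => ?_⟩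
    rw [h y h6 (h0.1.trans h2) (h3.trans h1.2), h y' h7 (h0.1.trans h4) (h5.trans h1.2)]
  · rintro t O a b - ha hb hI
    obtain ⟨⟨x, h1, h2, hx⟩, -⟩ := hI t ha hb
    obtain ⟨s, hs, hs', y, y', h3, h4, h5, h6, h7, h8, h9⟩ := hx _ _ h1 h2 a b ha hb
    exact h9 ((hI s hs hs').2 y y' h3 h4 h5 h6 h7 h8)

end Comp

section Germs

variable {N : Type u} [LinearOrder N] [DenselyOrdered N] [NoMinOrder N] [NoMaxOrder N] [Nonempty N]
  {S : Struc N}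

/-- A one-sided germ filter at `x`. -/
structure IsGerm (S : Struc N) (L : Filter N) (x : N) : Prop where
  neBot : L.NeBot
  mem : ∀ a b, a < x → x < b → ∀ᶠ t in L, a < t ∧ t < b
  dich : ∀ P : N → Prop, DefMap S P → (∀ᶠ t in L, P t) ∨ ∀ᶠ t in L, ¬ P t
  defMap : ∀ (Γ : Type u) [Interp S Γ] (P : Γ → N → Prop), DefMap S (fun p : Γ × N => P p.1 p.2) →
    DefMap S fun x => ∀ᶠ t in L, P x t

/-- The filter of right neighbourhoods of `x`. -/
def rightGerm (x : N) : Filter N where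
  sets := {s | ∃ y, x < y ∧ ∀ t, x < t → t < y → t ∈ s}
  univ_sets := (exists_gt x).imp fun _ hy => ⟨hy, fun _ _ _ => trivial⟩
  sets_of_superset := fun ⟨y, hy, h⟩ hs => ⟨y, hy, fun t h1 h2 => hs (h t h1 h2)⟩
  inter_sets := fun ⟨y, hy, h⟩ ⟨z, hz, h'⟩ => ⟨min y z, lt_min hy hz, fun t h1 h2 =>
    ⟨h t h1 (h2.trans_le (min_le_left _ _)), h' t h1 (h2.trans_le (min_le_right _ _))⟩⟩

/-- The filter of left neighbourhoods of `x`. -/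
def leftGerm (x : N) : Filter N where
  sets := {s | ∃ y, y < x ∧ ∀ t, y < t → t < x → t ∈ s}
  univ_sets := (exists_lt x).imp fun _ hy => ⟨hy, fun _ _ _ => trivial⟩
  sets_of_superset := fun ⟨y, hy, h⟩ hs => ⟨y, hy, fun t h1 h2 => hs (h t h1 h2)⟩
  inter_sets := fun ⟨y, hy, h⟩ ⟨z, hz, h'⟩ => ⟨max y z, max_lt hy hz, fun t h1 h2 =>
    ⟨h t ((le_max_left _ _).trans_lt h1) h2, h' t ((le_max_right _ _).trans_lt h1) h2⟩⟩

theorem isGerm_right (x : N) : IsGerm S (rightGerm x) x where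
  neBot := ⟨fun h => by
    obtain ⟨y, hy, hI⟩ : ∅ ∈ rightGerm x := h ▸ mem_bot
    obtain ⟨t, h1, h2⟩ := exists_between hy
    exact hI t h1 h2⟩
  mem := fun a b ha hb => ⟨b, hb, fun t h1 h2 => ⟨ha.trans h1, h2⟩⟩
  dich := fun P hP => by
    obtain ⟨y, hy, h | h⟩ := germ_right hP x
    · exact Or.inl ⟨y, hy, h⟩
    · exact Or.inr ⟨y, hy, h⟩
  defMap := fun Γ _ P hP => by
    change DefMap S fun z => ∃ y, x < y ∧ ∀ t, x < t → t < y → P z t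
    fun_prop

theorem isGerm_left (x : N) : IsGerm S (leftGerm x) x where
  neBot := ⟨fun h => by
    obtain ⟨y, hy, hI⟩ : ∅ ∈ leftGerm x := h ▸ mem_bot
    obtain ⟨t, h1, h2⟩ := exists_between hy
    exact hI t h1 h2⟩
  mem := fun a b ha hb => ⟨a, ha, fun t h1 h2 => ⟨h1, h2.trans hb⟩⟩
  dich := fun P hP => by
    obtain ⟨y, hy, h | h⟩ := germ_left hP x
    · exact Or.inl ⟨y, hy, h⟩
    · exact Or.inr ⟨y, hy, h⟩
  defMap := fun Γ _ P hP => by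
    change DefMap S fun z => ∃ y, y < x ∧ ∀ t, y < t → t < x → P z t
    fun_prop

/-- To check a property near `x` it suffices to check it along both one-sided germs. -/
theorem exists_nhd_of_germ {P : N → Prop} {x : N} (hx : P x)
    (h : ∀ L, IsGerm S L x → ∀ᶠ t in L, P t) : ∃ a b, a < x ∧ x < b ∧ ∀ t, a < t → t < b → P t := by
  obtain ⟨b, hb, h1⟩ := h _ (isGerm_right x)
  obtain ⟨a, ha, h2⟩ := h _ (isGerm_left x)
  refine ⟨a, b, ha, hb, fun t h3 h4 => ?_⟩
  rcases lt_trichotomy t x with h5 | h5 | h5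
  · exact h2 t h3 h5
  · exact h5 ▸ hx
  · exact h1 t h5 h4

theorem LocC.eventually {P : N → Prop} {x : N} (h : LocC P x) {L : Filter N} (hL : IsGerm S L x) :
    ∀ᶠ t in L, P t ↔ P x := by
  obtain ⟨a, b, ha, hb, h⟩ := h
  exact (hL.mem a b ha hb).mono fun t ht => h t ht.1 ht.2

theorem LocC.not {P : N → Prop} {x : N} (h : LocC P x) : LocC (fun t => ¬ P t) x := by
  obtain ⟨a, b, ha, hb, h⟩ := h
  exact ⟨a, b, ha, hb, fun t h1 h2 => not_congr (h t h1 h2)⟩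

/-- A definable set with at most one boundary point on a closed interval, containing no end point,
has at most one point there. -/
theorem subsingleton_of_bdry {R : N → Prop} (hR : DefMap S R) {u v : N}
    (hb : ∀ z z', u ≤ z → z ≤ v → u ≤ z' → z' ≤ v → ¬ LocC R z → ¬ LocC R z' → z = z')
    (hu : ¬ R u) (hv : ¬ R v) : {z | (u ≤ z ∧ z ≤ v) ∧ R z}.Finite := by
  obtain ⟨b, hb⟩ : ∃ b, ∀ z, u ≤ z → z ≤ v → z ≠ b → LocC R z := by
    by_cases h : ∃ b, u ≤ b ∧ b ≤ v ∧ ¬ LocC R b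
    · obtain ⟨b, h1, h2, h3⟩ := h
      exact ⟨b, fun z h4 h5 h6 => by_contra fun h7 => h6 (hb z b h4 h5 h1 h2 h7 h3)⟩
    · push Not at h
      exact ⟨u, fun z h1 h2 _ => h z h1 h2⟩
  refine (finite_singleton b).subset ?_
  rintro z ⟨⟨h1, h2⟩, h3⟩
  by_contra h4
  rcases lt_or_gt_of_ne (show z ≠ b from h4) with h5 | h5
  · exact hu ((const_of_locC hR h1 fun y h6 h7 => hb y h6 (h7.trans h2) (h7.trans_lt h5).ne).2 h3)
  · exact hv ((const_of_locC hR h2 fun y h6 h7 => hb y (h1.trans h6) h7 (h5.trans_le h6).ne').1 h3)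

theorem exists_between_not_mem {E : Set N} (hE : E.Finite) {a b : N} (h : a < b) :
    ∃ c, a < c ∧ c < b ∧ c ∉ E := by
  obtain ⟨c, hc, hc'⟩ := ((Set.Ioo_infinite h).sdiff hE).nonempty
  exact ⟨c, hc.1, hc.2, hc'⟩

theorem locC_infinite {B : N → N → Prop} (hB : DefMap S fun p : N × N => B p.1 p.2) {x : N} {E : Set N}
    (hE : E.Finite) (hloc : ∀ y, y ∉ E → LocC (fun t => B t y) x) {Y : N → N → Prop}
    (hY : ∀ t y, ¬ Y t y → LocC (B t) y) (hbdd : BddNear Y x) (hsep : SepNear Y x) :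
    LocC (fun t => {y | B t y}.Infinite) x := by
  refine exists_nhd_of_germ (S := S) (P := fun t => {y | B t y}.Infinite ↔ {y | B x y}.Infinite)
    Iff.rfl fun L hL => ?_
  have := hL.neBot
  have hBt : ∀ t, DefMap S (B t) := fun t => by fun_prop
  by_cases hx : {y | B x y}.Infinite
  · obtain ⟨a, b, hab, hI⟩ := exists_interval (hBt x) hx
    obtain ⟨c, hac, hcb⟩ := exists_between hab
    obtain ⟨u, v, huc, hcv, a', b', ha', hb', hs⟩ := hsep c
    obtain ⟨u', hu1, hu2, hu3⟩ := exists_between_not_mem hE (max_lt hac huc)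
    obtain ⟨v', hv1, hv2, hv3⟩ := exists_between_not_mem hE (lt_min hcb hcv)
    rw [max_lt_iff] at hu1
    rw [lt_min_iff] at hv2
    filter_upwards [(hloc u' hu3).eventually hL, (hloc v' hv3).eventually hL, hL.mem a' b' ha' hb']
      with t h1 h2 h3
    refine iff_of_true (fun hfin => ?_) hx
    have h4 := subsingleton_of_bdry (S := S) (R := fun y => ¬ B t y) (by fun_prop) (u := u') (v := v')
      (fun z z' h5 h6 h7 h8 h9 h10 => hs t h3.1 h3.2 z z' (by order) (by order) (by order) (by order)
        (by_contra fun h => h9 (hY t z h).not) (by_contra fun h => h10 (hY t z' h).not))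
      (not_not.2 (h1.2 (hI u' hu1.1 (by order)))) (not_not.2 (h2.2 (hI v' (by order) hv2.1)))
    refine Set.Ioo_infinite (hu2.trans hv1) ((hfin.union h4).subset fun z hz => ?_)
    by_cases h : B t z
    · exact Or.inl h
    · exact Or.inr ⟨⟨hz.1.le, hz.2.le⟩, h⟩
  · rcases hL.dich (fun t => {y | B t y}.Infinite) (by fun_prop) with hP | hP
    swap
    · exact hP.mono fun t ht => iff_of_false ht hx
    exfalso
    have hE' : (E ∪ {y | B x y}).Finite := hE.union (not_infinite.1 hx)
    have hev : ∀ y, y ∉ E ∪ {y | B x y} → ∀ᶠ t in L, ¬ B t y := fun y hy =>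
      ((hloc y fun h => hy (Or.inl h)).eventually hL).mono fun t ht h => hy (Or.inr (ht.1 h))
    obtain ⟨M, M', a, b, ha, hb, hM⟩ := hbdd
    have hM : ∀ᶠ t in L, ∀ y, ¬ LocC (B t) y → M < y ∧ y < M' :=
      (hL.mem a b ha hb).mono fun t ht y hy => hM t ht.1 ht.2 y (by_contra fun h => hy (hY t y h))
    let Q : N → Prop := fun y => ∀ᶠ t in L, ¬ {z | B t z ∧ z < y}.Infinite
    have hQ : DefMap S Q := hL.defMap N (fun y t => ¬ {z | B t z ∧ z < y}.Infinite) (by fun_prop)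
    have hQM : Q M := by
      obtain ⟨M0, hM0⟩ := exists_lt M
      obtain ⟨c, -, hc2, hc3⟩ := exists_between_not_mem hE' hM0
      filter_upwards [hM, hev c hc3] with t h1 h2
      refine not_infinite.2 (Set.finite_empty.subset ?_)
      rintro z ⟨hz, hz'⟩
      refine h2 ?_
      rcases le_total c z with h | h
      · exact (const_of_locC (hBt t) h fun y h3 h4 => by_contra fun h5 => (h1 y h5).1.not_gt (by order)).2 hz
      · exact (const_of_locC (hBt t) h fun y h3 h4 => by_contra fun h5 => (h1 y h5).1.not_gt (by order)).1 hz
    have hQM' : ¬ Q M' := by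
      intro hq
      obtain ⟨M0, hM0⟩ := exists_gt M'
      obtain ⟨c, hc2, -, hc3⟩ := exists_between_not_mem hE' hM0
      obtain ⟨t, h1, h2, h3, h4⟩ := (hM.and ((hev c hc3).and (hq.and hP))).exists
      refine h4 ((not_infinite.1 h3).subset fun z hz => ⟨hz, lt_of_not_ge fun hz' => h2 ?_⟩)
      rcases le_total c z with h | h
      · exact (const_of_locC (hBt t) h fun y h3 h4 => by_contra fun h5 => (h1 y h5).2.not_ge (by order)).2 hz
      · exact (const_of_locC (hBt t) h fun y h3 h4 => by_contra fun h5 => (h1 y h5).2.not_ge (by order)).1 hz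
    have hmono : ∀ y z, Q z → y ≤ z → Q y := fun y z hz hyz => Filter.Eventually.mono hz
      fun t ht h => ht (h.mono fun w hw => ⟨hw.1, hw.2.trans_le hyz⟩)
    obtain ⟨c, hc⟩ := exists_lub hQ ⟨M, hQM⟩ ⟨M', fun y hy => le_of_not_ge fun h => hQM' (hmono _ _ hy h)⟩
    obtain ⟨u, v, huc, hcv, a', b', ha', hb', hs⟩ := hsep c
    obtain ⟨u', hu1, hu2, hu3⟩ := exists_between_not_mem hE' huc
    obtain ⟨v', hv1, hv2, hv3⟩ := exists_between_not_mem hE' hcv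
    have hu4 : Q u' := by
      by_contra h
      refine (hc.2 (fun y hy => le_of_not_ge fun h' => h (hmono _ _ hy h'))).not_gt hu2
    have hv4 : ∀ᶠ t in L, {z | B t z ∧ z < v'}.Infinite := by
      refine (hL.dich _ (by fun_prop)).resolve_right fun h => ?_
      exact (hc.1 (show v' ∈ {y | Q y} from h)).not_gt hv1
    obtain ⟨t, h1, h2, h3, h4, h5⟩ := ((hev u' hu3).and ((hev v' hv3).and ((hL.mem a' b' ha' hb').and
      (hv4.and hu4)))).exists
    have h6 := subsingleton_of_bdry (hBt t) (u := u') (v := v')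
      (fun z z' h5 h6 h7 h8 h9 h10 => hs t h3.1 h3.2 z z' (by order) (by order) (by order) (by order)
        (by_contra fun h => h9 (hY t z h)) (by_contra fun h => h10 (hY t z' h))) h1 h2
    refine h4 (((not_infinite.1 h5).union h6).subset fun z hz => ?_)
    rcases lt_or_ge z u' with h | h
    · exact Or.inl ⟨hz.1, h⟩
    · exact Or.inr ⟨⟨h, hz.2.le⟩, hz.1⟩

/-- `T` is locally constant, relative to `G`, along every coordinate line. -/
def SegInv {d : ℕ} (G T : (Fin d → N) → Prop) : Prop :=
  ∀ w, G w → ∀ l, ∃ a b, a < w l ∧ w l < b ∧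
    ∀ t, a < t → t < b → G (Function.update w l t) → (T (Function.update w l t) ↔ T w)

/-- A definable set `G` has a finite set of representatives for its relatively invariant definable
subsets of full dimension. -/
theorem exists_finite_rep {d : ℕ} {G : (Fin d → N) → Prop} (hG : DefMap S G) :
    ∃ P : Set (Fin d → N), P.Finite ∧ (∀ w ∈ P, G w) ∧
      ∀ T : (Fin d → N) → Prop, DefMap S T → Lg d (fun w => T w ∧ G w) → SegInv G T → ∃ w ∈ P, T w := by
  induction d with
  | zero =>
    refine ⟨{w | G w}, Set.toFinite _, fun w hw => hw, fun T _ h _ => ?_⟩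
    obtain ⟨w, hw⟩ := h
    exact ⟨w, hw.2, hw.1⟩
  | succ d ih =>
    let A : Fin d → (Fin d → N) → N → N → Prop := fun l w t y => G (Fin.snoc (Function.update w l t) y)
    have hA : ∀ l, DefMap S fun p : (Fin d → N) × N × N => A l p.1 p.2.1 p.2.2 := fun l => by
      simp only [A]; fun_prop
    have hA' : ∀ l w, DefMap S fun p : N × N => A l w p.1 p.2 := fun l w => by
      simp only [A]; fun_prop
    let Y : Fin d → (Fin d → N) → N → N → Prop := fun l w t y => ¬ LocC (A l w t) y
    have hY : ∀ l, DefMap S fun p : (Fin d → N) × N × N => Y l p.1 p.2.1 p.2.2 := fun l => by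
      have := hA l
      simp only [Y]; fun_prop
    have hY' : ∀ l w, DefMap S fun p : N × N => Y l w p.1 p.2 := fun l w => by
      have := hY l
      fun_prop
    have hYfin : ∀ l w t, {y | Y l w t y}.Finite := fun l w t =>
      finite_not_locC (by have := hA' l w; fun_prop)
    let Bad : Fin d → (Fin d → N) → Prop := fun l w =>
      ¬ (¬ {y | ¬ LocC (fun t => A l w t y) (w l)}.Infinite ∧ BddNear (Y l w) (w l) ∧ SepNear (Y l w) (w l))
    have hBad : ∀ l, DefMap S (Bad l) := fun l => by
      have h1 := hA l
      have h2 := hY l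
      simp only [Bad]; fun_prop
    have hbad : ¬ Lg d fun w => ∃ l ∈ (Set.univ : Set (Fin d)), Bad l w := by
      intro h
      obtain ⟨l, -, hl⟩ := h.exists_of_finite Set.finite_univ
      refine not_lg_of_line l (hBad l) (fun w => ?_) hl
      have h1 : {t | {y | ¬ LocC (fun t => A l w t y) t}.Infinite}.Finite := by
        by_contra hinf
        obtain ⟨y, hy⟩ := exists_infinite_fiber (S := S) (A := fun t y => ¬ LocC (fun t => A l w t y) t)
          (by have := hA' l w; fun_prop) hinf
        exact hy (finite_not_locC (by have := hA' l w; fun_prop))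
      refine ((h1.union (finite_not_bddNear (hY' l w) (hYfin l w))).union
        (finite_not_sepNear (hY' l w) (hYfin l w))).subset fun t ht => ?_
      by_contra hcon
      have hu : ∀ t, A l (Function.update w l t) = A l w := fun t => by
        funext s y; simp only [A, Function.update_idem]
      have hu' : ∀ t, Y l (Function.update w l t) = Y l w := fun t => by
        simp only [Y, hu]
      refine ht ?_
      simp only [hu, hu', Function.update_self]
      simp only [mem_union, not_or] at hcon
      exact ⟨hcon.1.1, not_not.1 hcon.1.2, not_not.1 hcon.2⟩
    obtain ⟨P', hPf, hPG, hP⟩ := ih (G := fun w => ¬ ∃ l ∈ (Set.univ : Set (Fin d)), Bad l w) (by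
      simp only [mem_univ, true_and]
      exact (DefMap.exFin fun l => hBad l).not)
    have hrep := fun w : Fin d → N => exists_rep (S := S) (A := fun y => G (Fin.snoc w y)) (by fun_prop)
    choose R hRf hRG hR using hrep
    refine ⟨⋃ w ∈ P', (fun y => (Fin.snoc w y : Fin (d + 1) → N)) '' R w,
      hPf.biUnion fun w _ => (hRf w).image _, ?_, fun T hT hL hseg => ?_⟩
    · intro w hw
      simp only [mem_iUnion] at hw
      obtain ⟨w', -, y, hy, rfl⟩ := hw
      exact hRG w' y hy
    · obtain ⟨w, hw, hTw⟩ := hP (fun w => {y | T (Fin.snoc w y) ∧ G (Fin.snoc w y)}.Infinite)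
        (by fun_prop) (Lg.and_not (d := d) hL hbad) (fun w hw l => by
          have hgood : ¬ Bad l w := fun h => hw ⟨l, mem_univ _, h⟩
          simp only [Bad, not_not] at hgood
          have key := locC_infinite (S := S)
            (B := fun t y => T (Fin.snoc (Function.update w l t) y) ∧ A l w t y) (Y := Y l w) (x := w l)
            (by have := hA' l w; fun_prop) (not_infinite.1 hgood.1) (fun y hy => ?_) (fun t y hy => ?_)
            hgood.2.1 hgood.2.2
          · obtain ⟨a, b, ha, hb, h⟩ := key
            refine ⟨a, b, ha, hb, fun t h1 h2 _ => ?_⟩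
            simpa only [A, Function.update_eq_self] using h t h1 h2
          · have hy' : LocC (fun t => A l w t y) (w l) := by simpa using hy
            obtain ⟨a, b, ha, hb, h⟩ := hy'
            by_cases hG1 : A l w (w l) y
            · obtain ⟨a', b', ha', hb', h'⟩ := hseg (Fin.snoc w y)
                (by simpa only [A, Function.update_eq_self] using hG1) l.castSucc
              simp only [Fin.snoc_castSucc] at ha' hb'
              refine ⟨max a a', min b b', max_lt ha ha', lt_min hb hb', fun t h1 h2 => ?_⟩
              rw [max_lt_iff] at h1
              rw [lt_min_iff] at h2
              have h3 := h t h1.1 h2.1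
              have h4 := h' t h1.2 h2.2
              rw [← Fin.snoc_update] at h4
              simp only [Function.update_eq_self]
              refine and_congr (h4 (h3.2 hG1)) (by simpa only [Function.update_eq_self] using h3)
            · exact ⟨a, b, ha, hb, fun t h1 h2 =>
                iff_of_false (fun h3 => hG1 ((h t h1 h2).1 h3.2)) fun h3 => hG1 h3.2⟩
          · have hy' : LocC (A l w t) y := by simpa [Y] using hy
            obtain ⟨a, b, ha, hb, h⟩ := hy'
            by_cases hG1 : A l w t y
            · obtain ⟨a', b', ha', hb', h'⟩ := hseg (Fin.snoc (Function.update w l t) y) hG1 (Fin.last d)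
              simp only [Fin.snoc_last] at ha' hb'
              refine ⟨max a a', min b b', max_lt ha ha', lt_min hb hb', fun s h1 h2 => ?_⟩
              rw [max_lt_iff] at h1
              rw [lt_min_iff] at h2
              have h3 := h s h1.1 h2.1
              have h4 := h' s h1.2 h2.2
              rw [Fin.update_snoc_last] at h4
              exact and_congr (h4 (h3.2 hG1)) h3
            · exact ⟨a, b, ha, hb, fun s h1 h2 =>
                iff_of_false (fun h3 => hG1 ((h s h1 h2).1 h3.2)) fun h3 => hG1 h3.2⟩)
      obtain ⟨r, hr, hTr⟩ := hR w (fun y => T (Fin.snoc w y)) (by fun_prop) hTw (fun y hy => by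
        obtain ⟨a, b, ha, hb, h⟩ := hseg (Fin.snoc w y) hy (Fin.last d)
        simp only [Fin.snoc_last, Fin.update_snoc_last] at ha hb h
        exact ⟨a, b, ha, hb, h⟩)
      exact ⟨_, mem_biUnion hw ⟨r, hr, rfl⟩, hTr⟩

end Germs

section Families

variable {N : Type u} [LinearOrder N] [DenselyOrdered N] [NoMinOrder N] [NoMaxOrder N] [Nonempty N]
  {S : Struc N}

/-- The point `x` lies in the open box with lower and upper corners given by `O`. -/
def InBox {m : ℕ} (O : Fin (m + m) → N) (x : Fin m → N) : Prop :=
  ∀ i, O (Fin.castAdd m i) < x i ∧ x i < O (Fin.natAdd m i)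

@[fun_prop]
theorem DefMap.inBox {Γ : Type*} [Interp S Γ] {m : ℕ} {O : Γ → Fin (m + m) → N} {f : Γ → Fin m → N}
    (hO : DefMap S O) (hf : DefMap S f) : DefMap S fun x => InBox (O x) (f x) := by
  simp only [InBox]; fun_prop

theorem lg_box_around {m : ℕ} {x : Fin m → N} {B : Fin (m + m) → N} (h : InBox B x) :
    Lg (m + m) fun O => InBox O x ∧ ∀ y, InBox O y → InBox B y :=
  (lg_nbhd (fun i => (h i).1) fun i => (h i).2).mono fun _ hO =>
    ⟨fun i => ⟨(hO i).1.2, (hO i).2.1⟩, fun _ hy i =>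
      ⟨(hO i).1.1.trans (hy i).1, (hy i).2.trans (hO i).2.2⟩⟩

theorem exists_isolating_box {m : ℕ} {F : Set (Fin m → N)} (hF : F.Finite) (x : Fin m → N) :
    ∃ B, InBox B x ∧ ∀ y ∈ F, InBox B y → y = x := by
  choose u v hu hv h using fun i => exists_isolating (hF.image fun y => y i) (x i)
  refine ⟨Fin.append u v, fun i => ?_, fun y hy hB => funext fun i => ?_⟩
  · rw [Fin.append_left, Fin.append_right]; exact ⟨hu i, hv i⟩
  · have := hB i
    rw [Fin.append_left, Fin.append_right] at this
    exact h i _ ⟨y, hy, rfl⟩ this.1 this.2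

/-- A definable way of saying that `Y` is finite. -/
def FinFam {m : ℕ} (Y : (Fin m → N) → Prop) : Prop := ∀ i, ¬ {y | ∃ a, Y a ∧ a i = y}.Infinite

theorem finFam_iff {m : ℕ} {Y : (Fin m → N) → Prop} : FinFam Y ↔ {a | Y a}.Finite := by
  constructor
  · intro h
    refine (Set.Finite.pi' fun i => not_infinite.1 (h i)).subset fun a ha i => ⟨a, ha, rfl⟩
  · intro h i
    refine not_infinite.2 ((h.image fun a => a i).subset ?_)
    rintro _ ⟨a, ha, rfl⟩
    exact ⟨a, ha, rfl⟩

@[fun_prop]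
theorem DefMap.finFam {Γ : Type*} [Interp S Γ] {m : ℕ} {Y : Γ → (Fin m → N) → Prop}
    (hY : DefMap S fun p : Γ × (Fin m → N) => Y p.1 p.2) : DefMap S fun x => FinFam (Y x) := by
  simp only [FinFam]; fun_prop

variable {m : ℕ}

/-- Some points of `E` stay close to each point of `E t`. -/
def Lsc (E : N → (Fin m → N) → Prop) (t : N) : Prop :=
  ∀ a, E t a → ∀ O, InBox O a → ∃ u v, u < t ∧ t < v ∧ ∀ s, u < s → s < v → ∃ a', E s a' ∧ InBox O a'

/-- The points of `E` stay away from the points outside `E t`. -/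
def Usc (E : N → (Fin m → N) → Prop) (t : N) : Prop :=
  ∀ a, ¬ E t a → ∃ O, InBox O a ∧ ∃ u v, u < t ∧ t < v ∧ ∀ s, u < s → s < v → ∀ a', E s a' → ¬ InBox O a'

/-- The family `E` is bounded near `t`. -/
def Bdd (E : N → (Fin m → N) → Prop) (t : N) : Prop :=
  ∃ O u v, u < t ∧ t < v ∧ ∀ s, u < s → s < v → ∀ a', E s a' → InBox O a'

section
variable {Γ : Type*} [Interp S Γ] {E : Γ → N → (Fin m → N) → Prop} {f : Γ → N}

@[fun_prop]
theorem DefMap.lsc (hE : DefMap S fun p : Γ × N × (Fin m → N) => E p.1 p.2.1 p.2.2)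
    (hf : DefMap S f) : DefMap S fun x => Lsc (E x) (f x) := by simp only [Lsc]; fun_prop

@[fun_prop]
theorem DefMap.usc (hE : DefMap S fun p : Γ × N × (Fin m → N) => E p.1 p.2.1 p.2.2)
    (hf : DefMap S f) : DefMap S fun x => Usc (E x) (f x) := by simp only [Usc]; fun_prop

@[fun_prop]
theorem DefMap.bdd (hE : DefMap S fun p : Γ × N × (Fin m → N) => E p.1 p.2.1 p.2.2)
    (hf : DefMap S f) : DefMap S fun x => Bdd (E x) (f x) := by simp only [Bdd]; fun_prop

end

variable {E : N → (Fin m → N) → Prop}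

theorem finite_not_lsc (hE : DefMap S fun p : N × (Fin m → N) => E p.1 p.2) :
    {t | FinFam (E t) ∧ ¬ Lsc E t}.Finite := by
  let Bx : N → (Fin (m + m) → N) → Prop := fun t O =>
    ¬ ∃ u v, u < t ∧ t < v ∧ ∀ s, u < s → s < v → ∃ a', E s a' ∧ InBox O a'
  have hBx : DefMap S fun p : N × (Fin (m + m) → N) => Bx p.1 p.2 := by simp only [Bx]; fun_prop
  refine finite_of_param (S := S) (k := m + m) (Φ := fun t O => (∃ a, E t a ∧ InBox O a) ∧ Bx t O)
    (by fun_prop) (by fun_prop) ?_ ?_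
  · rintro t ⟨-, h⟩
    simp only [Lsc, not_forall] at h
    obtain ⟨a, ha, B, hB, h⟩ := h
    refine (lg_box_around hB).mono fun O hO => ⟨⟨a, ha, hO.1⟩, ?_⟩
    rintro ⟨u, v, hu, hv, h'⟩
    refine h ⟨u, v, hu, hv, fun s h1 h2 => ?_⟩
    obtain ⟨a', h3, h4⟩ := h' s h1 h2
    exact ⟨a', h3, hO.2 _ h4⟩
  · rintro t O u v - hu hv h
    exact (h t hu hv).2 ⟨u, v, hu, hv, fun s h1 h2 => (h s h1 h2).1⟩

theorem finite_not_usc (hE : DefMap S fun p : N × (Fin m → N) => E p.1 p.2) :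
    {t | FinFam (E t) ∧ ¬ Usc E t}.Finite := by
  let Bp : N → (Fin m → N) → Prop := fun t a => ¬ E t a ∧
    ¬ ∃ O, InBox O a ∧ ∃ u v, u < t ∧ t < v ∧ ∀ s, u < s → s < v → ∀ a', E s a' → ¬ InBox O a'
  have hBp : DefMap S fun p : N × (Fin m → N) => Bp p.1 p.2 := by simp only [Bp]; fun_prop
  refine finite_of_param (S := S) (k := m + m)
    (Φ := fun t O => (∀ a', E t a' → ¬ InBox O a') ∧ ∃ a, Bp t a ∧ InBox O a)
    (by fun_prop) (by fun_prop) ?_ ?_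
  · rintro t ⟨hfin, h⟩
    simp only [Usc, not_forall] at h
    obtain ⟨a, ha, h⟩ := h
    obtain ⟨B, hB, hB'⟩ := exists_isolating_box (finFam_iff.1 hfin) a
    refine (lg_box_around hB).mono fun O hO => ⟨fun a' h1 h2 => ?_, a, ⟨ha, h⟩, hO.1⟩
    exact ha (hB' a' h1 (hO.2 _ h2) ▸ h1)
  · rintro t O u v - hu hv h
    obtain ⟨a, ha, hO⟩ := (h t hu hv).2
    exact ha.2 ⟨O, hO, u, v, hu, hv, fun s h1 h2 => (h s h1 h2).1⟩

theorem finite_not_bdd (hE : DefMap S fun p : N × (Fin m → N) => E p.1 p.2) :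
    {t | FinFam (E t) ∧ ¬ Bdd E t}.Finite := by
  refine finite_of_param (S := S) (k := m + m) (Φ := fun t O => ∀ a', E t a' → InBox O a')
    (by fun_prop) (by fun_prop) ?_ ?_
  · rintro t ⟨hfin, -⟩
    choose u v _ h using fun i => exists_bounds ((finFam_iff.1 hfin).image fun y => y i)
    choose u' hu' using fun i => exists_lt (u i)
    choose v' hv' using fun i => exists_gt (v i)
    refine (lg_box (a := Fin.append u' v) (b := Fin.append u v') fun i => ?_).mono fun O hO a ha i => ?_
    · refine Fin.addCases (fun i => ?_) (fun i => ?_) i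
      · simpa only [Fin.append_left] using hu' i
      · simpa only [Fin.append_right] using hv' i
    · have h1 := hO (Fin.castAdd m i)
      have h2 := hO (Fin.natAdd m i)
      have h3 := h i _ ⟨a, ha, rfl⟩
      simp only [Fin.append_left, Fin.append_right] at h1 h2
      exact ⟨h1.2.trans h3.1, h3.2.trans h2.1⟩
  · rintro t O u v h hu hv hI
    exact h.2 ⟨O, u, v, hu, hv, hI⟩

/-- A bounded definable family of nonempty sets has a limit point along a germ. -/
theorem exists_limit {L : Filter N} {t : N} (hL : IsGerm S L t) {n : ℕ} {E : N → (Fin n → N) → Prop}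
    (hE : DefMap S fun p : N × (Fin n → N) => E p.1 p.2) (h1 : ∀ᶠ t in L, ∃ a, E t a)
    {lo hi : Fin n → N} (h2 : ∀ᶠ t in L, ∀ a, E t a → ∀ i, lo i < a i ∧ a i < hi i) :
    ∃ x : Fin n → N, ∀ u v : Fin n → N, (∀ i, u i < x i ∧ x i < v i) →
      ∀ᶠ t in L, ∃ a, E t a ∧ ∀ i, u i < a i ∧ a i < v i := by
  have := hL.neBot
  induction n with
  | zero => exact ⟨Fin.elim0, fun u v _ => h1.mono fun t ⟨a, ha⟩ => ⟨a, ha, fun i => i.elim0⟩⟩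
  | succ n ih =>
    obtain ⟨x, hx⟩ := ih (E := fun t b => ∃ y, E t (Fin.snoc b y)) (by fun_prop)
      (h1.mono fun t ⟨a, ha⟩ => ⟨Fin.init a, a (Fin.last n), by simpa using ha⟩)
      (lo := fun i => lo i.castSucc) (hi := fun i => hi i.castSucc)
      (h2.mono fun t h b ⟨y, hy⟩ i => by simpa using h _ hy i.castSucc)
    let Q : N → Prop := fun y => ∀ u v : Fin n → N, (∀ i, u i < x i ∧ x i < v i) →
      ∀ᶠ t in L, ∃ b z, E t (Fin.snoc b z) ∧ (∀ i, u i < b i ∧ b i < v i) ∧ z < y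
    have hQ : DefMap S Q := by
      have := hL.defMap (N × (Fin n → N) × (Fin n → N)) (fun p t => ∃ b z, E t (Fin.snoc b z) ∧
        (∀ i, p.2.1 i < b i ∧ b i < p.2.2 i) ∧ z < p.1) (by fun_prop)
      refine DefMap.all (DefMap.all (DefMap.imp (by fun_prop) ?_))
      exact this.comp (g := fun p : (N × (Fin n → N)) × (Fin n → N) => (p.1.1, p.1.2, p.2)) (by fun_prop)
    have hmono : ∀ y z, Q y → y ≤ z → Q z := fun y z hy hyz u v huv => (hy u v huv).mono
      fun t ⟨b, w, h3, h4, h5⟩ => ⟨b, w, h3, h4, h5.trans_le hyz⟩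
    have hlow : ∀ y, Q y → lo (Fin.last n) ≤ y := by
      intro y hy
      choose u hu using fun i => exists_lt (x i)
      choose v hv using fun i => exists_gt (x i)
      obtain ⟨t, ⟨b, z, h3, -, h4⟩, h5⟩ := ((hy u v fun i => ⟨hu i, hv i⟩).and h2).exists
      have := (h5 _ h3 (Fin.last n)).1
      rw [Fin.snoc_last] at this
      exact (this.trans h4).le
    obtain ⟨c, hc⟩ := exists_glb hQ ⟨hi (Fin.last n), fun u v huv => by
      filter_upwards [hx u v huv, h2] with t ⟨b, ⟨y, hy⟩, hb⟩ h4
      exact ⟨b, y, hy, hb, by simpa using (h4 _ hy (Fin.last n)).2⟩⟩ ⟨_, hlow⟩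
    refine ⟨Fin.snoc x c, fun u v huv => ?_⟩
    have huvc := huv (Fin.last n)
    rw [Fin.snoc_last] at huvc
    have huvx : ∀ i : Fin n, u i.castSucc < x i ∧ x i < v i.castSucc := fun i => by
      simpa using huv i.castSucc
    obtain ⟨d, hd, hd'⟩ := exists_between huvc.1
    have hQd : ¬ Q d := fun h => (hc.1 h).not_gt hd'
    have hQv : Q (v (Fin.last n)) := by
      by_contra h
      exact (hc.2 fun y hy => le_of_not_ge fun h' => h (hmono _ _ hy h')).not_gt huvc.2
    simp only [Q, not_forall] at hQd
    obtain ⟨u', v', huv', h3⟩ := hQd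
    have h4 := (hL.dich _ (by fun_prop)).resolve_left h3
    filter_upwards [h4, hQv (fun i => max (u i.castSucc) (u' i)) (fun i => min (v i.castSucc) (v' i))
      fun i => ⟨max_lt (huvx i).1 (huv' i).1, lt_min (huvx i).2 (huv' i).2⟩]
    rintro t h5 ⟨b, z, h6, h7, h8⟩
    refine ⟨_, h6, fun i => ?_⟩
    refine Fin.lastCases ?_ (fun i => ?_) i
    · simp only [Fin.snoc_last]
      refine ⟨hd.trans_le (le_of_not_gt fun h => h5 ⟨b, z, h6, fun i => ?_, h⟩), h8⟩
      exact ⟨(le_max_right _ _).trans_lt (h7 i).1, (h7 i).2.trans_le (min_le_right _ _)⟩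
    · simp only [Fin.snoc_castSucc]
      exact ⟨(le_max_left _ _).trans_lt (h7 i).1, (h7 i).2.trans_le (min_le_left _ _)⟩

end Families

section Reps

variable {N : Type u} [LinearOrder N] [DenselyOrdered N] [NoMinOrder N] [NoMaxOrder N] [Nonempty N]
  {S : Struc N}

/-- `Q` meets every relatively clopen definable subset of maximal dimension in a point of a fixed
finite set. -/
theorem exists_finite_rep_clopen {m e : ℕ} {Q : (Fin m → N) → Prop} (hQ : DefMap S Q)
    (hfib : ∀ p : Fin e → Fin m, ¬ Lg e fun w => ¬ FinFam fun a => Q a ∧ (fun i => a (p i)) = w) :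
    ∃ F : Set (Fin m → N), F.Finite ∧ ∀ C : (Fin m → N) → Prop, DefMap S C → (∀ a, C a → Q a) →
      (∀ a, Q a → ∃ O, InBox O a ∧ ∀ b, Q b → InBox O b → (C b ↔ C a)) →
      (∃ p : Fin e → Fin m, Lg e fun w => ∃ a, C a ∧ (fun i => a (p i)) = w) → ∃ a ∈ F, C a := by
  let E : (Fin e → Fin m) → (Fin e → N) → (Fin m → N) → Prop := fun p w a =>
    Q a ∧ (fun i => a (p i)) = w
  have hE : ∀ p, DefMap S fun z : (Fin e → N) × (Fin m → N) => E p z.1 z.2 := fun p => by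
    simp only [E]; fun_prop
  let Bad : (Fin e → Fin m) → Fin e → (Fin e → N) → Prop := fun p l w => FinFam (E p w) ∧
    ¬ (Lsc (fun t => E p (Function.update w l t)) (w l) ∧
      Usc (fun t => E p (Function.update w l t)) (w l) ∧ Bdd (fun t => E p (Function.update w l t)) (w l))
  have hBad : ∀ p l, DefMap S (Bad p l) := fun p l => by
    have := hE p
    simp only [Bad]; fun_prop
  have hbad : ∀ p, ¬ Lg e fun w => ¬ FinFam (E p w) ∨ ∃ l ∈ (Set.univ : Set (Fin e)), Bad p l w := by
    intro p h
    rcases h.or with h | h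
    · exact hfib p h
    obtain ⟨l, -, hl⟩ := h.exists_of_finite Set.finite_univ
    refine not_lg_of_line l (hBad p l) (fun w => ?_) hl
    have hd : DefMap S fun z : N × (Fin m → N) => E p (Function.update w l z.1) z.2 := by
      have := hE p
      fun_prop
    refine (((finite_not_lsc (E := fun t => E p (Function.update w l t)) hd).union
      (finite_not_usc (E := fun t => E p (Function.update w l t)) hd)).union
      (finite_not_bdd (E := fun t => E p (Function.update w l t)) hd)).subset fun t ht => ?_
    have ht : Bad p l (Function.update w l t) := ht
    simp only [Bad, Function.update_idem, Function.update_self] at ht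
    by_contra hcon
    simp only [mem_union, Set.mem_ofPred_eq, not_or, not_and, not_not] at hcon
    exact ht.2 ⟨hcon.1.1 ht.1, hcon.1.2 ht.1, hcon.2 ht.1⟩
  have hGd : ∀ p, DefMap S fun w => ¬ (¬ FinFam (E p w) ∨ ∃ l ∈ (Set.univ : Set (Fin e)), Bad p l w) := by
    intro p
    have h1 : DefMap S fun w => ∃ l : Fin e, Bad p l w := DefMap.exFin fun l => hBad p l
    have := hE p
    simp only [mem_univ, true_and]
    fun_prop
  choose P hPf hPG hP using fun p => exists_finite_rep (hGd p)
  refine ⟨⋃ p, ⋃ w ∈ P p, {a | E p w a}, Set.finite_iUnion fun p => (hPf p).biUnion fun w hw => ?_,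
    fun C hC hCQ hloc ⟨p, hp⟩ => ?_⟩
  · have := hPG p w hw
    push Not at this
    exact finFam_iff.1 this.1
  obtain ⟨w, hw, a, ha, hap⟩ := hP p (fun w => ∃ a, C a ∧ (fun i => a (p i)) = w) (by fun_prop)
    (hp.and_not (hbad p)) (fun w hw l => by
      push Not at hw
      obtain ⟨hl, hu, hb⟩ := by_contra fun h => hw.2 l (mem_univ _) ⟨hw.1, h⟩
      refine exists_nhd_of_germ (S := S) (x := w l)
        (P := fun t => (¬ (¬ FinFam (E p (Function.update w l t)) ∨ ∃ l' ∈ (Set.univ : Set (Fin e)),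
          Bad p l' (Function.update w l t))) → ((∃ a, C a ∧ (fun i => a (p i)) = Function.update w l t) ↔
          ∃ a, C a ∧ (fun i => a (p i)) = w)) (by simp) fun L hL => ?_
      have := hL.neBot
      by_cases hT : ∃ a, C a ∧ (fun i => a (p i)) = w
      · obtain ⟨a, ha, haw⟩ := hT
        obtain ⟨O, hO, hO'⟩ := hloc a (hCQ a ha)
        obtain ⟨α, β, hα, hβ, hs⟩ := hl a (by simpa [E] using ⟨hCQ a ha, haw⟩) O hO
        filter_upwards [hL.mem α β hα hβ] with t ht _
        obtain ⟨b, hb, hb'⟩ := hs t ht.1 ht.2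
        exact iff_of_true ⟨b, (hO' b hb.1 hb').2 ha, hb.2⟩ ⟨a, ha, haw⟩
      · have hd : DefMap S fun t => ∃ a, C a ∧ (fun i => a (p i)) = Function.update w l t := by fun_prop
        rcases hL.dich _ hd with h | h
        · exfalso
          obtain ⟨B, α, β, hα, hβ, hB⟩ := hb
          obtain ⟨x, hx⟩ := exists_limit hL
            (E := fun t a => C a ∧ (fun i => a (p i)) = Function.update w l t) (by fun_prop) h
            (lo := fun i => B (Fin.castAdd m i)) (hi := fun i => B (Fin.natAdd m i))
            ((hL.mem α β hα hβ).mono fun t ht a ha => hB t ht.1 ht.2 a ⟨hCQ a ha.1, ha.2⟩)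
          have hx' : ∀ O, InBox O x → ∀ᶠ t in L, ∃ a, (C a ∧ (fun i => a (p i)) = Function.update w l t) ∧
            InBox O a := fun O hO => hx (fun i => O (Fin.castAdd m i)) (fun i => O (Fin.natAdd m i)) hO
          have hxE : E p w x := by
            by_contra hxE
            obtain ⟨O, hO, α, β, hα, hβ, hs⟩ := hu x (by simpa using hxE)
            obtain ⟨t, ⟨a, ha, ha'⟩, ht⟩ := ((hx' O hO).and (hL.mem α β hα hβ)).exists
            exact hs t ht.1 ht.2 a ⟨hCQ a ha.1, ha.2⟩ ha'
          obtain ⟨O, hO, hO'⟩ := hloc x hxE.1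
          obtain ⟨t, a, ha, ha'⟩ := (hx' O hO).exists
          exact hT ⟨x, (hO' a (hCQ a ha.1) ha').1 ha.1, hxE.2⟩
        · exact h.mono fun t ht _ => iff_of_false ht hT)
  exact ⟨a, mem_iUnion.2 ⟨p, mem_biUnion hw ⟨hCQ a ha, hap⟩⟩, ha⟩

end Reps

section Grp

variable {N : Type u} [LinearOrder N] [DenselyOrdered N] [NoMinOrder N] [NoMaxOrder N] [Nonempty N]
  {S : Struc N}

variable (S) in
/-- The group operations of `G` are definable. -/
class DefGrp (G : Type*) [Group G] [Interp S G] : Prop where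
  mul_def : DefMap S fun p : G × G => p.1 * p.2
  inv_def : DefMap S fun x : G => x⁻¹

variable {G : Type*} [Group G] [Interp S G]

@[fun_prop]
theorem DefMap.mul [DefGrp S G] {Γ : Type*} [Interp S Γ] {f g : Γ → G} (hf : DefMap S f) (hg : DefMap S g) :
    DefMap S fun x => f x * g x :=
  DefMap.comp (DefGrp.mul_def (S := S) (G := G)) (hf.prodMk hg)

@[fun_prop]
theorem DefMap.inv [DefGrp S G] {Γ : Type*} [Interp S Γ] {f : Γ → G} (hf : DefMap S f) :
    DefMap S fun x => (f x)⁻¹ :=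
  DefMap.comp (DefGrp.inv_def (S := S) (G := G)) hf

variable (S) in
/-- The subgroup `K` is definable. -/
class DefSub (K : Subgroup G) : Prop where
  mem_def : DefMap S fun x : G => x ∈ K

@[fun_prop]
theorem DefMap.memSub {K : Subgroup G} [DefSub S K] {Γ : Type*} [Interp S Γ] {f : Γ → G}
    (hf : DefMap S f) : DefMap S fun x => f x ∈ K :=
  DefMap.comp (DefSub.mem_def (S := S) (K := K)) hf

instance (K L : Subgroup G) [DefSub S K] [DefSub S L] : DefSub S (K ⊓ L) :=
  ⟨by simp only [Subgroup.mem_inf]; fun_prop⟩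

instance : DefSub S (⊤ : Subgroup G) := ⟨by simp only [Subgroup.mem_top]; fun_prop⟩

instance : DefSub S (⊥ : Subgroup G) := ⟨by simp only [Subgroup.mem_bot]; fun_prop⟩

theorem defP_coset_eq [DefGrp S G] (K : Subgroup G) [DefSub S K] :
    DefP S fun p : G × G => (p.1 : G ⧸ K) = (p.2 : G ⧸ K) := by
  rw [defP_iff]; simp only [QuotientGroup.eq]; fun_prop

/-- The interpretation of the space of left cosets of a definable subgroup. -/
instance instInterpCosets [DefGrp S G] (K : Subgroup G) [DefSub S K] : Interp S (G ⧸ K) :=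
  Interp.ofSurj (QuotientGroup.mk (s := K)) QuotientGroup.mk_surjective (defP_coset_eq K)

theorem DefMap.cosets [DefGrp S G] (K : Subgroup G) [DefSub S K] :
    DefMap S fun x : G => (x : G ⧸ K) :=
  DefMap.ofSurj _ QuotientGroup.mk_surjective (defP_coset_eq K)

variable (S) in
/-- All cosets of `K` have dimension at least `d`. -/
def CosetDim (d : ℕ) (K : Subgroup G) : Prop := ∀ g : G, DimGE S d fun x => g⁻¹ * x ∈ K

theorem cosetDim_zero (K : Subgroup G) : CosetDim S 0 K :=
  fun g => DimGE.of_nonempty ⟨g, by simp [K.one_mem]⟩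

theorem CosetDim.le {d : ℕ} {K : Subgroup G} (h : CosetDim S d K) : d ≤ ar S G := (h 1).le

theorem CosetDim.succ [DefGrp S G] {d : ℕ} {K H : Subgroup G} [DefSub S K] [DefSub S H]
    (hKH : K ≤ H) (hinf : K.relIndex H = 0) (h : CosetDim S d K) : CosetDim S (d + 1) H := by
  intro g
  have hm : DefMap S fun x : G => (x : G ⧸ K) := DefMap.cosets (S := S) K
  refine (DimGE.iUnion (S := S) (Γ := G) (I := G ⧸ K) (C := fun i x => (x : G ⧸ K) = i)
    (Q := fun i => ∃ h, h ∈ H ∧ ((g * h : G) : G ⧸ K) = i) ?_ ?_ ?_ ?_ ?_).mono ?_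
  · exact (hm.comp DefMap.snd').eq DefMap.fst'
  · have : DefMap S fun p : (G ⧸ K) × G => ((g * p.2 : G) : G ⧸ K) = p.1 :=
      (hm.comp (g := fun p : (G ⧸ K) × G => g * p.2) (by fun_prop)).eq DefMap.fst'
    fun_prop
  · intro hfin
    have : Finite (H ⧸ K.subgroupOf H) := by
      have := hfin.to_subtype
      refine Finite.of_injective (β := {i : G ⧸ K | ∃ h, h ∈ H ∧ ((g * h : G) : G ⧸ K) = i})
        (fun q => ⟨((g * (q.out : H) : G) : G ⧸ K), _, q.out.2, rfl⟩) fun q q' hq => ?_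
      have := congrArg Subtype.val hq
      simp only [QuotientGroup.eq] at this
      rw [← q.out_eq', ← q'.out_eq']
      refine QuotientGroup.eq.2 ?_
      rw [Subgroup.mem_subgroupOf]
      simpa [mul_assoc] using this
    exact Subgroup.index_ne_zero_of_finite (H := K.subgroupOf H) hinf
  · rintro i ⟨h', -, rfl⟩
    refine (h (g * h')).mono fun x hx => ?_
    exact (QuotientGroup.eq.2 hx).symm
  · rintro i j x - - rfl rfl; rfl
  · rintro x ⟨i, ⟨h', hh, rfl⟩, hi⟩
    have := hKH (QuotientGroup.eq.1 hi.symm)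
    simpa [mul_assoc] using H.mul_mem hh this

theorem DimGE.exists_of_finite {Γ : Type*} [Interp S Γ] {d : ℕ} {ι : Type*} {F : Set ι} (hF : F.Finite)
    {Y : ι → Γ → Prop} (h : DimGE S d fun γ => ∃ i ∈ F, Y i γ) : ∃ i ∈ F, DimGE S d (Y i) := by
  obtain ⟨p, hp⟩ := h
  obtain ⟨i, hi, h⟩ := Lg.exists_of_finite (P := fun i w => ∃ a, ∃ γ : Γ, rp S a γ ∧ Y i γ ∧ (fun i => a (p i)) = w)
    hF (hp.mono fun w ⟨a, γ, h1, ⟨i, hi, h2⟩, h3⟩ => ⟨i, hi, a, γ, h1, h2, h3⟩)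
  exact ⟨i, hi, p, h⟩

section Rep
variable {v : G → Fin (ar S G) → N}

theorem dimGE_iff (hv : ∀ a γ, OMin.rp S a γ ↔ a = v γ) {d : ℕ} {Y : G → Prop} : DimGE S d Y ↔
    ∃ p : Fin d → Fin (ar S G), Lg d fun w => ∃ γ, Y γ ∧ (fun i => v γ (p i)) = w := by
  refine exists_congr fun p => lg_congr fun w => ?_
  constructor
  · rintro ⟨a, γ, h1, h2, rfl⟩
    rw [hv] at h1; subst h1
    exact ⟨γ, h2, rfl⟩
  · rintro ⟨γ, h2, rfl⟩
    exact ⟨_, γ, (hv _ _).2 rfl, h2, rfl⟩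

theorem rep_injective (hv : ∀ a γ, OMin.rp S a γ ↔ a = v γ) : Function.Injective v := fun x y h =>
  Interp.uniq ((hv _ x).2 rfl) ((hv _ y).2 h)

theorem DefMap.rep (hv : ∀ a γ, OMin.rp S a γ ↔ a = v γ) : DefMap S v := DefMap.of_graph <| defP_iff.2 <| by
  have : DefMap S fun p : G × (Fin (ar S G) → N) => OMin.rp S p.2 p.1 := by fun_prop
  exact this.congrP fun x => by rw [hv]; exact eq_comm

theorem DimGE.image (hv : ∀ a γ, OMin.rp S a γ ↔ a = v γ) {d : ℕ} {Y : G → Prop} (hY : DefMap S Y) (h : DimGE S d Y) {f : G → G}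
    (hf : DefMap S f) (hinj : Function.Injective f) : DimGE S d fun y => ∃ x, Y x ∧ f x = y := by
  obtain ⟨p, hp⟩ := (dimGE_iff hv).1 h
  have hvd := DefMap.rep hv
  refine DimGE.of_surj (by fun_prop) (R := fun y w => ∃ x, f x = y ∧ (fun i => v x (p i)) = w)
    (by fun_prop) ?_ (hp.mono ?_)
  · rintro y w w' - ⟨x, rfl, rfl⟩ ⟨x', h1, rfl⟩
    rw [hinj h1]
  · rintro w ⟨x, hx, rfl⟩
    exact ⟨f x, ⟨x, hx, rfl⟩, x, rfl, rfl⟩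

theorem DimGE.translate (hv : ∀ a γ, OMin.rp S a γ ↔ a = v γ) [DefGrp S G] {d : ℕ} {Y : G → Prop} (hY : DefMap S Y) (h : DimGE S d Y) (g g' : G) :
    DimGE S d fun y => Y (g * y * g') := by
  refine (h.image hv hY (f := fun y => g⁻¹ * y * g'⁻¹) (by fun_prop) (fun x y h => by simpa using h)).mono ?_
  rintro _ ⟨x, hx, rfl⟩
  simpa [mul_assoc] using hx

theorem DimGE.of_infinite_fiber (hv : ∀ a γ, OMin.rp S a γ ↔ a = v γ) {e : ℕ} {Q : G → Prop} {p : Fin e → Fin (ar S G)}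
    (h : Lg e fun w => ¬ FinFam fun a => (∃ γ, Q γ ∧ v γ = a) ∧ (fun i => a (p i)) = w) :
    DimGE S (e + 1) Q := by
  obtain ⟨j, -, hj⟩ := Lg.exists_of_finite (P := fun j w => {y | ∃ a, ((∃ γ, Q γ ∧ v γ = a) ∧
    (fun i => a (p i)) = w) ∧ a j = y}.Infinite) (Set.finite_univ (α := Fin (ar S G))) (h.mono fun w hw => by
      simp only [FinFam] at hw
      push Not at hw
      obtain ⟨i, hi⟩ := hw
      exact ⟨i, mem_univ _, hi⟩)
  refine (dimGE_iff hv).2 ⟨Fin.snoc p j, Lg.mono (d := e + 1) (P := fun w => ∃ a, ((∃ γ, Q γ ∧ v γ = a) ∧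
    (fun i => a (p i)) = Fin.init w) ∧ a j = w (Fin.last e)) (hj.mono fun w hw => by simpa using hw) ?_⟩
  rintro w ⟨_, ⟨⟨γ, h1, rfl⟩, h2⟩, h3⟩
  refine ⟨γ, h1, funext fun i => ?_⟩
  refine Fin.lastCases ?_ (fun i => ?_) i
  · simpa using h3
  · simpa [Fin.init] using congrFun h2 i

end Rep

end Grp

section IndexBound

variable {N : Type u} [LinearOrder N] [DenselyOrdered N] [NoMinOrder N] [NoMaxOrder N] [Nonempty N]
  {S : Struc N} {G : Type*} [Group G] [Interp S G] [DefGrp S G]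
variable {v : G → Fin (ar S G) → N}

theorem exists_dim {Γ : Type*} [Interp S Γ] {Y : Γ → Prop} (h : ∃ γ, Y γ) :
    ∃ e, DimGE S e Y ∧ ¬ DimGE S (e + 1) Y := by
  by_contra! hcon
  have : ∀ e, DimGE S e Y := fun e => by
    induction e with
    | zero => exact DimGE.of_nonempty h
    | succ e ih => exact hcon e ih
  have := (this (ar S Γ + 1)).le
  omega

theorem DefMap.exFinite {Γ ι : Type*} [Interp S Γ] [Finite ι] {P : ι → Γ → Prop} (h : ∀ i, DefMap S (P i)) :
    DefMap S fun x => ∃ i, P i x := by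
  obtain ⟨n, ⟨f⟩⟩ := Finite.exists_equiv_fin ι
  have h1 : DefMap S fun x => ∃ i : Fin n, P (f.symm i) x := DefMap.exFin fun i => h _
  exact h1.congrP fun x => ⟨fun ⟨i, hi⟩ => ⟨f i, by simpa using hi⟩, fun ⟨i, hi⟩ => ⟨_, hi⟩⟩

theorem box_mem_nhds [TopologicalSpace N] [OrderTopology N] {m : ℕ} {O : Fin (m + m) → N} {x : Fin m → N} (h : InBox O x) :
    {y | InBox O y} ∈ 𝓝 x := by
  have : ∀ i, ∀ᶠ y in 𝓝 x, O (Fin.castAdd m i) < y i ∧ y i < O (Fin.natAdd m i) := fun i =>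
    ((continuous_apply i).tendsto x).eventually (Ioo_mem_nhds (h i).1 (h i).2)
  exact eventually_all.2 this

theorem exists_box_of_mem_nhds [TopologicalSpace N] [OrderTopology N] {m : ℕ} {x : Fin m → N} {W : Set (Fin m → N)} (h : W ∈ 𝓝 x) :
    ∃ O, InBox O x ∧ ∀ y, InBox O y → y ∈ W := by
  rw [nhds_pi, Filter.mem_pi'] at h
  obtain ⟨I, t, ht, hI⟩ := h
  choose a b hab hs using fun i => mem_nhds_iff_exists_Ioo_subset.1 (ht i)
  refine ⟨Fin.append a b, fun i => by simpa only [Fin.append_left, Fin.append_right, Set.mem_Ioo] using hab i, fun y hy => hI fun i _ => hs i ?_⟩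
  simpa only [Fin.append_left, Fin.append_right, Set.mem_Ioo] using hy i

theorem exists_sub_box {m e : ℕ} {O : Fin (m + m) → N} {x : Fin m → N} (hO : InBox O x) {q : Fin e → Fin m}
    {a b : Fin e → N} (h : ∀ i, a i < x (q i) ∧ x (q i) < b i) :
    ∃ B, InBox B x ∧ ∀ z, InBox B z → InBox O z ∧ ∀ i, a i < z (q i) ∧ z (q i) < b i := by
  let := Preorder.topology N
  have : OrderTopology N := ⟨rfl⟩
  exact exists_box_of_mem_nhds (W := {z | InBox O z ∧ ∀ i, a i < z (q i) ∧ z (q i) < b i}) <|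
    Filter.inter_mem (box_mem_nhds hO) <| eventually_all.2 fun i =>
      ((continuous_apply (q i)).tendsto x).eventually (Ioo_mem_nhds (h i).1 (h i).2)

/-- The points of `Z` which are not in its interior relative to `Y` form a small set. -/
theorem not_dimGE_boundary (hv : ∀ a γ, OMin.rp S a γ ↔ a = v γ) {Y Z : G → Prop} (hY : DefMap S Y) (hZ : DefMap S Z) {e : ℕ}
    (he : ¬ DimGE S (e + 1) Y) :
    ¬ DimGE S e fun x => Z x ∧ ¬ ∃ B, InBox B (v x) ∧ ∀ y, Y y → InBox B (v y) → Z y := by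
  intro hD
  have hvd := DefMap.rep hv
  obtain ⟨q, hq⟩ := (dimGE_iff hv).1 hD
  have h1 := hq.and_not (Q := fun w => ¬ FinFam fun a => (∃ γ, Y γ ∧ v γ = a) ∧
    (fun i => a (q i)) = w) fun h => he (DimGE.of_infinite_fiber hv h)
  have h2 : Lg e fun w => Lg (ar S G + ar S G) fun O => ∃ γ, (Z γ ∧ ¬ ∃ B, InBox B (v γ) ∧ ∀ y, Y y →
      InBox B (v y) → Z y) ∧ (fun i => v γ (q i)) = w ∧ InBox O (v γ) ∧ ∀ y, Y y →
      (fun i => v y (q i)) = w → InBox O (v y) → y = γ := by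
    refine h1.mono fun w ⟨⟨γ, hγ, hγw⟩, hfin⟩ => ?_
    rw [not_not, finFam_iff] at hfin
    obtain ⟨B, hB, hBF⟩ := exists_isolating_box hfin (v γ)
    refine (lg_box_around hB).mono fun O hO => ⟨γ, hγ, hγw, hO.1, fun y hy hyw hyO => ?_⟩
    exact rep_injective hv (hBF _ ⟨⟨y, hy, rfl⟩, hyw⟩ (hO.2 _ hyO))
  rw [lg_fubini (S := S) (A := fun w O => ∃ γ, (Z γ ∧ ¬ ∃ B, InBox B (v γ) ∧ ∀ y, Y y →
      InBox B (v y) → Z y) ∧ (fun i => v γ (q i)) = w ∧ InBox O (v γ) ∧ ∀ y, Y y →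
      (fun i => v y (q i)) = w → InBox O (v y) → y = γ) (by fun_prop)] at h2
  obtain ⟨O, hO⟩ := h2.exists
  obtain ⟨a, b, hab, hbox⟩ := hO.exists_box (S := S) (by fun_prop)
  choose w hw using fun i => exists_between (hab i)
  obtain ⟨x, hx, hxw, hxO, -⟩ := hbox w hw
  obtain ⟨B, hB, hBO⟩ := exists_sub_box hxO (q := q) (a := a) (b := b) fun i => by
    rw [show v x (q i) = w i from congrFun hxw i]; exact hw i
  refine hx.2 ⟨B, hB, fun y hy hyB => ?_⟩
  obtain ⟨γ, h1, h2, h3, h4⟩ := hbox (fun i => v y (q i)) (hBO _ hyB).2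
  obtain rfl := h4 y hy rfl (hBO _ hyB).1
  exact h1.1

/-- A definable map is continuous outside a small set. -/
theorem not_dimGE_discontinuous (hv : ∀ a γ, OMin.rp S a γ ↔ a = v γ) {Y : G → Prop} (hY : DefMap S Y) {f : G → G} (hf : DefMap S f)
    {e : ℕ} (he : ¬ DimGE S (e + 1) Y) :
    ¬ DimGE S e fun x => Y x ∧ ¬ ∀ O, InBox O (v (f x)) → ∃ B, InBox B (v x) ∧
      ∀ y, Y y → InBox B (v y) → InBox O (v (f y)) := by
  intro hD
  have hvd := DefMap.rep hv
  obtain ⟨q, hq⟩ := (dimGE_iff hv).1 hD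
  have h2 : Lg e fun w => Lg (ar S G + ar S G) fun O => ∃ x, (Y x ∧ InBox O (v (f x)) ∧ ¬ ∃ B, InBox B (v x) ∧
      ∀ y, Y y → InBox B (v y) → InBox O (v (f y))) ∧ (fun i => v x (q i)) = w := by
    refine hq.mono fun w ⟨x, ⟨hx, hbad⟩, hxw⟩ => ?_
    push Not at hbad
    obtain ⟨O', hO', hbad⟩ := hbad
    refine (lg_box_around hO').mono fun O hO => ⟨x, ⟨hx, hO.1, fun ⟨B, hB, h⟩ => ?_⟩, hxw⟩
    obtain ⟨y, hy, hyB, hyO⟩ := hbad B hB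
    exact hyO (hO.2 _ (h y hy hyB))
  rw [lg_fubini (S := S) (A := fun w O => ∃ x, (Y x ∧ InBox O (v (f x)) ∧ ¬ ∃ B, InBox B (v x) ∧
      ∀ y, Y y → InBox B (v y) → InBox O (v (f y))) ∧ (fun i => v x (q i)) = w) (by fun_prop)] at h2
  obtain ⟨O, hO⟩ := h2.exists
  refine not_dimGE_boundary hv hY (Z := fun x => Y x ∧ InBox O (v (f x))) (by fun_prop) he
    ((dimGE_iff hv).2 ⟨q, hO.mono fun w ⟨x, ⟨h1, h2, h3⟩, h4⟩ => ⟨x, ⟨⟨h1, h2⟩, fun ⟨B, hB, h⟩ =>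
      h3 ⟨B, hB, fun y hy hyB => (h y hy hyB).2⟩⟩, h4⟩⟩)

/-- The translation taking `x` to `x₀` is not continuous at `x`, on `Y`. -/
def BadAt (v : G → Fin (ar S G) → N) (Y : G → Prop) (x₀ x : G) : Prop :=
  ¬ ∀ O, InBox O (v x₀) → ∃ B, InBox B (v x) ∧ ∀ y, Y y → InBox B (v y) → InBox O (v (x₀ * x⁻¹ * y))

theorem DefMap.badAt (hv : ∀ a γ, OMin.rp S a γ ↔ a = v γ) {Y : G → Prop} (hY : DefMap S Y) : DefMap S fun p : G × G => BadAt v Y p.1 p.2 := by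
  have hvd := DefMap.rep hv
  simp only [BadAt]
  fun_prop

theorem not_dimGE_badAt (hv : ∀ a γ, OMin.rp S a γ ↔ a = v γ) {H : Subgroup G} [DefSub S H] {e : ℕ} (he : ¬ DimGE S (e + 1) fun x => x ∈ H) :
    ¬ DimGE S e fun x => x ∈ H ∧ DimGE S e fun x₀ => x₀ ∈ H ∧ BadAt v (· ∈ H) x₀ x := by
  intro hcon
  have hvd := DefMap.rep hv
  have hbd := DefMap.badAt hv (S := S) (Y := (· ∈ H)) (by fun_prop)
  obtain ⟨p, hp⟩ := (dimGE_iff hv).1 hcon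
  obtain ⟨q, -, hq⟩ := Lg.exists_of_finite (F := (Set.univ : Set (Fin e → Fin (ar S G))))
    (P := fun q z => ∃ x, (x ∈ H ∧ Lg e fun w => ∃ c, (c ∈ H ∧ BadAt v (· ∈ H) (c * x) x) ∧
      (fun i => v c (q i)) = w) ∧ (fun i => v x (p i)) = z) Set.finite_univ (hp.mono fun z ⟨x, ⟨hx, hu⟩, hz⟩ => by
      obtain ⟨q, hq⟩ := (dimGE_iff hv).1 (hu.translate hv (by fun_prop) 1 x)
      refine ⟨q, mem_univ _, x, ⟨hx, hq.mono fun w ⟨c, hc, hw⟩ => ⟨c, ⟨?_, ?_⟩, hw⟩⟩, hz⟩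
      · simpa [H.mul_mem_cancel_right hx] using hc.1
      · simpa using hc.2)
  have h3 : Lg e fun z => Lg e fun w => ∃ x c, (fun i => v x (p i)) = z ∧ x ∈ H ∧ c ∈ H ∧
      BadAt v (· ∈ H) (c * x) x ∧ (fun i => v c (q i)) = w :=
    hq.mono fun z ⟨x, ⟨hx, hu⟩, hz⟩ => hu.mono fun w ⟨c, hc, hw⟩ => ⟨x, c, hz, hx, hc.1, hc.2, hw⟩
  rw [lg_fubini (S := S) (A := fun z w => ∃ x c, (fun i => v x (p i)) = z ∧ x ∈ H ∧ c ∈ H ∧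
      BadAt v (· ∈ H) (c * x) x ∧ (fun i => v c (q i)) = w) (by fun_prop)] at h3
  obtain ⟨w, hw, hfin⟩ := (h3.and_not (Q := fun w => ¬ FinFam fun a => (∃ γ, γ ∈ H ∧ v γ = a) ∧
    (fun i => a (q i)) = w) fun h => he (DimGE.of_infinite_fiber hv h)).exists
  rw [not_not, finFam_iff] at hfin
  obtain ⟨a, ⟨⟨c, hc, rfl⟩, ha⟩, hL⟩ := Lg.exists_of_finite (P := fun a z => ∃ x c, (fun i => v x (p i)) = z ∧
    x ∈ H ∧ BadAt v (· ∈ H) (c * x) x ∧ v c = a) hfin (hw.mono fun z ⟨x, c, h1, h2, h3, h4, h5⟩ =>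
      ⟨v c, ⟨⟨c, h3, rfl⟩, h5⟩, x, c, h1, h2, h4, rfl⟩)
  refine not_dimGE_discontinuous hv (Y := (· ∈ H)) (by fun_prop) (f := fun x => c * x) (by fun_prop) he
    ((dimGE_iff hv).2 ⟨p, hL.mono fun z ⟨x, c', h1, h2, h3, h4⟩ => ?_⟩)
  obtain rfl := rep_injective hv h4
  exact ⟨x, ⟨h2, by simpa [BadAt] using h3⟩, h1⟩

/-- The indices of the definable subgroups of finite index of `H` are bounded. -/
theorem exists_relIndex_bound (hv : ∀ a γ, OMin.rp S a γ ↔ a = v γ) (H : Subgroup G) [DefSub S H] :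
    ∃ n, ∀ K : Subgroup G, DefSub S K → K ≤ H → K.relIndex H ≠ 0 → K.relIndex H ≤ n := by
  have hvd := DefMap.rep hv
  have hbd := DefMap.badAt hv (S := S) (Y := (· ∈ H)) (by fun_prop)
  obtain ⟨e, he, he'⟩ := exists_dim (S := S) (Y := fun x => x ∈ H) ⟨1, H.one_mem⟩
  have hsmall := not_dimGE_badAt hv he'
  set V : G → Prop := fun x => ¬ DimGE S e fun x₀ => x₀ ∈ H ∧ BadAt v (· ∈ H) x₀ x with hVdef
  have hV : DefMap S V := by
    simp only [hVdef, dimGE_iff hv]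
    exact (DefMap.exFinite fun q => by fun_prop).not
  have hg : ¬ DimGE S e fun x => x ∈ H ∧ ¬ V x := by simpa [hVdef] using hsmall
  have hfibG : ∀ p : Fin e → Fin (ar S G), ¬ Lg e fun w => ¬ FinFam fun a =>
      (∃ γ, (γ ∈ H ∧ V γ) ∧ v γ = a) ∧ (fun i => a (p i)) = w := fun p hp => he' <|
    (DimGE.of_infinite_fiber hv (Q := fun γ => γ ∈ H ∧ V γ) hp).mono fun x hx => hx.1
  obtain ⟨F, hF, hFC⟩ := exists_finite_rep_clopen (S := S) (e := e)
    (Q := fun a => ∃ γ, (γ ∈ H ∧ V γ) ∧ v γ = a) (by fun_prop) hfibG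
  refine ⟨F.ncard, fun K hK hKH hKi => ?_⟩
  have hfinq : Finite (H ⧸ K.subgroupOf H) := @Subgroup.finite_quotient_of_finiteIndex _ _ _ ⟨hKi⟩
  have hcov : ∀ x ∈ H, ∃ q : H ⧸ K.subgroupOf H, ((q.out : H) : G)⁻¹ * x ∈ K := by
    intro x hx
    refine ⟨QuotientGroup.mk (⟨x, hx⟩ : H), ?_⟩
    have := QuotientGroup.eq.1 (QuotientGroup.out_eq' (QuotientGroup.mk (s := K.subgroupOf H) (⟨x, hx⟩ : H)))
    simpa [Subgroup.mem_subgroupOf] using this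
  -- the cosets of `K` have dimension `e`
  have hKe : DimGE S e fun x => x ∈ K := by
    obtain ⟨q, -, hq⟩ := DimGE.exists_of_finite (S := S) (d := e) (Γ := G)
      (F := (Set.univ : Set (H ⧸ K.subgroupOf H)))
      (Y := fun q x => ((q.out : H) : G)⁻¹ * x ∈ K) Set.finite_univ (he.mono fun x hx => by
        obtain ⟨q, hq⟩ := hcov x hx
        exact ⟨q, mem_univ _, hq⟩)
    exact (hq.translate hv (by fun_prop) (((q.out : H) : G)) 1).mono fun x hx => by simpa using hx
  have hKV : ∀ c ∈ H, DimGE S e fun x => c⁻¹ * x ∈ K ∧ V x := by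
    intro c hc
    have h1 := (hKe.translate hv (by fun_prop) c⁻¹ 1)
    have h2 : DimGE S e fun x => (c⁻¹ * x ∈ K ∧ V x) ∨ (c⁻¹ * x ∈ K ∧ ¬ V x) := h1.mono fun x hx => by
      rw [mul_one] at hx
      by_cases h : V x
      · exact Or.inl ⟨hx, h⟩
      · exact Or.inr ⟨hx, h⟩
    refine h2.or.resolve_right fun h3 => hg (h3.mono fun x hx => ⟨?_, hx.2⟩)
    simpa [mul_assoc] using H.mul_mem hc (hKH hx.1)
  -- at almost all points, the coset of `K` is a neighbourhood in `H`
  have hT : ¬ DimGE S e fun x => x ∈ H ∧ ¬ ∃ B, InBox B (v x) ∧ ∀ y ∈ H, InBox B (v y) → x⁻¹ * y ∈ K := by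
    intro h
    obtain ⟨q, -, hq⟩ := DimGE.exists_of_finite (S := S) (d := e) (Γ := G)
      (F := (Set.univ : Set (H ⧸ K.subgroupOf H)))
      (Y := fun q x => ((q.out : H) : G)⁻¹ * x ∈ K ∧ ¬ ∃ B, InBox B (v x) ∧ ∀ y ∈ H, InBox B (v y) →
        ((q.out : H) : G)⁻¹ * y ∈ K) Set.finite_univ (h.mono fun x ⟨hx, hx'⟩ => by
        obtain ⟨q, hq⟩ := hcov x hx
        refine ⟨q, mem_univ _, hq, fun ⟨B, hB, hBK⟩ => hx' ⟨B, hB, fun y hy hyB => ?_⟩⟩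
        simpa [mul_assoc] using K.mul_mem (K.inv_mem hq) (hBK y hy hyB))
    refine not_dimGE_boundary hv (Y := (· ∈ H)) (Z := fun x => ((q.out : H) : G)⁻¹ * x ∈ K) (by fun_prop)
      (by fun_prop) he' hq
  have hnear : ∀ x ∈ H, V x → ∃ B, InBox B (v x) ∧ ∀ y ∈ H, InBox B (v y) → x⁻¹ * y ∈ K := by
    intro x hx hxV
    obtain ⟨x₀, hx₀, hgood, B₀, hB₀, hBK⟩ : ∃ x₀ ∈ H, ¬ BadAt v (· ∈ H) x₀ x ∧
        ∃ B, InBox B (v x₀) ∧ ∀ y ∈ H, InBox B (v y) → x₀⁻¹ * y ∈ K := by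
      by_contra! hcon
      have h1 : DimGE S e fun x₀ => (x₀ ∈ H ∧ BadAt v (· ∈ H) x₀ x) ∨ (x₀ ∈ H ∧ ¬ ∃ B, InBox B (v x₀) ∧
          ∀ y ∈ H, InBox B (v y) → x₀⁻¹ * y ∈ K) := he.mono fun x₀ hx₀ => by
        by_cases h : BadAt v (· ∈ H) x₀ x
        · exact Or.inl ⟨hx₀, h⟩
        · refine Or.inr ⟨hx₀, ?_⟩
          push Not
          exact hcon x₀ hx₀ h
      exact h1.or.elim hxV hT
    rw [BadAt, not_not] at hgood
    obtain ⟨B, hB, hBB⟩ := hgood B₀ hB₀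
    refine ⟨B, hB, fun y hy hyB => ?_⟩
    simpa [mul_assoc] using hBK _ (H.mul_mem (H.mul_mem hx₀ (H.inv_mem hx)) hy) (hBB y hy hyB)
  -- every coset of `K` in `H` meets `F`
  have hmeet : ∀ c : H ⧸ K.subgroupOf H, ∃ a ∈ F, ∃ γ, v γ = a ∧ ((c.out : H) : G)⁻¹ * γ ∈ K := by
    intro c
    have hcH : ((c.out : H) : G) ∈ H := (c.out : H).2
    suffices h : ∃ a ∈ F, ∃ γ, (((c.out : H) : G)⁻¹ * γ ∈ K ∧ V γ) ∧ v γ = a by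
      obtain ⟨a, haF, γ, hγ, hγa⟩ := h
      exact ⟨a, haF, γ, hγa, hγ.1⟩
    refine hFC (fun a => ∃ γ, (((c.out : H) : G)⁻¹ * γ ∈ K ∧ V γ) ∧ v γ = a) (by fun_prop) ?_ ?_ ?_
    · rintro _ ⟨γ, hγ, rfl⟩
      refine ⟨γ, ⟨?_, hγ.2⟩, rfl⟩
      simpa [mul_assoc] using H.mul_mem hcH (hKH hγ.1)
    · rintro _ ⟨x, hx, rfl⟩
      obtain ⟨B, hB, hBK⟩ := hnear x hx.1 hx.2
      refine ⟨B, hB, ?_⟩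
      rintro _ ⟨y, hy, rfl⟩ hyB
      have h3 := hBK y hy.1 hyB
      constructor
      · rintro ⟨y', h4, h5⟩
        obtain rfl := rep_injective hv h5
        refine ⟨x, ⟨?_, hx.2⟩, rfl⟩
        simpa [mul_assoc] using K.mul_mem h4.1 (K.inv_mem h3)
      · rintro ⟨x', h4, h5⟩
        obtain rfl := rep_injective hv h5
        refine ⟨y, ⟨?_, hy.2⟩, rfl⟩
        simpa [mul_assoc] using K.mul_mem h4.1 h3
    · obtain ⟨q, hq⟩ := (dimGE_iff hv).1 (hKV _ hcH)
      exact ⟨q, hq.mono fun w ⟨γ, h1, h2⟩ => ⟨v γ, ⟨γ, h1, rfl⟩, h2⟩⟩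
  choose φ hφF ψ hψ hψK using hmeet
  have hinj : Function.Injective φ := by
    intro c c' h
    have h1 : ψ c = ψ c' := rep_injective hv (by rw [hψ, hψ, h])
    rw [← c.out_eq', ← c'.out_eq']
    refine QuotientGroup.eq.2 (Subgroup.mem_subgroupOf.2 ?_)
    have := K.mul_mem (hψK c) (K.inv_mem (hψK c'))
    rw [h1] at this
    simpa [mul_assoc] using this
  have := hF.to_subtype
  calc K.relIndex H = Nat.card (H ⧸ K.subgroupOf H) := rfl
    _ ≤ Nat.card F := Nat.card_le_card_of_injective (fun c => ⟨φ c, hφF c⟩) fun c c' h =>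
        hinj (congrArg Subtype.val h)
    _ = F.ncard := rfl

end IndexBound

section Chain

variable {N : Type u} [LinearOrder N] [DenselyOrdered N] [NoMinOrder N] [NoMaxOrder N] [Nonempty N]
  {S : Struc N} {G : Type*} [Group G] [Interp S G]

variable (S) in
/-- The minimal condition on definable subgroups. -/
class DCC (G : Type*) [Group G] [Interp S G] : Prop where
  exists_min : ∀ F : Subgroup G → Prop, (∀ K, F K → DefSub S K) → (∃ K, F K) →
    ∃ K, F K ∧ ∀ L, F L → L ≤ K → L = K

theorem exists_cosetDim (H : Subgroup G) : ∃ e, CosetDim S e H ∧ ∀ e', CosetDim S e' H → e' ≤ e := by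
  classical
  refine ⟨Nat.findGreatest (fun e => CosetDim S e H) (ar S G), ?_, fun e' h => Nat.le_findGreatest h.le h⟩
  exact Nat.findGreatest_spec (P := fun e => CosetDim S e H) (Nat.zero_le _) (cosetDim_zero H)

theorem DCC.of_relIndex_bound [DefGrp S G] (hb : ∀ H : Subgroup G, DefSub S H → ∃ n, ∀ K : Subgroup G,
    DefSub S K → K ≤ H → K.relIndex H ≠ 0 → K.relIndex H ≤ n) : DCC S G := by
  refine ⟨fun F hF ⟨K₀, hK₀⟩ => ?_⟩
  classical
  have h1 : ∃ e, ∃ H, F H ∧ CosetDim S e H ∧ ∀ e', CosetDim S e' H → e' ≤ e := by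
    obtain ⟨e, he⟩ := exists_cosetDim (S := S) K₀
    exact ⟨e, K₀, hK₀, he⟩
  obtain ⟨H, hH, he, he'⟩ := Nat.find_spec h1
  have hfin : ∀ K, F K → K ≤ H → K.relIndex H ≠ 0 := by
    intro K hK hKH h0
    have := hF K hK
    have := hF H hH
    obtain ⟨e, h2, h3⟩ := exists_cosetDim (S := S) K
    have h4 := Nat.find_min' h1 ⟨K, hK, h2, h3⟩
    have h5 := he' _ (h2.succ hKH h0)
    omega
  obtain ⟨n, hn⟩ := hb H (hF H hH)
  have h2 : ∃ i, ∃ K, F K ∧ K ≤ H ∧ K.relIndex H = n - i :=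
    ⟨n - H.relIndex H, H, hH, le_rfl, by have := hn H (hF H hH) le_rfl (hfin H hH le_rfl); omega⟩
  obtain ⟨K, hK, hKH, hi⟩ := Nat.find_spec h2
  refine ⟨K, hK, fun L hL hLK => le_antisymm hLK ?_⟩
  have hLH := hLK.trans hKH
  have h3 := Nat.find_min' h2 ⟨L, hL, hLH, (by have := hn L (hF L hL) hLH (hfin L hL hLH); omega :
    L.relIndex H = n - (n - L.relIndex H))⟩
  have h4 := Subgroup.relIndex_mul_relIndex L K H hLK hKH
  have h5 := hn L (hF L hL) hLH (hfin L hL hLH)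
  have h6 := hfin L hL hLH
  have h7 := hfin K hK hKH
  rw [← Subgroup.relIndex_eq_one]
  have h8 : L.relIndex H ≤ K.relIndex H := by omega
  rw [← h4] at h8 h6
  have h9 : L.relIndex K ≠ 0 := fun h => h6 (by rw [h, zero_mul])
  have : L.relIndex K ≤ 1 := Nat.le_of_mul_le_mul_right (by rwa [one_mul]) (Nat.pos_of_ne_zero h7)
  omega

end Chain

section Elt

variable {N : Type u} [LinearOrder N] [DenselyOrdered N] [NoMinOrder N] [NoMaxOrder N] [Nonempty N]
  [TopologicalSpace N] {S : Struc N} {m : ℕ} (U : DefGroup S m)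

instance instInterpElt : Interp S U.Elt :=
  Interp.sub (fun x => x ∈ U.carrier) (defP_tuple.2 U.carrier_def)

instance : DefGrp S U.Elt := by
  have h1 : DefMap S fun p : U.Elt × U.Elt => p.1 * p.2 := DefMap.of_graph <|
    def_congr U.mul_graph_def fun z => by
      constructor
      · rintro ⟨⟨⟨a, b⟩, c⟩, ⟨⟨h1, h2⟩, h3⟩, h4⟩
        have h1 : z ∘ Fin.castAdd m ∘ Fin.castAdd m = a.1 := h1
        have h2 : z ∘ Fin.castAdd m ∘ Fin.natAdd m = b.1 := h2
        have h3 : z ∘ Fin.natAdd (m + m) = c.1 := h3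
        refine ⟨by rw [h1]; exact a.2, by rw [h2]; exact b.2, ?_⟩
        rw [h1, h2, h3]
        exact congrArg Subtype.val h4
      · rintro ⟨h1, h2, h3⟩
        exact ⟨((⟨_, h1⟩, ⟨_, h2⟩), ⟨z ∘ Fin.natAdd (m + m), h3 ▸ U.mul_mem h1 h2⟩), ⟨⟨rfl, rfl⟩, rfl⟩,
          Subtype.ext h3⟩
  refine ⟨h1, DefMap.of_graph <| defP_iff.2 ?_⟩
  have h2 : DefMap S fun p : U.Elt × U.Elt => p.1 * p.2 = 1 := h1.eq (DefMap.const 1)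
  exact h2.congrP fun p => by rw [inv_eq_iff_mul_eq_one]

instance : DCC S U.Elt :=
  DCC.of_relIndex_bound fun H _ => exists_relIndex_bound (v := fun x : U.Elt => x.1) (fun _ _ => Iff.rfl) H

end Elt

open scoped commutatorElement

section Width

variable {N : Type u} [LinearOrder N] [DenselyOrdered N] [NoMinOrder N] [NoMaxOrder N] [Nonempty N]
  {S : Struc N}

variable (S) in
/-- The operations of the additive group `V` are definable. -/
class DefAddGrp (V : Type*) [AddCommGroup V] [Interp S V] : Prop where
  add_def : DefMap S fun p : V × V => p.1 + p.2
  neg_def : DefMap S fun x : V => -x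

variable {V : Type*} [AddCommGroup V] [Interp S V] [DefAddGrp S V]

@[fun_prop]
theorem DefMap.add {Γ : Type*} [Interp S Γ] {f g : Γ → V} (hf : DefMap S f) (hg : DefMap S g) :
    DefMap S fun x => f x + g x :=
  DefMap.comp (DefAddGrp.add_def (S := S) (V := V)) (hf.prodMk hg)

@[fun_prop]
theorem DefMap.neg {Γ : Type*} [Interp S Γ] {f : Γ → V} (hf : DefMap S f) :
    DefMap S fun x => -(f x) :=
  DefMap.comp (DefAddGrp.neg_def (S := S) (V := V)) hf

@[fun_prop]
theorem DefMap.sub {Γ : Type*} [Interp S Γ] {f g : Γ → V} (hf : DefMap S f) (hg : DefMap S g) :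
    DefMap S fun x => f x - g x := by
  simp only [sub_eq_add_neg]; fun_prop

variable {ι : Type*}

/-- The sums of elements of the sets indexed by a list. -/
def SumSet (B : ι → V → Prop) : List ι → V → Prop
  | [], v => v = 0
  | i :: l, v => ∃ b s, B i b ∧ SumSet B l s ∧ v = b + s

/-- The sum of the sets indexed by the list is direct. -/
def Indep (B : ι → V → Prop) : List ι → Prop
  | [] => True
  | i :: l => Indep B l ∧ ∀ b b' s s', B i b → B i b' → SumSet B l s → SumSet B l s' →
      b + s = b' + s' → b = b'

theorem DefMap.sumSet {B : ι → V → Prop} {l : List ι} (hB : ∀ i ∈ l, DefMap S (B i)) :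
    DefMap S (SumSet B l) := by
  induction l with
  | nil => simp only [SumSet]; fun_prop
  | cons i l ih =>
    have h1 := ih fun j hj => hB j (List.mem_cons_of_mem _ hj)
    have h2 := hB i List.mem_cons_self
    simp only [SumSet]
    fun_prop

theorem dimGE_sumSet {B : ι → V → Prop} {l : List ι} (hB : ∀ i ∈ l, DefMap S (B i))
    (hinf : ∀ i ∈ l, {b | B i b}.Infinite) (hl : Indep B l) (u : V) :
    DimGE S l.length fun v => SumSet B l (v - u) := by
  induction l generalizing u with
  | nil => exact DimGE.of_nonempty ⟨u, by simp [SumSet]⟩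
  | cons i l ih =>
    have h1 := DefMap.sumSet (S := S) fun j hj => hB j (List.mem_cons_of_mem _ hj)
    refine (DimGE.iUnion (S := S) (I := V) (C := fun b v => SumSet B l (v - (u + b))) (Q := B i)
      (by fun_prop) (hB i List.mem_cons_self) (hinf i List.mem_cons_self)
      (fun b _ => ih (fun j hj => hB j (List.mem_cons_of_mem _ hj))
        (fun j hj => hinf j (List.mem_cons_of_mem _ hj)) hl.1 (u + b)) ?_).mono ?_
    · exact fun b b' v hb hb' h h' => hl.2 b b' _ _ hb hb' h h' (by abel)
    · rintro v ⟨b, hb, h⟩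
      exact ⟨b, _, hb, h, by abel⟩

/-- There is a maximal independent list. -/
theorem exists_maximal_indep (S : Struc N) [Interp S V] [DefAddGrp S V] (B : ι → V → Prop) (P : ι → Prop)
    (hB : ∀ i, P i → DefMap S (B i)) (hinf : ∀ i, P i → {b | B i b}.Infinite) :
    ∃ l : List ι, (∀ i ∈ l, P i) ∧ Indep B l ∧ ∀ i, P i → ∃ b b' s s', B i b ∧ B i b' ∧ SumSet B l s ∧
      SumSet B l s' ∧ b + s = b' + s' ∧ b ≠ b' := by
  classical
  set Q : ℕ → Prop := fun n => ∃ l : List ι, l.length = n ∧ (∀ i ∈ l, P i) ∧ Indep B l with hQ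
  obtain ⟨l, hl, hP, hI⟩ := Nat.findGreatest_spec (P := Q) (Nat.zero_le (ar S V)) ⟨[], rfl, by simp, trivial⟩
  refine ⟨l, hP, hI, fun i hi => ?_⟩
  by_contra! hcon
  have hP' : ∀ j ∈ i :: l, P j := by simpa using ⟨hi, hP⟩
  have hI' : Indep B (i :: l) := ⟨hI, hcon⟩
  have h1 := (dimGE_sumSet (S := S) (fun j hj => hB j (hP' j hj)) (fun j hj => hinf j (hP' j hj)) hI' 0).le
  have h2 := Nat.le_findGreatest (P := Q) h1 ⟨i :: l, rfl, hP', hI'⟩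
  rw [← hl] at h2
  simp at h2

end Width

section MinCond

theorem sInf_of_minimal {α : Type*} [CompleteLattice α] {D : α → Prop} (hinf : ∀ a b, D a → D b → D (a ⊓ b))
    (htop : D ⊤) (hmin : ∀ F : α → Prop, (∀ K, F K → D K) → (∃ K, F K) → ∃ K, F K ∧ ∀ L, F L → L ≤ K → L = K)
    {s : Set α} (hs : ∀ K ∈ s, D K) : D (sInf s) := by
  obtain ⟨K, ⟨hK, hK'⟩, hKm⟩ := hmin (fun K => D K ∧ sInf s ≤ K) (fun K h => h.1) ⟨⊤, htop, le_top⟩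
  have : K = sInf s := le_antisymm (le_sInf fun L hL => ?_) hK'
  · rwa [← this]
  · rw [← hKm (K ⊓ L) ⟨hinf _ _ hK (hs L hL), le_inf hK' (sInf_le hL)⟩ inf_le_left]
    exact inf_le_right

end MinCond

section AddDCC

variable {N : Type u} [LinearOrder N] [DenselyOrdered N] [NoMinOrder N] [NoMaxOrder N] [Nonempty N]
  {S : Struc N}

variable (S) in
/-- The minimal condition on definable additive subgroups. -/
class AddDCC (V : Type*) [AddCommGroup V] [Interp S V] : Prop where
  exists_min : ∀ F : AddSubgroup V → Prop, (∀ K, F K → DefMap S (· ∈ K)) → (∃ K, F K) →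
    ∃ K, F K ∧ ∀ L, F L → L ≤ K → L = K

theorem AddDCC.sInf {V : Type*} [AddCommGroup V] [Interp S V] [AddDCC S V] {s : Set (AddSubgroup V)}
    (hs : ∀ K ∈ s, DefMap S (· ∈ K)) : DefMap S (· ∈ sInf s) :=
  sInf_of_minimal (D := fun K : AddSubgroup V => DefMap S (· ∈ K))
    (fun _ _ h h' => (h.and h').congrP fun x => AddSubgroup.mem_inf)
    ((DefMap.const True).congrP fun x => by simp) AddDCC.exists_min hs

theorem DCC.sInf {G : Type*} [Group G] [Interp S G] [DCC S G] {s : Set (Subgroup G)}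
    (hs : ∀ K ∈ s, DefSub S K) : DefSub S (sInf s) :=
  sInf_of_minimal (D := fun K : Subgroup G => DefSub S K)
    (fun _ _ _ _ => inferInstance) inferInstance DCC.exists_min hs

theorem DefMap.forall_addDCC {V ι : Type*} [AddCommGroup V] [Interp S V] [AddDCC S V] {K : ι → AddSubgroup V}
    (hK : ∀ i, DefMap S (· ∈ K i)) : DefMap S fun v => ∀ i, v ∈ K i :=
  (AddDCC.sInf (S := S) (s := Set.range K) (by rintro _ ⟨i, rfl⟩; exact hK i)).congrP fun x => by
    simp [AddSubgroup.mem_sInf]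

end AddDCC

section Closure

variable {N : Type u} [LinearOrder N] [DenselyOrdered N] [NoMinOrder N] [NoMaxOrder N] [Nonempty N]
  {S : Struc N} {G : Type*} [Group G] [Interp S G] [DefGrp S G]

variable (S) in
/-- The smallest definable subgroup containing a set. -/
def dcl (X : Set G) : Subgroup G := sInf {K | DefSub S K ∧ X ⊆ K}

instance [DCC S G] (X : Set G) : DefSub S (dcl S X) := DCC.sInf fun _ hK => hK.1

theorem subset_dcl (X : Set G) : X ⊆ dcl S X := fun _ hx => by
  simp only [dcl, SetLike.mem_coe, Subgroup.mem_sInf]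
  exact fun K hK => hK.2 hx

theorem dcl_le {X : Set G} {K : Subgroup G} [hK : DefSub S K] (h : X ⊆ K) : dcl S X ≤ K := sInf_le ⟨hK, h⟩

theorem DefSub.comap_conj (K : Subgroup G) [DefSub S K] (g : G) :
    DefSub S (K.comap (MulAut.conj g).toMonoidHom) :=
  ⟨by simp only [Subgroup.mem_comap, MulEquiv.coe_toMonoidHom, MulAut.conj_apply]; fun_prop⟩

theorem dcl_normal [DCC S G] (X : Subgroup G) [X.Normal] : (dcl S (X : Set G)).Normal := by
  refine ⟨fun x hx g => ?_⟩
  have := DefSub.comap_conj (S := S) (dcl S (X : Set G)) g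
  have h : dcl S (X : Set G) ≤ (dcl S (X : Set G)).comap (MulAut.conj g).toMonoidHom := dcl_le fun y hy =>
    subset_dcl (S := S) (X : Set G) (Subgroup.Normal.conj_mem inferInstance y hy g)
  exact h hx

/-- The subgroup `{a | ∀ g ∈ X, [g, a] ∈ M}` for normal `M`. -/
def centMod (M : Subgroup G) [M.Normal] (X : Set G) : Subgroup G where
  carrier := {a | ∀ g ∈ X, ⁅g, a⁆ ∈ M}
  one_mem' g _ := by simp
  mul_mem' {a b} ha hb g hg := by
    have h : ⁅g, a * b⁆ = ⁅g, a⁆ * (a * ⁅g, b⁆ * a⁻¹) := by simp only [commutatorElement_def]; group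
    rw [h]
    exact M.mul_mem (ha g hg) (Subgroup.Normal.conj_mem inferInstance _ (hb g hg) a)
  inv_mem' {a} ha g hg := by
    have h : ⁅g, a⁻¹⁆ = a⁻¹ * ⁅g, a⁆⁻¹ * a⁻¹⁻¹ := by simp only [commutatorElement_def]; group
    rw [h]
    exact Subgroup.Normal.conj_mem inferInstance _ (M.inv_mem (ha g hg)) a⁻¹

theorem mem_centMod {M : Subgroup G} [M.Normal] {X : Set G} {a : G} :
    a ∈ centMod M X ↔ ∀ g ∈ X, ⁅g, a⁆ ∈ M := Iff.rfl

instance [DCC S G] (M : Subgroup G) [M.Normal] [DefSub S M] (X : Set G) : DefSub S (centMod M X) := by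
  have h : centMod M X = sInf ((fun g => centMod M {g}) '' X) := by
    ext a
    simp [mem_centMod, Subgroup.mem_sInf]
  rw [h]
  refine DCC.sInf ?_
  rintro _ ⟨g, -, rfl⟩
  exact ⟨by simp only [mem_centMod, Set.mem_singleton_iff, forall_eq, commutatorElement_def]; fun_prop⟩

theorem commutatorElement_mem_symm {M : Subgroup G} {a b : G} (h : ⁅a, b⁆ ∈ M) : ⁅b, a⁆ ∈ M := by
  rw [← commutatorElement_inv]; exact M.inv_mem h

/-- Commutators modulo a definable normal subgroup only depend on the definable hulls. -/
theorem commutator_dcl_le [DCC S G] {X Y : Set G} {M : Subgroup G} [M.Normal] [DefSub S M]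
    (h : ∀ x ∈ X, ∀ y ∈ Y, ⁅x, y⁆ ∈ M) : ⁅dcl S X, dcl S Y⁆ ≤ M := by
  rw [Subgroup.commutator_le]
  have h1 : dcl S Y ≤ centMod M X := dcl_le fun y hy x hx => h x hx y hy
  have h2 : dcl S X ≤ centMod M (dcl S Y : Set G) := dcl_le fun x hx y hy =>
    commutatorElement_mem_symm (h1 hy x hx)
  exact fun x hx y hy => commutatorElement_mem_symm (h2 hx y hy)

variable (S) in
/-- The subgroup `L` has no proper definable subgroup of finite index. -/
def DConn (L : Subgroup G) : Prop := ∀ K : Subgroup G, DefSub S K → K ≤ L → K.relIndex L ≠ 0 → K = L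

theorem relIndex_ne_zero_of_finite {T : Type*} {K L : Subgroup G} (φ : G → T)
    (hfin : (φ '' L).Finite) (hφ : ∀ x ∈ L, ∀ y ∈ L, φ x = φ y → x⁻¹ * y ∈ K) : K.relIndex L ≠ 0 := by
  have := hfin.to_subtype
  have : Finite (L ⧸ K.subgroupOf L) := by
    refine Finite.of_injective (β := φ '' L) (fun q => ⟨φ q.out, _, q.out.2, rfl⟩) fun q q' hq => ?_
    have := hφ _ q.out.2 _ q'.out.2 (congrArg Subtype.val hq)
    rw [← q.out_eq', ← q'.out_eq']
    refine QuotientGroup.eq.2 ?_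
    rw [Subgroup.mem_subgroupOf]
    simpa using this
  exact Subgroup.index_ne_zero_of_finite (H := K.subgroupOf L)

theorem DConn.eq_of_finite {T : Type*} {L : Subgroup G} (hL : DConn S L) {K : Subgroup G} [hK : DefSub S K]
    (hKL : K ≤ L) (φ : G → T) (hfin : (φ '' L).Finite)
    (hφ : ∀ x ∈ L, ∀ y ∈ L, φ x = φ y → x⁻¹ * y ∈ K) : K = L :=
  hL K hK hKL (relIndex_ne_zero_of_finite φ hfin hφ)

theorem finite_of_relIndex_ne_zero {K L : Subgroup G} (h : K.relIndex L ≠ 0) :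
    ((fun x : G => (x : G ⧸ K)) '' L).Finite := by
  have : Finite (L ⧸ K.subgroupOf L) := @Subgroup.finite_quotient_of_finiteIndex _ _ _ ⟨h⟩
  refine (Set.finite_range fun q : L ⧸ K.subgroupOf L => ((q.out : G) : G ⧸ K)).subset ?_
  rintro _ ⟨x, hx, rfl⟩
  refine ⟨QuotientGroup.mk ⟨x, hx⟩, ?_⟩
  have := QuotientGroup.eq.1 (QuotientGroup.out_eq' (QuotientGroup.mk (s := K.subgroupOf L) ⟨x, hx⟩))
  exact QuotientGroup.eq.2 (by simpa [Subgroup.mem_subgroupOf] using this)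

/-- The connected component. -/
theorem exists_component [DCC S G] (L : Subgroup G) [hL : DefSub S L] : ∃ K, DefSub S K ∧ K ≤ L ∧ K.relIndex L ≠ 0 ∧
    DConn S K ∧ ∀ K', DefSub S K' → K' ≤ L → K'.relIndex L ≠ 0 → K ≤ K' := by
  obtain ⟨K, ⟨h1, h2, h3⟩, h4⟩ := DCC.exists_min (S := S) (G := G) (fun K => DefSub S K ∧ K ≤ L ∧ K.relIndex L ≠ 0)
    (fun K h => h.1) ⟨L, hL, le_rfl, by simp⟩
  refine ⟨K, h1, h2, h3, fun K' h h' h'' => h4 K' ⟨h, h'.trans h2, ?_⟩ h', fun K' h h' h'' => ?_⟩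
  · exact Subgroup.relIndex_ne_zero_trans h'' h3
  · rw [← h4 (K ⊓ K') ⟨inferInstance, inf_le_left.trans h2, Subgroup.relIndex_inf_ne_zero h3 h''⟩ inf_le_left]
    exact inf_le_right

theorem relIndex_comap_conj (K L : Subgroup G) [hL : L.Normal] (g : G) :
    (K.comap (MulAut.conj g).toMonoidHom).relIndex L = K.relIndex L := by
  have h : L.map (MulAut.conj g).toMonoidHom = L := by
    ext x
    simp only [Subgroup.mem_map, MulEquiv.coe_toMonoidHom, MulAut.conj_apply]
    constructor
    · rintro ⟨y, hy, rfl⟩; exact hL.conj_mem y hy g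
    · exact fun hx => ⟨g⁻¹ * x * g, by simpa using hL.conj_mem x hx g⁻¹, by group⟩
  rw [Subgroup.relIndex_comap, h]

theorem DConn.commutator_le [DCC S G] {L M : Subgroup G} [hLd : DefSub S L] (hL : DConn S L) [DefSub S M] [M.Normal]
    {X : Set G} (h : ∀ x ∈ X, ((fun y : G => ((⁅x, y⁆ : G) : G ⧸ M)) '' L).Finite) :
    ∀ x ∈ X, ∀ y ∈ L, ⁅x, y⁆ ∈ M := by
  intro x hx
  have h1 : centMod M {x} ⊓ L = L := by
    refine hL.eq_of_finite inf_le_right (fun y : G => ((⁅x, y⁆ : G) : G ⧸ M)) (h x hx) fun y hy z hz hyz => ?_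
    refine ⟨fun g hg => ?_, L.mul_mem (L.inv_mem hy) hz⟩
    obtain rfl : g = x := hg
    have h2 := QuotientGroup.eq.1 hyz
    have h3 : ⁅g, y⁻¹ * z⁆ = y⁻¹ * (⁅g, y⁆⁻¹ * ⁅g, z⁆) * y⁻¹⁻¹ := by
      simp only [commutatorElement_def]; group
    rw [h3]
    exact Subgroup.Normal.conj_mem inferInstance _ h2 _
  intro y hy
  rw [← h1] at hy
  exact hy.1 x rfl

/-- The definable hull of the derived subgroup of a connected normal subgroup is connected. -/
theorem DConn.dcl_commutator [DCC S G] {L : Subgroup G} [L.Normal] [DefSub S L] (hL : DConn S L) :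
    DConn S (dcl S ((⁅L, L⁆ : Subgroup G) : Set G)) := by
  set D := dcl S ((⁅L, L⁆ : Subgroup G) : Set G) with hD
  have hDn : D.Normal := dcl_normal _
  have hDL : D ≤ L := dcl_le (Subgroup.commutator_le_left L L)
  obtain ⟨K, h1, h2, h3, h4, h5⟩ := exists_component (S := S) D
  have hKn : K.Normal := by
    refine ⟨fun x hx g => ?_⟩
    refine h5 (K.comap (MulAut.conj g).toMonoidHom) (DefSub.comap_conj K g) ?_ ?_ hx
    · intro y hy
      simpa [mul_assoc] using hDn.conj_mem _ (h2 hy) g⁻¹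
    · rwa [relIndex_comap_conj]
  have h6 : ∀ x ∈ (L : Set G), ∀ y ∈ L, ⁅x, y⁆ ∈ K := hL.commutator_le fun x hx =>
    (finite_of_relIndex_ne_zero h3).subset <| by
      rintro _ ⟨y, hy, rfl⟩
      exact ⟨_, subset_dcl (S := S) _ (Subgroup.commutator_mem_commutator hx hy), rfl⟩
  have h7 : D ≤ K := dcl_le (Subgroup.commutator_le.2 h6)
  rwa [le_antisymm h7 h2]

end Closure

section FieldAut

variable {N : Type u} [LinearOrder N] [DenselyOrdered N] [NoMinOrder N] [NoMaxOrder N] [Nonempty N]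
  {S : Struc N}

/-- A connected group acts trivially on finite sets. -/
theorem DConn.fixed {G : Type*} [Group G] [Interp S G] [DefGrp S G] {L : Subgroup G} [DefSub S L] (hL : DConn S L)
    {T : Type*} [Interp S T] {φ : G → T → T} (hφ : DefMap S fun p : G × T => φ p.1 p.2)
    (h1 : ∀ x, φ 1 x = x) (hm : ∀ g h x, φ (g * h) x = φ g (φ h x)) {x : T}
    (hfin : ((fun g => φ g x) '' L).Finite) : ∀ g ∈ L, φ g x = x := by
  have hi : ∀ g y, φ g y = x → φ g⁻¹ x = y := fun g y h => by rw [← h, ← hm, inv_mul_cancel, h1]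
  let K : Subgroup G :=
    { carrier := {g | g ∈ L ∧ φ g x = x}
      one_mem' := ⟨L.one_mem, h1 x⟩
      mul_mem' := fun {a b} ha hb => ⟨L.mul_mem ha.1 hb.1, by rw [hm, hb.2, ha.2]⟩
      inv_mem' := fun {a} ha => ⟨L.inv_mem ha.1, hi _ _ ha.2⟩ }
  have hK : ∀ g, g ∈ K ↔ g ∈ L ∧ φ g x = x := fun g => Iff.rfl
  have hd : DefSub S K := ⟨by
    have h2 : DefMap S fun g : G => φ g x = x :=
      (hφ.comp (g := fun g : G => (g, x)) (by fun_prop)).eq (DefMap.const x)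
    simp only [hK]; fun_prop⟩
  have h : K = L := hL.eq_of_finite (fun g hg => hg.1) (fun g => φ g x) hfin fun a ha b hb hab =>
    ⟨L.mul_mem (L.inv_mem ha) hb, by
      have hab : φ a x = φ b x := hab
      rw [hm, ← hab, ← hm, inv_mul_cancel, h1]⟩
  intro g hg
  rw [← h] at hg
  exact hg.2

variable (S) in
/-- The operations of the field `K` are definable. -/
class DefField (K : Type*) [Field K] [Interp S K] : Prop extends DefAddGrp S K where
  mul_def : DefMap S fun p : K × K => p.1 * p.2

variable {K : Type*} [Field K] [Interp S K] [DefField S K]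

@[fun_prop]
theorem DefMap.fieldMul {Γ : Type*} [Interp S Γ] {f g : Γ → K} (hf : DefMap S f) (hg : DefMap S g) :
    DefMap S fun x => f x * g x :=
  DefMap.comp (DefField.mul_def (S := S) (K := K)) (hf.prodMk hg)

theorem DefMap.fieldPow {Γ : Type*} [Interp S Γ] {f : Γ → K} (hf : DefMap S f) (n : ℕ) :
    DefMap S fun x => f x ^ n := by
  induction n with
  | zero => simp only [pow_zero]; fun_prop
  | succ n ih => simp only [pow_succ]; fun_prop

/-- An infinite definable field has no proper definable additive subgroup of finite index. -/
theorem addSubgroup_eq_top [AddDCC S K] [Infinite K] {A : AddSubgroup K} (hA : DefMap S (· ∈ A)) (hi : A.index ≠ 0) :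
    A = ⊤ := by
  obtain ⟨B, ⟨h1, h2⟩, h3⟩ := AddDCC.exists_min (S := S) (V := K) (fun A => DefMap S (· ∈ A) ∧ A.index ≠ 0)
    (fun K h => h.1) ⟨A, hA, hi⟩
  have hle : ∀ A' : AddSubgroup K, DefMap S (· ∈ A') → A'.index ≠ 0 → B ≤ A' := fun A' h h' => by
    rw [← h3 (B ⊓ A') ⟨(h1.and h).congrP fun x => AddSubgroup.mem_inf, AddSubgroup.index_inf_ne_zero h2 h'⟩
      inf_le_left]
    exact inf_le_right
  have hmul : ∀ c, ∀ b ∈ B, c * b ∈ B := by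
    intro c b hb
    rcases eq_or_ne c 0 with rfl | hc
    · rw [zero_mul]; exact B.zero_mem
    · refine hle (B.comap (AddMonoidHom.mulLeft c)) ?_ ?_ hb
      · simp only [AddSubgroup.mem_comap, AddMonoidHom.coe_mulLeft]; fun_prop
      · rwa [AddSubgroup.index_comap_of_surjective]
        exact fun y => ⟨c⁻¹ * y, by simp [hc]⟩
  have hB : B ≠ ⊥ := by
    rintro rfl
    rw [AddSubgroup.index_bot, Nat.card_eq_zero_of_infinite] at h2
    exact h2 rfl
  obtain ⟨b, hb, hb0⟩ := B.bot_or_exists_ne_zero.resolve_left hB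
  rw [eq_top_iff]
  refine le_trans (fun x _ => ?_) (hle A hA hi)
  have := hmul (x * b⁻¹) _ hb
  rwa [mul_assoc, inv_mul_cancel₀ hb0, mul_one] at this

variable {G : Type*} [Group G] [Interp S G] [DefGrp S G]

theorem infinite_fixed [AddDCC S K] [Infinite K] (hG : DConn S (⊤ : Subgroup G)) {σ : G →* (K →+* K)}
    (hσ : DefMap S fun p : G × K => σ p.1 p.2) : {x : K | ∀ g, σ g x = x}.Infinite := by
  obtain ⟨p, hp⟩ := CharP.exists K
  rcases CharP.char_is_prime_or_zero K p with hpp | rfl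
  · have : Fact p.Prime := ⟨hpp⟩
    let P : K →+ K := (frobenius K p : K →+ K) - AddMonoidHom.id K
    have hP : ∀ x, P x = x ^ p - x := fun x => rfl
    have hPd : DefMap S P := by
      have := DefMap.fieldPow (S := S) (f := fun x : K => x) (by fun_prop) p
      have : DefMap S fun x : K => x ^ p - x := by fun_prop
      exact this
    have hker : {x | P x = 0}.Finite := by
      have h0 : (Polynomial.X ^ p - Polynomial.X : Polynomial K) ≠ 0 := FiniteField.X_pow_card_sub_X_ne_zero K hpp.one_lt
      refine (Polynomial.finite_setOfPred_isRoot h0).subset fun x hx => ?_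
      simpa [hP] using hx
    have hfib : ∀ y, {x | P x = y}.Finite := by
      intro y
      by_cases h : ∃ x₀, P x₀ = y
      · obtain ⟨x₀, rfl⟩ := h
        refine (hker.image (x₀ + ·)).subset fun x hx => ⟨x - x₀, ?_, by simp⟩
        rw [Set.mem_ofPred_eq] at hx
        simp [hx]
      · refine Set.finite_empty.subset fun x hx => h ⟨x, hx⟩
    have hsurj : Function.Surjective P := by
      let Q : ℕ → AddSubgroup K := fun n => n.rec ⊤ fun _ A => A.map P
      have hQs : ∀ n, Q (n + 1) = (Q n).map P := fun n => rfl
      have hQd : ∀ n, DefMap S (· ∈ Q n) := fun n => by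
        induction n with
        | zero => exact (DefMap.const True).congrP fun x => by simp [Q]
        | succ n ih =>
          rw [hQs]
          simp only [AddSubgroup.mem_map]
          fun_prop
      have hQa : ∀ n, Q (n + 1) ≤ Q n := fun n => by
        induction n with
        | zero => exact le_top
        | succ n ih => exact AddSubgroup.map_mono ih
      obtain ⟨_, ⟨n, rfl⟩, hn⟩ := AddDCC.exists_min (S := S) (V := K) (fun A => ∃ n, Q n = A)
        (by rintro _ ⟨n, rfl⟩; exact hQd n) ⟨_, 0, rfl⟩
      have hind : ∀ m, m ≤ n → (Q (n - m + 1)).relIndex (Q (n - m)) ≠ 0 := by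
        intro m
        induction m with
        | zero => intro _; rw [Nat.sub_zero, hn _ ⟨n + 1, rfl⟩ (hQa n)]; simp
        | succ m ih =>
          intro hm
          have h1 := ih (by omega)
          rw [show n - m = n - (m + 1) + 1 by omega] at h1
          generalize n - (m + 1) = j at *
          have h3 := h1
          rw [hQs (j + 1), hQs j] at h3
          have h4 := AddSubgroup.relIndex_comap (f := P) (H := (Q (j + 1)).map P) (K := Q j)
          rw [← h4, AddSubgroup.comap_map_eq] at h3
          have h5 : (Q (j + 1)).relIndex (Q (j + 1) ⊔ P.ker) ≠ 0 := by
            rw [sup_comm, AddSubgroup.relIndex_sup_right]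
            have : Finite P.ker := hker
            exact AddSubgroup.index_ne_zero_of_finite (H := (Q (j + 1)).addSubgroupOf P.ker)
          exact AddSubgroup.relIndex_ne_zero_trans h5 h3
      have h0 := hind n le_rfl
      rw [Nat.sub_self, hQs] at h0
      have h1 : (Q 0) = ⊤ := rfl
      rw [h1, AddSubgroup.relIndex_top_right] at h0
      have h2 := addSubgroup_eq_top (S := S) (A := AddSubgroup.map P ⊤) (h1 ▸ hQs 0 ▸ hQd 1) h0
      intro y
      have : y ∈ AddSubgroup.map P ⊤ := by rw [h2]; exact AddSubgroup.mem_top y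
      obtain ⟨x, -, hx⟩ := this
      exact ⟨x, hx⟩
    intro hfin
    have hpre : ∀ x, (∀ g, σ g (P x) = P x) → ∀ g, σ g x = x := by
      intro x hx g
      refine hG.fixed (φ := fun g x => σ g x) hσ (by simp) (by simp) ((hfib (P x)).subset ?_) g trivial
      rintro _ ⟨h, -, rfl⟩
      have := hx h
      simp only [hP, map_sub, map_pow] at this ⊢
      exact this
    have := hfin.to_subtype
    choose r hr using hsurj
    let r' : {x : K | ∀ g, σ g x = x} → {x : K | ∀ g, σ g x = x} := fun x => ⟨r x, hpre _ (by rw [hr]; exact x.2)⟩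
    have hr' : Function.Injective r' := fun a b hab => Subtype.ext (by
      rw [← hr a.1, ← hr b.1, show r a.1 = r b.1 from congrArg Subtype.val hab])
    have hs := Finite.surjective_of_injective hr'
    obtain ⟨a, ha⟩ := hs ⟨0, by simp⟩
    obtain ⟨b, hb⟩ := hs ⟨1, by simp⟩
    have ha : r a = 0 := congrArg Subtype.val ha
    have hb : r b = 1 := congrArg Subtype.val hb
    have h1 : a.1 = 0 := by rw [← hr a.1, ha]; simp
    have h2 : b.1 = 0 := by rw [← hr b.1, hb, hP]; simp
    rw [h1] at ha
    rw [h2, ha] at hb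
    exact zero_ne_one hb
  · have := CharP.charP_to_charZero K
    exact (Set.infinite_range_of_injective (Nat.cast_injective (R := K))).mono (by rintro _ ⟨n, rfl⟩ g; simp)

/-- A connected definable group of automorphisms of a definable field is trivial. -/
theorem field_aut_trivial [AddDCC S K] (hG : DConn S (⊤ : Subgroup G)) {σ : G →* (K →+* K)}
    (hσ : DefMap S fun p : G × K => σ p.1 p.2) (g : G) (x : K) : σ g x = x := by
  rcases finite_or_infinite K with hK | hK
  · exact hG.fixed (φ := fun g x => σ g x) hσ (by simp) (by simp) (Set.toFinite _) g trivial
  rcases eq_or_ne x 0 with rfl | hx0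
  · simp
  have hinf := infinite_fixed hG hσ
  have hkd : DefMap S fun x : K => ∀ g, σ g x = x := by
    have : DefMap S fun p : K × G => σ p.2 p.1 = p.1 :=
      (hσ.comp (g := fun p : K × G => (p.2, p.1)) (by fun_prop)).eq (by fun_prop)
    exact this.all
  obtain ⟨l, -, -, hl⟩ := exists_maximal_indep S (V := K) (fun (i : ℕ) y => ∃ c, (∀ g, σ g c = c) ∧ c * x ^ i = y)
    (fun _ => True) (fun i _ => by fun_prop) (fun i _ => by
      refine (hinf.image (f := fun c => c * x ^ i) fun a _ b _ h => ?_).mono ?_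
      · simpa [hx0] using h
      · rintro _ ⟨c, hc, rfl⟩; exact ⟨c, hc, rfl⟩)
  obtain ⟨M, hM⟩ : ∃ M, ∀ i ∈ l, i < M := ⟨l.sum + 1, fun i hi => Nat.lt_succ_of_le (List.le_sum_of_mem hi)⟩
  have hpoly : ∀ l' : List ℕ, (∀ i ∈ l', i < M) → ∀ s, SumSet (fun (i : ℕ) y => ∃ c, (∀ g, σ g c = c) ∧ c * x ^ i = y) l' s →
      ∃ q : Polynomial K, (∀ g, q.map (σ g) = q) ∧ q.degree < M ∧ q.eval x = s := by
    intro l'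
    induction l' with
    | nil => rintro - s rfl; exact ⟨0, by simp, by simp, by simp⟩
    | cons i l' ih =>
      rintro hl' s ⟨_, t, ⟨c, hc, rfl⟩, ht, rfl⟩
      obtain ⟨q, h1, h2, h3⟩ := ih (fun j hj => hl' j (List.mem_cons_of_mem _ hj)) t ht
      refine ⟨Polynomial.C c * Polynomial.X ^ i + q, fun g => by simp [h1, hc], ?_, by simp [h3]⟩
      refine (Polynomial.degree_add_le _ _).trans_lt (max_lt ?_ h2)
      refine (Polynomial.degree_C_mul_X_pow_le i c).trans_lt ?_
      exact_mod_cast hl' i List.mem_cons_self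
  obtain ⟨_, _, s, s', ⟨c, hc, rfl⟩, ⟨c', hc', rfl⟩, hs, hs', he, hne⟩ := hl M trivial
  obtain ⟨q, h1, h2, h3⟩ := hpoly l hM s hs
  obtain ⟨q', h1', h2', h3'⟩ := hpoly l hM s' hs'
  set f := Polynomial.C (c - c') * Polynomial.X ^ M + (q - q') with hf
  have hf0 : f ≠ 0 := by
    intro h0
    have h4 : (q - q').coeff M = 0 := Polynomial.coeff_eq_zero_of_degree_lt
      ((Polynomial.degree_sub_le _ _).trans_lt (max_lt h2 h2'))
    have h5 : f.coeff M = c - c' := by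
      rw [hf, Polynomial.coeff_add, h4, Polynomial.coeff_C_mul_X_pow]; simp
    rw [h0, Polynomial.coeff_zero] at h5
    rw [sub_eq_zero.1 h5.symm] at hne
    exact hne rfl
  have hfx : f.eval x = 0 := by
    simp only [hf, Polynomial.eval_add, Polynomial.eval_mul, Polynomial.eval_C, Polynomial.eval_pow,
      Polynomial.eval_X, Polynomial.eval_sub, h3, h3']
    linear_combination he
  refine hG.fixed (φ := fun g x => σ g x) hσ (by simp) (by simp) ((Polynomial.finite_setOfPred_isRoot hf0).subset ?_) g trivial
  rintro _ ⟨h, -, rfl⟩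
  have h6 : f.map (σ h) = f := by simp [hf, h1, h1', hc, hc']
  have h7 := Polynomial.eval_map_apply (f := σ h) (p := f) x
  rw [h6, hfx, map_zero] at h7
  exact h7

end FieldAut

section SimpleModule

variable {N : Type u} [LinearOrder N] [DenselyOrdered N] [NoMinOrder N] [NoMaxOrder N] [Nonempty N]
  {S : Struc N} {V : Type*} [AddCommGroup V] [Interp S V] [DefAddGrp S V]
  {G : Type*} [Group G] [Interp S G] [DefGrp S G] {ρ : G →* AddMonoid.End V}

theorem rep_inv_apply (ρ : G →* AddMonoid.End V) (g : G) (v : V) : ρ g⁻¹ (ρ g v) = v := by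
  have := DFunLike.congr_fun (map_mul ρ g⁻¹ g) v
  simpa using this.symm

theorem rep_apply_inv (ρ : G →* AddMonoid.End V) (g : G) (v : V) : ρ g (ρ g⁻¹ v) = v := by
  have := DFunLike.congr_fun (map_mul ρ g g⁻¹) v
  simpa using this.symm

theorem DefMap.action (hρ : DefMap S fun p : G × V => ρ p.1 p.2) {Γ : Type*} [Interp S Γ] {f : Γ → G} {h : Γ → V}
    (hf : DefMap S f) (hh : DefMap S h) : DefMap S fun x => ρ (f x) (h x) :=
  hρ.comp (g := fun x => (f x, h x)) (by fun_prop)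

theorem end_mul (f g : AddMonoid.End V) (v : V) : (f * g) v = f (g v) := rfl

/-- The kernel of an endomorphism. -/
def kerE (r : AddMonoid.End V) : AddSubgroup V where
  carrier := {v | r v = 0}
  zero_mem' := map_zero r
  add_mem' {a b} ha hb := by
    rw [Set.mem_ofPred_eq] at *
    rw [map_add, ha, hb, add_zero]
  neg_mem' {a} ha := by
    rw [Set.mem_ofPred_eq] at *
    rw [map_neg, ha, neg_zero]

theorem mem_kerE {r : AddMonoid.End V} {v : V} : v ∈ kerE r ↔ r v = 0 := Iff.rfl

variable (S) in
/-- The representation has no proper nontrivial definable invariant subgroup. -/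
def DefSimple (ρ : G →* AddMonoid.End V) : Prop :=
  ∀ W : AddSubgroup V, DefMap S (· ∈ W) → (∀ g, ∀ v ∈ W, ρ g v ∈ W) → W = ⊥ ∨ W = ⊤

/-- In a commutative ring of definable endomorphisms normalized by a connected group without invariant
subgroups, nonzero elements are injective. -/
theorem injective_of_defSimple [AddDCC S V] (hG : DConn S (⊤ : Subgroup G)) (hρ : DefMap S fun p : G × V => ρ p.1 p.2)
    (hs : DefSimple S ρ) {R : Subring (AddMonoid.End V)} (hRd : ∀ r ∈ R, DefMap S fun v => r v)
    (hRc : ∀ r ∈ R, ∀ s ∈ R, r * s = s * r) (hRG : ∀ g, ∀ r ∈ R, ρ g * r * ρ g⁻¹ ∈ R)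
    (hinf : ∀ W : AddSubgroup V, (∀ r ∈ R, ∀ v ∈ W, r v ∈ W) → W ≠ ⊥ → (W : Set V).Infinite) :
    ∀ r ∈ R, r ≠ 0 → ∀ v, r v = 0 → v = 0 := by
  intro r₀ hr₀ hne
  have hV : (⊤ : AddSubgroup V) ≠ ⊥ := by
    intro h
    apply hne
    ext v
    have : ∀ v : V, v = 0 := fun v => by
      have : v ∈ (⊤ : AddSubgroup V) := trivial
      rwa [h, AddSubgroup.mem_bot] at this
    exact this _
  have hker : ∀ r ∈ R, DefMap S fun v => r v = 0 := fun r hr => (hRd r hr).eq (DefMap.const 0)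
  let KK : AddSubgroup V → Prop := fun W => ∃ P : Set (AddMonoid.End V), P ⊆ R ∧ ∀ v, v ∈ W ↔ ∀ r ∈ P, r v = 0
  have hKd : ∀ W, KK W → DefMap S (· ∈ W) := by
    rintro W ⟨P, hP, hW⟩
    refine (DefMap.forall_addDCC (S := S) (ι := P) (K := fun r => kerE r.1) fun r => ?_).congrP
      fun v => by rw [hW]; simp [mem_kerE]
    exact (hker r (hP r.2)).congrP fun v => by simp [mem_kerE]
  obtain ⟨W, ⟨hWK, hW0⟩, hWm⟩ := AddDCC.exists_min (S := S) (V := V) (fun W => KK W ∧ W ≠ ⊥) (fun W h => hKd W h.1)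
    ⟨⊤, ⟨∅, by simp, by simp⟩, hV⟩
  have hinfK : ∀ W, KK W → ∀ s, s ∈ R → KK (W ⊓ kerE s) := by
    rintro W ⟨P, hP, hW⟩ s hs
    exact ⟨insert s P, Set.insert_subset hs hP, fun v => by
      simp [hW, mem_kerE, and_comm]⟩
  have hinvK : ∀ W, KK W → ∀ s, s ∈ R → ∀ v ∈ W, s v ∈ W := by
    rintro W ⟨P, hP, hW⟩ s hs v hv
    rw [hW] at hv ⊢
    intro r hr
    have := DFunLike.congr_fun (hRc r (hP hr) s hs) v
    simp only [end_mul, hv r hr, map_zero] at this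
    exact this
  let c : G → AddSubgroup V → AddSubgroup V := fun g W => W.comap (ρ g⁻¹ : V →+ V)
  have hc : ∀ g W v, v ∈ c g W ↔ ρ g⁻¹ v ∈ W := fun g W v => Iff.rfl
  have hcc : ∀ g W, c g⁻¹ (c g W) = W := fun g W => by
    ext v; rw [hc, hc, inv_inv, rep_inv_apply]
  have hcc' : ∀ g W, c g (c g⁻¹ W) = W := fun g W => by
    have := hcc g⁻¹ W
    rwa [inv_inv] at this
  have hcK : ∀ g W, KK W → KK (c g W) := by
    rintro g W ⟨P, hP, hW⟩
    refine ⟨(fun r => ρ g * r * ρ g⁻¹) '' P, ?_, fun v => ?_⟩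
    · rintro _ ⟨r, hr, rfl⟩; exact hRG g r (hP hr)
    · rw [hc, hW]
      simp only [Set.forall_mem_image, end_mul]
      refine forall₂_congr fun r _ => ⟨fun h => by rw [h, map_zero], fun h => ?_⟩
      rw [← rep_inv_apply ρ g (r _), h, map_zero]
  have hc0 : ∀ g W, W ≠ ⊥ → c g W ≠ ⊥ := by
    intro g W h h'
    apply h
    rw [← hcc g W, h']
    ext v
    rw [hc, AddSubgroup.mem_bot, AddSubgroup.mem_bot]
    exact ⟨fun h => by rw [← rep_apply_inv ρ g⁻¹ v, h, map_zero], fun h => by rw [h, map_zero]⟩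
  have hcm : ∀ g W', KK W' → W' ≠ ⊥ → W' ≤ c g W → W' = c g W := by
    intro g W' h h0 hle
    rw [← hWm (c g⁻¹ W') ⟨hcK _ _ h, hc0 _ _ h0⟩ (fun v hv => ?_), hcc']
    have h2 : v ∈ c g⁻¹ (c g W) := hle hv
    rwa [hcc] at h2
  have hdefc : ∀ g, DefMap S (· ∈ c g W) := fun g => hKd _ (hcK g W hWK)
  obtain ⟨l, -, -, hl⟩ := exists_maximal_indep S (V := V) (fun (g : G) v => v ∈ c g W) (fun _ => True)
    (fun g _ => hdefc g) (fun g _ => hinf _ (hinvK _ (hcK g W hWK)) (hc0 g W hW0))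
  have hsep : ∀ g (l : List G), (∀ i ∈ l, c g W ≠ c i W) → ∃ r ∈ R,
      (∀ v, SumSet (fun (g : G) v => v ∈ c g W) l v → r v = 0) ∧ ∀ v ∈ c g W, r v = 0 → v = 0 := by
    intro g l
    induction l with
    | nil =>
      intro _
      exact ⟨1, R.one_mem, by rintro v rfl; exact map_zero _, fun v _ h => h⟩
    | cons i l ih =>
      intro hi
      obtain ⟨r, hr, h1, h2⟩ := ih fun j hj => hi j (List.mem_cons_of_mem _ hj)
      obtain ⟨s, hs, h3, h4⟩ : ∃ s ∈ R, (∀ v ∈ c i W, s v = 0) ∧ ∀ v ∈ c g W, s v = 0 → v = 0 := by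
        obtain ⟨P, hP, hPW⟩ := hcK i W hWK
        by_contra! hcon
        refine hi i List.mem_cons_self (hcm i _ (hcK g W hWK) (hc0 g W hW0) fun v hv => (hPW v).2 fun s hs => ?_)
        obtain ⟨w, hw, hw0, hw1⟩ := hcon s (hP hs) fun v hv => (hPW v).1 hv s hs
        have h5 := hcm g (c g W ⊓ kerE s) (hinfK _ (hcK g W hWK) s (hP hs)) (fun h => hw1 ?_) inf_le_left
        · rw [← h5] at hv
          exact hv.2
        · rw [← AddSubgroup.mem_bot, ← h]; exact ⟨hw, hw0⟩
      refine ⟨r * s, R.mul_mem hr hs, ?_, fun v hv h => h4 v hv (h2 _ (hinvK _ (hcK g W hWK) s hs v hv) h)⟩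
      rintro v ⟨b, t, hb, ht, rfl⟩
      rw [map_add, end_mul, h3 b hb, map_zero, zero_add, hRc r hr s hs, end_mul, h1 t ht,
        map_zero]
  have hfin : ((fun g => c g W) '' ((⊤ : Subgroup G) : Set G)).Finite := by
    refine ((l.finite_toSet).image fun g => c g W).subset ?_
    rintro _ ⟨g, -, rfl⟩
    by_contra hcon
    obtain ⟨r, hr, h1, h2⟩ := hsep g l fun i hi h => hcon ⟨i, hi, h.symm⟩
    obtain ⟨b, b', s, s', hb, hb', hs, hs', he, hne⟩ := hl g trivial
    apply hne
    rw [← sub_eq_zero]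
    refine h2 _ ((c g W).sub_mem hb hb') ?_
    rw [sub_eq_sub_iff_add_eq_add.2 (he.trans (add_comm _ _)), map_sub, h1 _ hs, h1 _ hs', sub_zero]
  let K : Subgroup G :=
    { carrier := {g | ∀ v, v ∈ W ↔ ρ g v ∈ W}
      one_mem' := fun v => by simp
      mul_mem' := fun {a b} ha hb v => by rw [map_mul, end_mul, ← ha, ← hb]
      inv_mem' := fun {a} ha v => by
        rw [ha (ρ a⁻¹ v), rep_apply_inv] }
  have hKmem : ∀ g, g ∈ K ↔ ∀ v, v ∈ W ↔ ρ g v ∈ W := fun g => Iff.rfl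
  have hWd := hKd W hWK
  have hKdef : DefSub S K := ⟨by
    have h1 : DefMap S fun p : G × V => ρ p.1 p.2 ∈ W := hWd.comp hρ
    have h2 : DefMap S fun p : G × V => (p.2 ∈ W ↔ ρ p.1 p.2 ∈ W) := by fun_prop
    exact h2.all⟩
  have hKtop : K = ⊤ := hG.eq_of_finite le_top _ hfin fun x _ y _ hxy v => by
    have hxy : c x W = c y W := hxy
    have h : ρ y v ∈ c x W ↔ ρ y v ∈ c y W := by rw [hxy]
    rw [hc, hc, rep_inv_apply] at h
    rw [map_mul, end_mul, h]
  have hW : W = ⊤ := (hs W hWd fun g v hv => by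
    have : g ∈ K := by rw [hKtop]; trivial
    exact (this v).1 hv).resolve_left hW0
  intro v hv
  by_contra hv0
  have := hWm (W ⊓ kerE r₀) ⟨hinfK W hWK r₀ hr₀, fun h => hv0 ?_⟩ inf_le_left
  · rw [hW, top_inf_eq] at this
    apply hne
    ext w
    have h : w ∈ (⊤ : AddSubgroup V) := trivial
    rw [← this] at h
    exact h
  · rw [← AddSubgroup.mem_bot, ← h]
    exact ⟨hW ▸ trivial, hv⟩

end SimpleModule

section OfInj

variable {N : Type u} [LinearOrder N] [DenselyOrdered N] [NoMinOrder N] [NoMaxOrder N] [Nonempty N]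
  {S : Struc N} {Γ : Type*} [Interp S Γ] {E : Type*}

/-- The interpretation of a set by an injection with definable range. -/
@[reducible] def Interp.ofInj (f : E → Γ) (hf : Function.Injective f) (h : DefP S fun x => ∃ e, f e = x) :
    Interp S E where
  n := ar S Γ
  rel a e := rp S a (f e)
  surj e := Interp.surj (f e)
  uniq h h' := hf (Interp.uniq h h')
  eq_def := by
    refine def_congr (S.def_inter (Interp.eq_def (S := S) (Γ := Γ))
      (S.def_reindex (Fin.castAdd _) h)) fun z => ?_
    constructor
    · rintro ⟨γ, h1, h2⟩
      exact ⟨⟨f γ, h1, h2⟩, ⟨f γ, h1, γ, rfl⟩⟩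
    · rintro ⟨⟨γ, h1, h2⟩, ⟨_, h3, e, rfl⟩⟩
      obtain rfl := Interp.uniq h1 h3
      exact ⟨e, h1, h2⟩

theorem DefMap.ofInj (f : E → Γ) (hf : Function.Injective f) (h : DefP S fun x => ∃ e, f e = x) :
    letI := Interp.ofInj f hf h; DefMap S f := by
  let _ := Interp.ofInj f hf h
  exact def_congr (Interp.eq_def (S := S) (Γ := E)) fun z => Iff.rfl

theorem DefMap.to_ofInj (f : E → Γ) (hf : Function.Injective f) (h : DefP S fun x => ∃ e, f e = x)
    {Δ : Type*} [Interp S Δ] {g : Δ → E} (hg : DefMap S fun x => f (g x)) :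
    letI := Interp.ofInj f hf h; DefMap S g := by
  let _ := Interp.ofInj f hf h
  exact hg

end OfInj

section ScalarField

variable {N : Type u} [LinearOrder N] [DenselyOrdered N] [NoMinOrder N] [NoMaxOrder N] [Nonempty N]
  {S : Struc N} {V : Type*} [AddCommGroup V] [Interp S V] [DefAddGrp S V]
  {G : Type*} [Group G] [Interp S G] [DefGrp S G] {ρ : G →* AddMonoid.End V} {A : Subgroup G}
  {F : Subring (AddMonoid.End V)}

variable (S) in
/-- `F` is a field of definable endomorphisms containing the image of `A`. -/
structure ScalarField (ρ : G →* AddMonoid.End V) (A : Subgroup G) (F : Subring (AddMonoid.End V)) : Prop where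
  comm : ∀ r ∈ F, ∀ s ∈ F, r * s = s * r
  dfn : ∀ r ∈ F, DefMap S fun v => r v
  inv : ∀ r ∈ F, r ≠ 0 → ∃ s ∈ F, s * r = 1
  mem : ∀ a ∈ A, ρ a ∈ F

theorem ScalarField.eq_zero (hF : ScalarField S ρ A F) {r : AddMonoid.End V} (hr : r ∈ F) {v : V} (hv : v ≠ 0)
    (h : r v = 0) : r = 0 := by
  by_contra h0
  obtain ⟨s, -, hs⟩ := hF.inv r hr h0
  apply hv
  have := DFunLike.congr_fun hs v
  rw [end_mul, h, map_zero] at this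
  exact this.symm

/-- The pairs of values at `v₀` and `v` of the sums of the endomorphisms in the list, with coefficients in `ρ(A)`. -/
def actSum (ρ : G →* AddMonoid.End V) (A : Subgroup G) (v₀ : V) : List (AddMonoid.End V) → V → V → V → Prop
  | [], s, _, t => s = 0 ∧ t = 0
  | φ :: l, s, v, t => ∃ a s' t', a ∈ A ∧ actSum ρ A v₀ l s' v t' ∧ s = φ (ρ a v₀) + s' ∧ t = φ (ρ a v) + t'

theorem DefMap.actSum [DefSub S A] (hρ : DefMap S fun p : G × V => ρ p.1 p.2) (v₀ : V) {l : List (AddMonoid.End V)}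
    (hl : ∀ φ ∈ l, DefMap S fun v => φ v) : DefMap S fun p : V × V × V => actSum ρ A v₀ l p.1 p.2.1 p.2.2 := by
  induction l with
  | nil => simp only [OMin.actSum]; fun_prop
  | cons φ l ih =>
    have h1 := ih fun j hj => hl j (List.mem_cons_of_mem _ hj)
    have h2 : DefMap S fun x : ((((V × V × V) × G) × V) × V) => OMin.actSum ρ A v₀ l x.1.2 x.1.1.1.2.1 x.2 :=
      h1.comp (g := fun x : ((((V × V × V) × G) × V) × V) => (x.1.2, x.1.1.1.2.1, x.2)) (by fun_prop)
    have h3 := hl φ List.mem_cons_self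
    have h4 : DefMap S fun x : ((((V × V × V) × G) × V) × V) => φ (ρ x.1.1.2 v₀) :=
      h3.comp (hρ.action (f := fun x : ((((V × V × V) × G) × V) × V) => x.1.1.2) (h := fun _ => v₀) (by fun_prop) (by fun_prop))
    have h5 : DefMap S fun x : ((((V × V × V) × G) × V) × V) => φ (ρ x.1.1.2 x.1.1.1.2.1) :=
      h3.comp (hρ.action (f := fun x : ((((V × V × V) × G) × V) × V) => x.1.1.2) (h := fun x => x.1.1.1.2.1) (by fun_prop) (by fun_prop))
    have h6 : DefMap S fun x : ((((V × V × V) × G) × V) × V) => x.1.1.2 ∈ A ∧ OMin.actSum ρ A v₀ l x.1.2 x.1.1.1.2.1 x.2 ∧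
      x.1.1.1.1 = φ (ρ x.1.1.2 v₀) + x.1.2 ∧ x.1.1.1.2.2 = φ (ρ x.1.1.2 x.1.1.1.2.1) + x.2 := by fun_prop
    exact h6.ex.ex.ex

theorem ScalarField.of_actSum (hF : ScalarField S ρ A F) {v₀ : V} {l : List (AddMonoid.End V)} (hl : ∀ φ ∈ l, φ ∈ F)
    {s v t : V} (h : actSum ρ A v₀ l s v t) : ∃ ψ ∈ F, ψ v₀ = s ∧ ψ v = t := by
  induction l generalizing s t with
  | nil => exact ⟨0, F.zero_mem, h.1.symm, h.2.symm⟩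
  | cons φ l ih =>
    obtain ⟨a, s', t', ha, h, rfl, rfl⟩ := h
    obtain ⟨ψ, h1, rfl, rfl⟩ := ih (fun j hj => hl j (List.mem_cons_of_mem _ hj)) h
    exact ⟨φ * ρ a + ψ, F.add_mem (F.mul_mem (hl φ List.mem_cons_self) (hF.mem a ha)) h1, rfl, rfl⟩

theorem exists_actSum {v₀ : V} {l : List (AddMonoid.End V)} {s : V}
    (h : SumSet (fun (φ : AddMonoid.End V) u => ∃ a, a ∈ A ∧ φ (ρ a v₀) = u) l s) (v : V) : ∃ t, actSum ρ A v₀ l s v t := by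
  induction l generalizing s with
  | nil => exact ⟨0, h, rfl⟩
  | cons φ l ih =>
    obtain ⟨_, s', ⟨a, ha, rfl⟩, h, rfl⟩ := h
    obtain ⟨t, ht⟩ := ih h
    exact ⟨_, a, s', t, ha, ht, rfl, rfl⟩

/-- The field and its action are definable. -/
theorem ScalarField.def_action [DefSub S A] (hF : ScalarField S ρ A F) (hρ : DefMap S fun p : G × V => ρ p.1 p.2)
    {v₀ : V} (h0 : v₀ ≠ 0) (hinf : ((fun a => ρ a v₀) '' A).Infinite) :
    DefMap S fun p : V × V × V => ∃ r ∈ F, r v₀ = p.1 ∧ r p.2.1 = p.2.2 := by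
  obtain ⟨l, hlF, -, hl⟩ := exists_maximal_indep S (V := V) (fun (φ : AddMonoid.End V) u => ∃ a, a ∈ A ∧ φ (ρ a v₀) = u)
    (fun φ => φ ∈ F ∧ φ ≠ 0) (fun φ hφ => by
      have h4 : DefMap S fun x : V × G => φ (ρ x.2 v₀) :=
        (hF.dfn φ hφ.1).comp (hρ.action (f := fun x : V × G => x.2) (h := fun _ => v₀) (by fun_prop) (by fun_prop))
      have h5 : DefMap S fun x : V × G => x.2 ∈ A := by fun_prop
      have h6 : DefMap S fun x : V × G => x.1 := by fun_prop
      exact (h5.and (h4.eq h6)).ex) (fun φ hφ => by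
      refine (hinf.image (f := fun v => φ v) fun x _ y _ hxy => ?_).mono ?_
      · by_contra hne
        refine hφ.2 (hF.eq_zero hφ.1 (sub_ne_zero.2 hne) ?_)
        rw [map_sub, sub_eq_zero]; exact hxy
      · rintro _ ⟨_, ⟨a, ha, rfl⟩, rfl⟩
        exact ⟨a, ha, rfl⟩)
  have hlF' : ∀ φ ∈ l, φ ∈ F := fun φ hφ => (hlF φ hφ).1
  have key : ∀ p : V × V × V, ((p.1 = 0 ∧ p.2.2 = 0) ∨ ∃ a a' s t s' t', a ∈ A ∧ a' ∈ A ∧ actSum ρ A v₀ l s p.2.1 t ∧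
      actSum ρ A v₀ l s' p.2.1 t' ∧ ρ a v₀ ≠ ρ a' v₀ ∧ ρ a p.1 - ρ a' p.1 = s' - s ∧
      ρ a p.2.2 - ρ a' p.2.2 = t' - t) ↔ ∃ r ∈ F, r v₀ = p.1 ∧ r p.2.1 = p.2.2 := by
    rintro ⟨u, v, w⟩
    constructor
    · rintro (⟨rfl, rfl⟩ | ⟨a, a', s, t, s', t', ha, ha', h1, h2, h3, h4, h5⟩)
      · exact ⟨0, F.zero_mem, rfl, rfl⟩
      · obtain ⟨ψ, hψ, rfl, rfl⟩ := hF.of_actSum hlF' h1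
        obtain ⟨ψ', hψ', rfl, rfl⟩ := hF.of_actSum hlF' h2
        obtain ⟨e, he, hed⟩ := hF.inv (ρ a - ρ a') (F.sub_mem (hF.mem a ha) (hF.mem a' ha')) fun h => h3 <| by
          rw [sub_eq_zero.1 h]
        have hed' : ∀ x, e (ρ a x - ρ a' x) = x := fun x => DFunLike.congr_fun hed x
        refine ⟨e * (ψ' - ψ), F.mul_mem he (F.sub_mem hψ' hψ), ?_, ?_⟩
        · rw [← hed' u]; exact congrArg e h4.symm
        · rw [← hed' w]; exact congrArg e h5.symm
    · rintro ⟨r, hr, h1, h2⟩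
      dsimp only at h1 h2
      subst h1 h2
      rcases eq_or_ne r 0 with rfl | hr0
      · exact Or.inl ⟨rfl, rfl⟩
      obtain ⟨_, _, s, s', ⟨a, ha, rfl⟩, ⟨a', ha', rfl⟩, hs, hs', he, hne⟩ := hl r ⟨hr, hr0⟩
      obtain ⟨t, ht⟩ := exists_actSum hs v
      obtain ⟨t', ht'⟩ := exists_actSum hs' v
      have hcm : ∀ b ∈ A, ∀ x, ρ b (r x) = r (ρ b x) := fun b hb x => DFunLike.congr_fun (hF.comm _ (hF.mem b hb) r hr) x
      refine Or.inr ⟨a, a', s, t, s', t', ha, ha', ht, ht', fun h => hne (by rw [h]), ?_, ?_⟩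
      · dsimp only
        rw [hcm a ha, hcm a' ha', sub_eq_sub_iff_add_eq_add.2]
        rw [he]; abel
      · obtain ⟨ψ, hψ, rfl, rfl⟩ := hF.of_actSum hlF' ht
        obtain ⟨ψ', hψ', rfl, rfl⟩ := hF.of_actSum hlF' ht'
        have h6 : r * ρ a + ψ - (r * ρ a' + ψ') = 0 :=
          hF.eq_zero (F.sub_mem (F.add_mem (F.mul_mem hr (hF.mem a ha)) hψ)
            (F.add_mem (F.mul_mem hr (hF.mem a' ha')) hψ')) h0 (sub_eq_zero.2 he)
        have h7 : r (ρ a v) + ψ v = r (ρ a' v) + ψ' v := DFunLike.congr_fun (sub_eq_zero.1 h6) v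
        dsimp only
        rw [hcm a ha, hcm a' ha', sub_eq_sub_iff_add_eq_add.2]
        rw [h7]; abel
  refine DefMap.congrP ?_ fun p => (key p).symm
  have hA := DefMap.actSum (S := S) (A := A) hρ v₀ fun φ hφ => hF.dfn φ (hlF' φ hφ)
  let Γ := ((((((V × V × V) × G) × G) × V) × V) × V) × V
  have h1 : DefMap S fun x : Γ => actSum ρ A v₀ l x.1.1.1.2 x.1.1.1.1.1.1.2.1 x.1.1.2 :=
    hA.comp (g := fun x : Γ => (x.1.1.1.2, x.1.1.1.1.1.1.2.1, x.1.1.2)) (by fun_prop)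
  have h2 : DefMap S fun x : Γ => actSum ρ A v₀ l x.1.2 x.1.1.1.1.1.1.2.1 x.2 :=
    hA.comp (g := fun x : Γ => (x.1.2, x.1.1.1.1.1.1.2.1, x.2)) (by fun_prop)
  have hρ' : ∀ (f : Γ → G) (h : Γ → V), DefMap S f → DefMap S h → DefMap S fun x => ρ (f x) (h x) :=
    fun f h hf hh => hρ.action hf hh
  have h3 := hρ' (fun x : Γ => x.1.1.1.1.1.2) (fun x => v₀) (by fun_prop) (by fun_prop)
  have h3' := hρ' (fun x : Γ => x.1.1.1.1.2) (fun x => v₀) (by fun_prop) (by fun_prop)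
  have h4 := hρ' (fun x : Γ => x.1.1.1.1.1.2) (fun x => x.1.1.1.1.1.1.1) (by fun_prop) (by fun_prop)
  have h4' := hρ' (fun x : Γ => x.1.1.1.1.2) (fun x => x.1.1.1.1.1.1.1) (by fun_prop) (by fun_prop)
  have h5 := hρ' (fun x : Γ => x.1.1.1.1.1.2) (fun x => x.1.1.1.1.1.1.2.2) (by fun_prop) (by fun_prop)
  have h5' := hρ' (fun x : Γ => x.1.1.1.1.2) (fun x => x.1.1.1.1.1.1.2.2) (by fun_prop) (by fun_prop)
  have h6 : DefMap S fun x : Γ => x.1.1.1.1.1.2 ∈ A ∧ x.1.1.1.1.2 ∈ A ∧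
      actSum ρ A v₀ l x.1.1.1.2 x.1.1.1.1.1.1.2.1 x.1.1.2 ∧ actSum ρ A v₀ l x.1.2 x.1.1.1.1.1.1.2.1 x.2 ∧
      ρ x.1.1.1.1.1.2 v₀ ≠ ρ x.1.1.1.1.2 v₀ ∧
      ρ x.1.1.1.1.1.2 x.1.1.1.1.1.1.1 - ρ x.1.1.1.1.2 x.1.1.1.1.1.1.1 = x.1.2 - x.1.1.1.2 ∧
      ρ x.1.1.1.1.1.2 x.1.1.1.1.1.1.2.2 - ρ x.1.1.1.1.2 x.1.1.1.1.1.1.2.2 = x.2 - x.1.1.2 := by fun_prop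
  have h7 : DefMap S fun p : V × V × V => (p.1 = 0 ∧ p.2.2 = 0) := by fun_prop
  exact h7.or h6.ex.ex.ex.ex.ex.ex

end ScalarField

section Linear

variable {N : Type u} [LinearOrder N] [DenselyOrdered N] [NoMinOrder N] [NoMaxOrder N] [Nonempty N]
  {S : Struc N} {V : Type*} [AddCommGroup V] [Interp S V] [DefAddGrp S V]
  {G : Type*} [Group G] [Interp S G] [DefGrp S G] {ρ : G →* AddMonoid.End V}

theorem AddDCC.of_injective [AddDCC S V] {E : Type*} [AddCommGroup E] [Interp S E] {f : E →+ V} (hf : Function.Injective f)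
    (hfd : DefMap S f) : AddDCC S E := by
  refine ⟨fun F hF ⟨K, hK⟩ => ?_⟩
  obtain ⟨_, ⟨M, hM, rfl⟩, h⟩ := AddDCC.exists_min (S := S) (V := V) (fun W => ∃ M, F M ∧ M.map f = W) (by
    rintro _ ⟨M, hM, rfl⟩
    have h1 := hF M hM
    have h2 : DefMap S fun p : V × E => p.2 ∈ M ∧ f p.2 = p.1 := by fun_prop
    exact h2.ex.congrP fun x => AddSubgroup.mem_map) ⟨_, K, hK, rfl⟩
  refine ⟨M, hM, fun L hL hLM => ?_⟩
  have := h _ ⟨L, hL, rfl⟩ (AddSubgroup.map_mono hLM)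
  exact AddSubgroup.map_injective hf this

/-- A connected group normalizing a definable field of endomorphisms commutes with it. -/
theorem commute_field [AddDCC S V] (hG : DConn S (⊤ : Subgroup G)) (hρ : DefMap S fun p : G × V => ρ p.1 p.2)
    {K : Type*} [Field K] (e : K →+* AddMonoid.End V) {v₀ : V} (h0 : v₀ ≠ 0)
    (he : DefMap S fun p : V × V × V => ∃ r, e r v₀ = p.1 ∧ e r p.2.1 = p.2.2)
    (hconj : ∀ g r, ∃ r', ρ g * e r * ρ g⁻¹ = e r') (g : G) (r : K) : ρ g * e r = e r * ρ g := by
  have hev0 : ∀ r, e r v₀ = 0 → r = 0 := fun r h => by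
    by_contra hr
    apply h0
    have := DFunLike.congr_fun (map_mul e r⁻¹ r) v₀
    rw [inv_mul_cancel₀ hr, end_mul, h, map_zero, map_one] at this
    exact this
  let ev : K →+ V := AddMonoidHom.mk' (fun r => e r v₀) fun x y => by rw [map_add]; rfl
  have hevi : Function.Injective ev := (injective_iff_map_eq_zero ev).2 hev0
  have hrange : DefP S fun x => ∃ r, ev r = x := by
    rw [defP_iff]
    have : DefMap S fun x : V => ∃ r, e r v₀ = x ∧ e r 0 = 0 :=
      he.comp (g := fun x : V => (x, 0, 0)) (by fun_prop)
    exact this.congrP fun x => exists_congr fun r => by rw [map_zero]; simp [ev]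
  let I : Interp S K := Interp.ofInj ev hevi hrange
  have hevd : DefMap S ev := DefMap.ofInj ev hevi hrange
  have hact : DefMap S fun p : K × V => e p.1 p.2 := by
    refine DefMap.of_graph ?_
    rw [defP_iff]
    have : DefMap S fun p : (K × V) × V => ∃ r, e r v₀ = ev p.1.1 ∧ e r p.1.2 = p.2 :=
      he.comp (g := fun p : (K × V) × V => (ev p.1.1, p.1.2, p.2)) (by fun_prop)
    refine this.congrP fun p => ⟨fun h => ⟨p.1.1, rfl, h⟩, ?_⟩
    rintro ⟨r, h1, h2⟩
    rw [← hevi h1]; exact h2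
  have : DefField S K :=
    { add_def := by
        refine DefMap.to_ofInj ev hevi hrange ?_
        simp only [map_add]; fun_prop
      neg_def := by
        refine DefMap.to_ofInj ev hevi hrange ?_
        simp only [map_neg]; fun_prop
      mul_def := by
        refine DefMap.to_ofInj ev hevi hrange ?_
        have : DefMap S fun p : K × K => e p.1 (ev p.2) := hact.comp (g := fun p : K × K => (p.1, ev p.2)) (by fun_prop)
        have h4 : (fun p : K × K => ev (p.1 * p.2)) = fun p => e p.1 (ev p.2) := funext fun p =>
          DFunLike.congr_fun (map_mul e p.1 p.2) v₀
        rw [h4]; exact this }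
  have : AddDCC S K := AddDCC.of_injective hevi hevd
  choose s hs using hconj
  have hei : Function.Injective e := (injective_iff_map_eq_zero e).2 fun r h => hev0 r (by rw [h]; rfl)
  have hss : ∀ g r v, e (s g r) v = ρ g (e r (ρ g⁻¹ v)) := fun g r v => DFunLike.congr_fun (hs g r).symm v
  have hext : ∀ a b : K, (∀ v, e a v = e b v) → a = b := fun a b h => hei (AddMonoidHom.ext h)
  let σ : G →* (K →+* K) :=
    { toFun := fun g =>
        { toFun := s g
          map_one' := hext _ _ fun v => by rw [hss, map_one]; exact rep_apply_inv ρ g v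
          map_mul' := fun a b => hext _ _ fun v => by
            rw [hss, map_mul, map_mul, end_mul, end_mul, hss, hss, rep_inv_apply]
          map_zero' := hext _ _ fun v => by rw [hss, map_zero]; exact map_zero _
          map_add' := fun a b => hext _ _ fun v => by
            rw [hss, map_add, map_add]
            change ρ g (e a _ + e b _) = e (s g a) v + e (s g b) v
            rw [map_add, hss, hss] }
      map_one' := RingHom.ext fun a => hext _ _ fun v => by
        change e (s 1 a) v = e a v
        rw [hss, inv_one, map_one]; rfl
      map_mul' := fun g h => RingHom.ext fun a => hext _ _ fun v => by
        change e (s (g * h) a) v = e (s g (s h a)) v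
        rw [hss, hss, hss, mul_inv_rev, map_mul, map_mul]; rfl }
  have hσ : DefMap S fun p : G × K => σ p.1 p.2 := by
    refine DefMap.to_ofInj ev hevi hrange ?_
    have h1 : DefMap S fun p : G × K => ρ p.1⁻¹ v₀ := hρ.action (f := fun p : G × K => p.1⁻¹) (h := fun _ => v₀) (by fun_prop) (by fun_prop)
    have h2 : DefMap S fun p : G × K => e p.2 (ρ p.1⁻¹ v₀) := hact.comp (g := fun p : G × K => (p.2, ρ p.1⁻¹ v₀)) (by fun_prop)
    have h3 : DefMap S fun p : G × K => ρ p.1 (e p.2 (ρ p.1⁻¹ v₀)) := hρ.action (by fun_prop) h2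
    have h4 : (fun p : G × K => ev (σ p.1 p.2)) = fun p : G × K => ρ p.1 (e p.2 (ρ p.1⁻¹ v₀)) := funext fun p => hss _ _ _
    rw [h4]; exact h3
  have h := field_aut_trivial hG hσ g r
  refine AddMonoidHom.ext fun v => ?_
  have h1 := hss g r (ρ g v)
  rw [rep_inv_apply, show s g r = r from h] at h1
  exact h1.symm

/-- Commutators acting as scalars vanish on a connected group. -/
theorem commute_of_scalar (hρ : DefMap S fun p : G × V => ρ p.1 p.2)
    {K : Type*} [Field K] [Infinite K] (e : K →+* AddMonoid.End V) {v₀ : V} (h0 : v₀ ≠ 0)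
    (he : DefMap S fun p : V × V × V => ∃ r, e r v₀ = p.1 ∧ e r p.2.1 = p.2.2)
    (hcomm : ∀ g r, ρ g * e r = e r * ρ g) {L : Subgroup G} [DefSub S L] (hL : DConn S L)
    (hscal : ∀ x ∈ L, ∀ y ∈ L, ∃ r, ρ ⁅x, y⁆ = e r) : ∀ x ∈ L, ∀ y ∈ L, ρ x * ρ y = ρ y * ρ x := by
  have heinj : ∀ v : V, v ≠ 0 → ∀ r, e r v = 0 → r = 0 := fun v hv r h => by
    by_contra hr
    apply hv
    have := DFunLike.congr_fun (map_mul e r⁻¹ r) v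
    rw [inv_mul_cancel₀ hr, end_mul, h, map_zero, map_one] at this
    exact this
  let _ : Module K V := Module.compHom V e
  have hsm : ∀ (r : K) v, r • v = e r v := fun r v => rfl
  have hBd : ∀ v : V, DefMap S fun u => ∃ r : K, r • v = u := fun v => by
    have : DefMap S fun p : V × V => ∃ r, e r v₀ = p.2 ∧ e r v = p.1 :=
      he.comp (g := fun p : V × V => (p.2, v, p.1)) (by fun_prop)
    exact (DefMap.ex (P := fun (u u' : V) => ∃ r, e r v₀ = u' ∧ e r v = u) this).congrP fun u => ⟨fun ⟨r, hr⟩ => ⟨_, r, rfl, hr⟩, fun ⟨_, r, _, hr⟩ => ⟨r, hr⟩⟩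
  obtain ⟨l, -, -, hl⟩ := exists_maximal_indep S (V := V) (fun (v : V) u => ∃ r : K, r • v = u)
    (fun v => v ≠ 0) (fun v _ => hBd v) (fun v hv => by
      refine (Set.infinite_range_of_injective (f := fun r : K => r • v) fun a b hab => ?_).mono ?_
      · rw [← sub_eq_zero]
        refine heinj v hv _ ?_
        rw [← hsm, sub_smul, sub_eq_zero]; exact hab
      · rintro _ ⟨r, rfl⟩; exact ⟨r, rfl⟩)
  have hspan : ∀ (l : List V) s, SumSet (fun (v : V) u => ∃ r : K, r • v = u) l s →
      s ∈ Submodule.span K {v | v ∈ l} := by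
    intro l
    induction l with
    | nil => rintro s rfl; exact Submodule.zero_mem _
    | cons v l ih =>
      rintro _ ⟨_, s, ⟨r, rfl⟩, hs, rfl⟩
      refine Submodule.add_mem _ (Submodule.smul_mem _ _ (Submodule.subset_span List.mem_cons_self)) ?_
      exact Submodule.span_mono (fun x hx => List.mem_cons_of_mem _ hx) (ih s hs)
  have hfd : Module.Finite K V := by
    refine ⟨⟨(l.finite_toSet).toFinset, ?_⟩⟩
    rw [Set.Finite.coe_toFinset, eq_top_iff]
    intro v _
    rcases eq_or_ne v 0 with rfl | hv
    · exact Submodule.zero_mem _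
    obtain ⟨_, _, s, s', ⟨r, rfl⟩, ⟨r', rfl⟩, hs, hs', h1, h2⟩ := hl v hv
    have h3 : r - r' ≠ 0 := fun h => h2 (by rw [sub_eq_zero.1 h])
    have h4 : v = (r - r')⁻¹ • (s' - s) := by
      rw [eq_inv_smul_iff₀ h3, sub_smul, sub_eq_sub_iff_add_eq_add, h1, add_comm]
    rw [h4]
    exact Submodule.smul_mem _ _ (Submodule.sub_mem _ (hspan l _ hs') (hspan l _ hs))
  let T : G →* (V →ₗ[K] V) :=
    { toFun := fun g =>
        { toFun := fun v => ρ g v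
          map_add' := fun a b => map_add _ a b
          map_smul' := fun r v => DFunLike.congr_fun (hcomm g r) v }
      map_one' := LinearMap.ext fun v => by simp
      map_mul' := fun g h => LinearMap.ext fun v => DFunLike.congr_fun (map_mul ρ g h) v }
  have hT : ∀ g v, T g v = ρ g v := fun g v => rfl
  set n := Module.finrank K V with hn
  have hn0 : n ≠ 0 := by
    have : Nontrivial V := ⟨v₀, 0, h0⟩
    exact Module.finrank_pos.ne'
  have hroot : ∀ x ∈ L, ∀ y ∈ L, ∃ r : K, r ^ n = 1 ∧ ρ ⁅x, y⁆ = e r := by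
    intro x hx y hy
    obtain ⟨r, hr⟩ := hscal x hx y hy
    refine ⟨r, ?_, hr⟩
    have h1 : T ⁅x, y⁆ = r • LinearMap.id := LinearMap.ext fun v => by
      rw [hT, hr]; rfl
    have h2 := congrArg LinearMap.det h1
    rw [LinearMap.det_smul, LinearMap.det_id, mul_one, ← hn] at h2
    rw [← h2, commutatorElement_def]
    simp only [map_mul]
    have hi : ∀ g : G, LinearMap.det (T g) * LinearMap.det (T g⁻¹) = 1 := fun g => by
      rw [← map_mul, ← map_mul, mul_inv_cancel, map_one, map_one]
    linear_combination (LinearMap.det (T y) * LinearMap.det (T y⁻¹)) * hi x + hi y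
  have hfin : {φ : AddMonoid.End V | ∃ r : K, r ^ n = 1 ∧ φ = e r}.Finite := by
    have h0 : (Polynomial.X ^ n - 1 : Polynomial K) ≠ 0 := Polynomial.X_pow_sub_C_ne_zero (Nat.pos_of_ne_zero hn0) 1
    refine ((Polynomial.finite_setOfPred_isRoot h0).image e).subset ?_
    rintro _ ⟨r, hr, rfl⟩
    exact ⟨r, by simp [hr], rfl⟩
  intro x hx
  let M : Subgroup G :=
    { carrier := {y | y ∈ L ∧ ρ x * ρ y = ρ y * ρ x}
      one_mem' := ⟨L.one_mem, by simp⟩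
      mul_mem' := fun {a b} ha hb => ⟨L.mul_mem ha.1 hb.1, by
        rw [map_mul, ← mul_assoc, ha.2, mul_assoc, hb.2, mul_assoc]⟩
      inv_mem' := fun {a} ha => ⟨L.inv_mem ha.1, by
        have h1 : ρ a⁻¹ * ρ a = 1 := by rw [← map_mul, inv_mul_cancel, map_one]
        have h2 : ρ a * ρ a⁻¹ = 1 := by rw [← map_mul, mul_inv_cancel, map_one]
        calc ρ x * ρ a⁻¹ = ρ a⁻¹ * ρ a * ρ x * ρ a⁻¹ := by rw [h1, one_mul]
          _ = ρ a⁻¹ * (ρ x * ρ a) * ρ a⁻¹ := by rw [ha.2]; simp only [mul_assoc]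
          _ = ρ a⁻¹ * ρ x := by rw [mul_assoc, mul_assoc, h2, mul_one]⟩ }
  have hMmem : ∀ y, y ∈ M ↔ y ∈ L ∧ ρ x * ρ y = ρ y * ρ x := fun y => Iff.rfl
  have hMd : DefSub S M := ⟨by
    have h1 : DefMap S fun p : G × V => ρ x (ρ p.1 p.2) :=
      hρ.action (f := fun _ => x) (by fun_prop) hρ
    have h2 : DefMap S fun p : G × V => ρ p.1 (ρ x p.2) :=
      hρ.action (by fun_prop) (hρ.action (f := fun _ : G × V => x) (h := fun p => p.2) (by fun_prop) (by fun_prop))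
    have h3 : DefMap S fun y : G => ∀ v, ρ x (ρ y v) = ρ y (ρ x v) := (h1.eq h2).all
    have h4 : DefMap S fun y : G => y ∈ L := by fun_prop
    exact (h4.and h3).congrP fun y => by
      rw [hMmem]
      exact and_congr_right fun _ => ⟨fun h v => DFunLike.congr_fun h v, fun h => AddMonoidHom.ext h⟩⟩
  have hML : M = L := by
    refine hL.eq_of_finite (fun y hy => hy.1) (fun y => ρ ⁅x, y⁆) (hfin.subset ?_) fun a ha b hb hab => ?_
    · rintro _ ⟨y, hy, rfl⟩
      exact hroot x hx y hy
    · refine ⟨L.mul_mem (L.inv_mem ha) hb, ?_⟩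
      have hab : ρ ⁅x, a⁆ = ρ ⁅x, b⁆ := hab
      obtain ⟨r, hr⟩ := hscal x hx b hb
      have hm : ∀ y : G, ρ ⁅x, y⁆ * (ρ y * ρ x) = ρ x * ρ y := fun y => by
        rw [← map_mul, ← map_mul, ← map_mul]
        congr 1
        rw [commutatorElement_def]; group
      have ha2 := hm a
      have hb2 := hm b
      rw [hab, hr] at ha2
      rw [hr] at hb2
      have h1 : ρ a * ρ a⁻¹ = 1 := by rw [← map_mul, mul_inv_cancel, map_one]
      have h1' : ρ a⁻¹ * ρ a = 1 := by rw [← map_mul, inv_mul_cancel, map_one]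
      have h2 : e r * (ρ x * ρ a⁻¹) = ρ a⁻¹ * ρ x := by
        calc e r * (ρ x * ρ a⁻¹) = ρ a⁻¹ * ρ a * e r * ρ x * ρ a⁻¹ := by rw [h1', one_mul, mul_assoc]
          _ = ρ a⁻¹ * (e r * (ρ a * ρ x)) * ρ a⁻¹ := by
            rw [← mul_assoc (e r), ← hcomm a r]; simp only [mul_assoc]
          _ = ρ a⁻¹ * ρ x := by rw [ha2, mul_assoc, mul_assoc, h1, mul_one]
      have h3 : e r * (ρ x * ρ (a⁻¹ * b)) = e r * (ρ (a⁻¹ * b) * ρ x) := by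
        calc e r * (ρ x * ρ (a⁻¹ * b)) = e r * (ρ x * ρ a⁻¹) * ρ b := by rw [map_mul]; simp only [mul_assoc]
          _ = ρ a⁻¹ * (e r * (ρ b * ρ x)) := by rw [h2, hb2, mul_assoc]
          _ = e r * (ρ (a⁻¹ * b) * ρ x) := by
            rw [← mul_assoc, hcomm, map_mul]; simp only [mul_assoc]
      have h4 : ρ ⁅x, b⁆⁻¹ * e r = 1 := by rw [← hr, ← map_mul, inv_mul_cancel, map_one]
      have h5 := congrArg (ρ ⁅x, b⁆⁻¹ * ·) h3
      simpa only [← mul_assoc, h4, one_mul] using h5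
  intro y hy
  rw [← hML] at hy
  exact hy.2

end Linear

section SolvableAction

variable {N : Type u} [LinearOrder N] [DenselyOrdered N] [NoMinOrder N] [NoMaxOrder N] [Nonempty N]
  {S : Struc N} {G : Type*} [Group G] [Interp S G] [DefGrp S G]

/-- In a solvable group, the definable hull of the derived subgroup is proper. -/
theorem dcl_commutator_ne [DCC S G] [Group.IsSolvable G] {L : Subgroup G} [L.Normal] [DefSub S L] (hL : L ≠ ⊥) :
    dcl S ((⁅L, L⁆ : Subgroup G) : Set G) ≠ L := by
  intro h
  obtain ⟨E, hE0, hE⟩ : ∃ E : ℕ → Subgroup G, E 0 = L ∧ ∀ n, E (n + 1) = ⁅E n, E n⁆ :=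
    ⟨fun n => n.rec L fun _ E => ⁅E, E⁆, rfl, fun n => rfl⟩
  have hEn : ∀ n, (E n).Normal := fun n => by
    induction n with
    | zero => rw [hE0]; assumption
    | succ n ih => rw [hE]; infer_instance
  have hEd : ∀ n, E n ≤ derivedSeries G n := fun n => by
    induction n with
    | zero => exact le_top
    | succ n ih => rw [hE]; exact Subgroup.commutator_mono ih ih
  have hEL : ∀ n, dcl S (E n : Set G) = L := fun n => by
    induction n with
    | zero =>
      rw [hE0]
      exact le_antisymm (dcl_le (S := S) (K := L) (fun _ h => h)) (subset_dcl (S := S) (L : Set G))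
    | succ n ih =>
      have := hEn n
      have := hEn (n + 1)
      have hn : (dcl S (E (n + 1) : Set G)).Normal := dcl_normal _
      refine le_antisymm ((dcl_le (S := S) ?_).trans_eq ih) ?_
      · rw [hE]
        exact (Subgroup.commutator_le_left _ _).trans (subset_dcl (S := S) (E n : Set G))
      · refine h.symm.le.trans (dcl_le ?_)
        have h1 := commutator_dcl_le (S := S) (X := (E n : Set G)) (Y := (E n : Set G)) (M := dcl S (E (n + 1) : Set G))
          fun x hx y hy => subset_dcl (S := S) (E (n + 1) : Set G)
            (by rw [hE]; exact Subgroup.commutator_mem_commutator hx hy)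
        rw [ih] at h1
        exact h1
  obtain ⟨n, hn⟩ := (Group.isSolvable_def G).1 inferInstance
  have h1 := hEd n
  rw [hn, le_bot_iff] at h1
  have h2 := hEL n
  rw [h1] at h2
  apply hL
  rw [← h2, eq_bot_iff]
  exact dcl_le le_rfl

variable {V : Type*} [AddCommGroup V] [Interp S V] [DefAddGrp S V] {ρ : G →* AddMonoid.End V}

theorem surjective_of_injective [AddDCC S V] {r : AddMonoid.End V} (hr : DefMap S fun v => r v)
    (hi : ∀ v, r v = 0 → v = 0) (v : V) : ∃ w, r w = v := by
  have hinj : Function.Injective r := (injective_iff_map_eq_zero r).2 hi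
  let Q : ℕ → AddSubgroup V := fun n => n.rec ⊤ fun _ A => A.map (r : V →+ V)
  have hQ : ∀ n v, v ∈ Q (n + 1) ↔ ∃ w ∈ Q n, r w = v := fun n v => Iff.rfl
  have hQd : ∀ n, DefMap S (· ∈ Q n) := fun n => by
    induction n with
    | zero => exact (DefMap.const True).congrP fun x => by simp [Q]
    | succ n ih =>
      simp only [hQ]
      have : DefMap S fun p : V × V => p.2 ∈ Q n ∧ r p.2 = p.1 := by fun_prop
      exact this.ex
  have hQa : ∀ n, Q (n + 1) ≤ Q n := fun n => by
    induction n with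
    | zero => exact le_top
    | succ n ih => exact AddSubgroup.map_mono ih
  obtain ⟨_, ⟨n, rfl⟩, hn⟩ := AddDCC.exists_min (S := S) (V := V) (fun A => ∃ n, Q n = A)
    (by rintro _ ⟨n, rfl⟩; exact hQd n) ⟨_, 0, rfl⟩
  have h1 : ∀ m, m ≤ n → Q (n - m + 1) = Q (n - m) := fun m => by
    induction m with
    | zero => intro _; exact hn _ ⟨n + 1, rfl⟩ (hQa n)
    | succ m ih =>
      intro hm
      have h1 := ih (by omega)
      rw [show n - m = n - (m + 1) + 1 by omega] at h1
      exact AddSubgroup.map_injective hinj h1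
  have h2 := h1 n le_rfl
  rw [Nat.sub_self] at h2
  have h3 : v ∈ Q 0 := AddSubgroup.mem_top v
  rw [← h2] at h3
  obtain ⟨w, -, hw⟩ := h3
  exact ⟨w, hw⟩

variable (S) in
/-- The definable endomorphisms commuting with a set of endomorphisms. -/
def endCent (X : Set (AddMonoid.End V)) : Subring (AddMonoid.End V) where
  carrier := {φ | (DefMap S fun v => φ v) ∧ ∀ x ∈ X, x * φ = φ * x}
  mul_mem' {a b} ha hb := ⟨DefMap.comp (g := fun v => b v) ha.1 hb.1, fun x hx => by rw [← mul_assoc, ha.2 x hx, mul_assoc, hb.2 x hx, mul_assoc]⟩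
  one_mem' := ⟨DefMap.id, fun x _ => by rw [mul_one, one_mul]⟩
  add_mem' {a b} ha hb := ⟨ha.1.add hb.1, fun x hx => by rw [mul_add, add_mul, ha.2 x hx, hb.2 x hx]⟩
  zero_mem' := ⟨DefMap.const 0, fun x _ => by rw [mul_zero, zero_mul]⟩
  neg_mem' {a} ha := ⟨ha.1.neg, fun x hx => by rw [mul_neg, neg_mul, ha.2 x hx]⟩

theorem mem_endCent {X : Set (AddMonoid.End V)} {φ : AddMonoid.End V} :
    φ ∈ endCent S X ↔ (DefMap S fun v => φ v) ∧ ∀ x ∈ X, x * φ = φ * x := Iff.rfl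

/-- The bicommutant is preserved by definable automorphisms preserving the set. -/
theorem conj_mem_endCent {X : Set (AddMonoid.End V)} {a b : AddMonoid.End V} (ha : DefMap S fun v => a v)
    (hb : DefMap S fun v => b v) (hab : a * b = 1) (hX : ∀ x ∈ X, b * x * a ∈ X) {φ : AddMonoid.End V}
    (hφ : φ ∈ endCent S X) : a * φ * b ∈ endCent S X := by
  refine ⟨ha.comp (g := fun v => φ (b v)) (hφ.1.comp hb), fun x hx => ?_⟩
  have h := hφ.2 _ (hX x hx)
  calc x * (a * φ * b) = a * b * x * (a * φ * b) := by rw [hab, one_mul]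
    _ = a * (b * x * a * φ) * b := by simp only [mul_assoc]
    _ = a * φ * b * x * (a * b) := by rw [h]; simp only [mul_assoc]
    _ = a * φ * b * x := by rw [hab, mul_one]

/-- A connected solvable definable group acts on an infinite definable group without definable invariant
subgroups through a commutative quotient. -/
theorem commute_of_defSimple [AddDCC S V] [DCC S G] (hG : DConn S (⊤ : Subgroup G)) [Group.IsSolvable G]
    (hρ : DefMap S fun p : G × V => ρ p.1 p.2) (hs : DefSimple S ρ) [Infinite V] (x y : G) : ρ x * ρ y = ρ y * ρ x := by
  have hcom : ∀ x y, ρ ⁅x, y⁆ = 1 → ρ x * ρ y = ρ y * ρ x := fun x y h => by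
    have h1 : x * y = ⁅x, y⁆ * (y * x) := by rw [commutatorElement_def]; group
    rw [← map_mul, h1, map_mul, h, one_mul, map_mul]
  have hρg : ∀ g, DefMap S fun v => ρ g v := fun g => hρ.action (by fun_prop) (by fun_prop)
  by_contra hxy
  obtain ⟨L, ⟨hLd, hLn, hLc, hLx⟩, hLm⟩ := DCC.exists_min (S := S) (G := G)
    (fun L => DefSub S L ∧ L.Normal ∧ DConn S L ∧ ∃ x ∈ L, ∃ y ∈ L, ρ x * ρ y ≠ ρ y * ρ x) (fun K h => h.1)
    ⟨⊤, inferInstance, inferInstance, hG, x, trivial, y, trivial, hxy⟩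
  have hL0 : L ≠ ⊥ := by
    rintro rfl
    obtain ⟨x, hx, y, hy, h⟩ := hLx
    rw [Subgroup.mem_bot] at hx hy
    rw [hx, hy] at h
    exact h rfl
  set A := dcl S ((⁅L, L⁆ : Subgroup G) : Set G) with hA
  have hAn : A.Normal := dcl_normal _
  have hAc : DConn S A := hLc.dcl_commutator
  have hAL : A ≤ L := dcl_le (Subgroup.commutator_le_left L L)
  have hLA : ∀ x ∈ L, ∀ y ∈ L, ⁅x, y⁆ ∈ A := fun x hx y hy =>
    subset_dcl (S := S) _ (Subgroup.commutator_mem_commutator hx hy)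
  have hAcomm : ∀ a ∈ A, ∀ b ∈ A, ρ a * ρ b = ρ b * ρ a := by
    by_contra! hcon
    exact dcl_commutator_ne hL0 (hLm A ⟨inferInstance, hAn, hAc, hcon⟩ hAL)
  have hAfix : ∀ v, (∀ a ∈ A, ρ a v = v) → v = 0 := by
    let C : AddSubgroup V :=
      { carrier := {v | ∀ a ∈ A, ρ a v = v}
        zero_mem' := fun a _ => map_zero _
        add_mem' := fun {v w} hv hw a ha => by rw [map_add, hv a ha, hw a ha]
        neg_mem' := fun {v} hv a ha => by rw [map_neg, hv a ha] }
    have hC : ∀ v, v ∈ C ↔ ∀ a ∈ A, ρ a v = v := fun v => Iff.rfl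
    have hCd : DefMap S (· ∈ C) := by
      have h1 : DefMap S fun p : V × G => ρ p.2 p.1 := hρ.action (by fun_prop) (by fun_prop)
      have h2 : DefMap S fun p : V × G => (p.2 ∈ A → ρ p.2 p.1 = p.1) := by fun_prop
      exact h2.all
    have h3 := hs C hCd fun g v hv a ha => by
      have h4 := hv _ (hAn.conj_mem a ha g⁻¹)
      rw [inv_inv, map_mul, map_mul, end_mul, end_mul] at h4
      rw [← rep_apply_inv ρ g (ρ a _), h4]
    intro v hv
    rcases h3 with h3 | h3
    · rw [← hC, h3] at hv; exact hv
    · obtain ⟨x, hx, y, hy, h⟩ := hLx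
      refine absurd (hcom x y (AddMonoidHom.ext fun v => ?_)) h
      have : v ∈ C := by rw [h3]; trivial
      exact this _ (hLA x hx y hy)
  have hinf : ∀ v, v ≠ 0 → ((fun a => ρ a v) '' A).Infinite := fun v hv h =>
    hv (hAfix v (hAc.fixed (φ := fun g v => ρ g v) hρ (fun x => by rw [map_one]; rfl)
      (fun g h x => by rw [map_mul]; rfl) h))
  let C := endCent S ((fun a => ρ a) '' (A : Set G))
  let F := endCent S (C : Set (AddMonoid.End V))
  have hmemC : ∀ φ, φ ∈ C ↔ (DefMap S fun v => φ v) ∧ ∀ a ∈ A, ρ a * φ = φ * ρ a := fun φ => by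
    rw [mem_endCent, Set.forall_mem_image]; rfl
  have hmemF : ∀ φ, φ ∈ F ↔ (DefMap S fun v => φ v) ∧ ∀ c ∈ C, c * φ = φ * c := fun φ => mem_endCent
  have hAC : ∀ a ∈ A, ρ a ∈ C := fun a ha => (hmemC _).2 ⟨hρg a, fun b hb => hAcomm b hb a ha⟩
  have hAF : ∀ a ∈ A, ρ a ∈ F := fun a ha => (hmemF _).2 ⟨hρg a, fun c hc => (((hmemC c).1 hc).2 a ha).symm⟩
  have hFC : ∀ r ∈ F, r ∈ C := fun r hr => (hmemC r).2 ⟨((hmemF r).1 hr).1, fun a ha => ((hmemF r).1 hr).2 _ (hAC a ha)⟩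
  have hFcomm : ∀ r ∈ F, ∀ s ∈ F, r * s = s * r := fun r hr s hs => ((hmemF s).1 hs).2 r (hFC r hr)
  have hinv1 : ∀ g, ρ g * ρ g⁻¹ = 1 := fun g => by rw [← map_mul, mul_inv_cancel, map_one]
  have hinv2 : ∀ g, ρ g⁻¹ * ρ g = 1 := fun g => by rw [← map_mul, inv_mul_cancel, map_one]
  have hFG : ∀ g, ∀ r ∈ F, ρ g * r * ρ g⁻¹ ∈ F := fun g r hr => by
    refine conj_mem_endCent (hρg _) (hρg _) (hinv1 g) (fun c hc => ?_) hr
    have h1 := conj_mem_endCent (S := S) (X := (fun a => ρ a) '' (A : Set G)) (hρg g⁻¹) (hρg g) (hinv2 g) ?_ hc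
    · exact h1
    · rintro _ ⟨a, ha, rfl⟩
      exact ⟨g * a * g⁻¹, hAn.conj_mem a ha g, by simp only [map_mul]⟩
  have hFinj := injective_of_defSimple hG hρ hs (R := F) (fun r hr => ((hmemF r).1 hr).1) hFcomm hFG fun W hW hW0 => by
    obtain ⟨w, hw, hw0⟩ := W.bot_or_exists_ne_zero.resolve_left hW0
    refine (hinf w hw0).mono ?_
    rintro _ ⟨a, ha, rfl⟩
    exact hW _ (hAF a ha) w hw
  have hF : ScalarField S ρ A F := by
    refine ⟨hFcomm, fun r hr => ((hmemF r).1 hr).1, fun r hr hr0 => ?_, hAF⟩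
    have hi := hFinj r hr hr0
    have hrd := ((hmemF r).1 hr).1
    have hinj : Function.Injective r := (injective_iff_map_eq_zero r).2 hi
    choose s hs using surjective_of_injective hrd hi
    have hsr : ∀ v, s (r v) = v := fun v => hinj (hs _)
    let s' : V →+ V := AddMonoidHom.mk' s fun v w => hinj (by rw [hs, map_add, hs, hs])
    refine ⟨s', (hmemF _).2 ⟨?_, fun c hc => AddMonoidHom.ext fun v => ?_⟩, AddMonoidHom.ext hsr⟩
    · refine DefMap.of_graph ?_
      rw [defP_iff]
      have : DefMap S fun p : V × V => p.1 = r p.2 := by fun_prop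
      refine this.congrP fun p => ?_
      constructor
      · intro h
        change s p.1 = p.2 at h
        rw [← h, hs]
      · intro h; rw [h]; exact hsr _
    · apply hinj
      change r (c (s v)) = r (s (c v))
      rw [hs]
      have h1 := DFunLike.congr_fun (((hmemF r).1 hr).2 c hc) (s v)
      change c (r (s v)) = r (c (s v)) at h1
      rw [← h1, hs]
  obtain ⟨v₀, hv₀⟩ := exists_ne (0 : V)
  have hnt : Nontrivial (AddMonoid.End V) := ⟨1, 0, fun h => hv₀ (DFunLike.congr_fun h v₀)⟩
  have hFf : IsField F := by
    refine ⟨⟨0, 1, zero_ne_one⟩, fun a b => Subtype.ext (hFcomm _ a.2 _ b.2), fun {a} ha => ?_⟩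
    obtain ⟨s, hs, h⟩ := hF.inv a a.2 fun h => ha (Subtype.ext h)
    exact ⟨⟨s, hs⟩, Subtype.ext ((hFcomm _ a.2 _ hs).trans h)⟩
  let _ : Field F := hFf.toField
  have hact := hF.def_action hρ hv₀ (hinf v₀ hv₀)
  have hact' : DefMap S fun p : V × V × V => ∃ r : F, F.subtype r v₀ = p.1 ∧ F.subtype r p.2.1 = p.2.2 :=
    hact.congrP fun p => ⟨fun ⟨r, h⟩ => ⟨r, r.2, h⟩, fun ⟨r, hr, h⟩ => ⟨⟨r, hr⟩, h⟩⟩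
  have hcommF := commute_field hG hρ (K := F) F.subtype hv₀ hact' fun g r => ⟨⟨_, hFG g r r.2⟩, rfl⟩
  have hFinf : Infinite F := by
    by_contra hcon
    have hcon : Finite F := not_infinite_iff_finite.1 hcon
    refine hinf v₀ hv₀ ((Set.finite_range fun r : F => r.1 v₀).subset ?_)
    rintro _ ⟨a, ha, rfl⟩
    exact ⟨⟨_, hAF a ha⟩, rfl⟩
  obtain ⟨x, hx, y, hy, h⟩ := hLx
  exact h (commute_of_scalar hρ (K := F) F.subtype hv₀ hact' hcommF hLc
    (fun x hx y hy => ⟨⟨_, hAF _ (hLA x hx y hy)⟩, rfl⟩) x hx y hy)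

end SolvableAction

section Section

variable {N : Type u} [LinearOrder N] [DenselyOrdered N] [NoMinOrder N] [NoMaxOrder N] [Nonempty N]
  {S : Struc N} {G : Type*} [Group G] [Interp S G] [DefGrp S G]

/-- The action of a connected solvable group on a minimal infinite abelian definable section is commutative.
The section `A / M` is presented by a relation between the group and a module. -/
theorem commutator_mem_of_relation [DCC S G] (hG : DConn S (⊤ : Subgroup G)) [Group.IsSolvable G]
    {V : Type*} [AddCommGroup V] [Interp S V] [Infinite V] {ρ : G →* AddMonoid.End V} {A M : Subgroup G}
    {R : G → V → Prop} (hR : DefMap S fun p : G × V => R p.1 p.2) (h1 : R 1 0)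
    (hfun : ∀ a u v, R a u → R a v → u = v) (hsurj : ∀ v, ∃ a, R a v) (hRA : ∀ a v, R a v → a ∈ A)
    (hAR : ∀ a ∈ A, ∃ v, R a v) (hmul : ∀ a b u v, R a u → R b v → R (a * b) (u + v))
    (hker : ∀ a, R a 0 ↔ a ∈ M) (hρ : ∀ g a v, R a v → R (g * a * g⁻¹) (ρ g v))
    (hsimple : ∀ C : Subgroup G, DefSub S C → C.Normal → M ≤ C → C ≤ A → C = M ∨ C = A) :
    ∀ g ∈ commutator G, ∀ a ∈ A, ⁅g, a⁆ ∈ M := by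
  have hneg : ∀ a v, R a v → R a⁻¹ (-v) := fun a v h => by
    obtain ⟨w, hw⟩ := hAR _ (A.inv_mem (hRA a v h))
    have h2 := hmul _ _ _ _ h hw
    rw [mul_inv_cancel] at h2
    rwa [neg_eq_of_add_eq_zero_right (hfun _ _ _ h2 h1)]
  have hadd : DefAddGrp S V := by
    refine ⟨DefMap.of_graph ?_, DefMap.of_graph ?_⟩
    · rw [defP_iff]
      have h2 : DefMap S fun p : (V × V) × V => ∃ a b : G, R a p.1.1 ∧ R b p.1.2 ∧ R (a * b) p.2 := by fun_prop
      refine h2.congrP fun p => ⟨?_, ?_⟩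
      · intro h
        obtain ⟨a, ha⟩ := hsurj p.1.1
        obtain ⟨b, hb⟩ := hsurj p.1.2
        exact ⟨a, b, ha, hb, h ▸ hmul _ _ _ _ ha hb⟩
      · rintro ⟨a, b, ha, hb, h⟩
        exact hfun _ _ _ (hmul _ _ _ _ ha hb) h
    · rw [defP_iff]
      have h2 : DefMap S fun p : V × V => ∃ a : G, R a p.1 ∧ R a⁻¹ p.2 := by fun_prop
      refine h2.congrP fun p => ⟨?_, ?_⟩
      · intro h
        obtain ⟨a, ha⟩ := hsurj p.1
        exact ⟨a, ha, h ▸ hneg _ _ ha⟩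
      · rintro ⟨a, ha, h⟩
        exact hfun _ _ _ (hneg _ _ ha) h
  let pull : AddSubgroup V → Subgroup G := fun W =>
    { carrier := {a | ∃ v, R a v ∧ v ∈ W}
      one_mem' := ⟨0, h1, W.zero_mem⟩
      mul_mem' := fun {a b} ⟨u, hu, hu'⟩ ⟨v, hv, hv'⟩ => ⟨u + v, hmul _ _ _ _ hu hv, W.add_mem hu' hv'⟩
      inv_mem' := fun {a} ⟨u, hu, hu'⟩ => ⟨-u, hneg _ _ hu, W.neg_mem hu'⟩ }
  have hpull : ∀ W a, a ∈ pull W ↔ ∃ v, R a v ∧ v ∈ W := fun W a => Iff.rfl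
  have hpull' : ∀ W a v, R a v → (a ∈ pull W ↔ v ∈ W) := fun W a v h =>
    ⟨fun ⟨u, hu, hu'⟩ => hfun _ _ _ hu h ▸ hu', fun hv => ⟨v, h, hv⟩⟩
  have hle : ∀ W W', pull W ≤ pull W' → W ≤ W' := fun W W' h v hv => by
    obtain ⟨a, ha⟩ := hsurj v
    exact (hpull' W' a v ha).1 (h ((hpull' W a v ha).2 hv))
  have hpd : ∀ W : AddSubgroup V, DefMap S (· ∈ W) → DefSub S (pull W) := fun W hW => by
    refine ⟨?_⟩
    simp only [hpull]
    fun_prop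
  have hdcc : AddDCC S V := by
    refine ⟨fun F hF ⟨K₀, hK₀⟩ => ?_⟩
    obtain ⟨_, ⟨K, hK, rfl⟩, hmin⟩ := DCC.exists_min (S := S) (G := G) (fun L => ∃ K, F K ∧ pull K = L)
      (by rintro _ ⟨K, hK, rfl⟩; exact hpd K (hF K hK)) ⟨_, K₀, hK₀, rfl⟩
    refine ⟨K, hK, fun L hL hLK => le_antisymm hLK (hle _ _ ?_)⟩
    exact (hmin _ ⟨L, hL, rfl⟩ fun a ⟨v, hv, hv'⟩ => ⟨v, hv, hLK hv'⟩).symm.le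
  have hact : DefMap S fun p : G × V => ρ p.1 p.2 := by
    refine DefMap.of_graph ?_
    rw [defP_iff]
    have h2 : DefMap S fun p : (G × V) × V => ∃ a : G, R a p.1.2 ∧ R (p.1.1 * a * p.1.1⁻¹) p.2 := by fun_prop
    refine h2.congrP fun p => ⟨?_, ?_⟩
    · intro h
      obtain ⟨a, ha⟩ := hsurj p.1.2
      exact ⟨a, ha, h ▸ hρ _ _ _ ha⟩
    · rintro ⟨a, ha, h⟩
      exact hfun _ _ _ (hρ _ _ _ ha) h
  have hs : DefSimple S ρ := fun W hW hWG => by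
    have hn : (pull W).Normal := ⟨fun a ⟨v, hv, hv'⟩ g => ⟨_, hρ g _ _ hv, hWG g v hv'⟩⟩
    rcases hsimple (pull W) (hpd W hW) hn (fun a ha => ⟨0, (hker a).2 ha, W.zero_mem⟩)
      (fun a ⟨v, hv, _⟩ => hRA _ _ hv) with h | h
    · left
      rw [eq_bot_iff]
      intro v hv
      obtain ⟨a, ha⟩ := hsurj v
      have h2 := (hpull' W a v ha).2 hv
      rw [h] at h2
      exact hfun _ _ _ ha ((hker a).2 h2)
    · right
      rw [eq_top_iff]
      intro v _
      obtain ⟨a, ha⟩ := hsurj v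
      exact (hpull' W a v ha).1 (h ▸ hRA _ _ ha)
  have hcomm := commute_of_defSimple hG hact hs
  have hk : commutator G ≤ ρ.ker := by
    rw [commutator_def, Subgroup.commutator_le]
    intro x _ y _
    rw [MonoidHom.mem_ker, commutatorElement_def]
    have h2 : x * y * x⁻¹ * y⁻¹ = x * y * (y * x)⁻¹ := by group
    rw [h2, map_mul, map_mul ρ x y, hcomm, ← map_mul, ← map_mul, mul_inv_cancel, map_one]
  intro g hg a ha
  obtain ⟨v, hv⟩ := hAR a ha
  have h2 := hmul _ _ _ _ (hρ g a v hv) (hneg _ _ hv)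
  have h3 : ρ g = 1 := hk hg
  rw [← hker]
  rw [h3] at h2
  have h4 : (1 : AddMonoid.End V) v + -v = 0 := add_neg_cancel v
  rw [h4] at h2
  exact h2

/-- A connected solvable group acts on a minimal infinite abelian definable section through a commutative
quotient. -/
theorem commutator_mem_of_minimal [DCC S G] (hG : DConn S (⊤ : Subgroup G)) [Group.IsSolvable G]
    {A M : Subgroup G} [hAn : A.Normal] [hMn : M.Normal] [DefSub S A] [DefSub S M] (hMA : M ≤ A) (hAA : ⁅A, A⁆ ≤ M)
    (hinf : M.relIndex A = 0)
    (hsimple : ∀ C : Subgroup G, DefSub S C → C.Normal → M ≤ C → C ≤ A → C = M ∨ C = A) :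
    ∀ g ∈ commutator G, ∀ a ∈ A, ⁅g, a⁆ ∈ M := by
  let _ : CommGroup (A ⧸ M.subgroupOf A) :=
    { (inferInstance : Group (A ⧸ M.subgroupOf A)) with
      mul_comm := by
        intro x y
        induction x using QuotientGroup.induction_on with | H a => ?_
        induction y using QuotientGroup.induction_on with | H b => ?_
        refine QuotientGroup.eq.2 ?_
        rw [Subgroup.mem_subgroupOf]
        have h1 : (((a * b)⁻¹ * (b * a) : A) : G) = ⁅(b : G)⁻¹, (a : G)⁻¹⁆ := by
          rw [commutatorElement_def]; push_cast; group
        rw [h1]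
        exact hAA (Subgroup.commutator_mem_commutator (A.inv_mem b.2) (A.inv_mem a.2)) }
  have hcomap : ∀ g : G, M.subgroupOf A ≤ (M.subgroupOf A).comap (MulAut.conjNormal g : MulAut A).toMonoidHom :=
    fun g a ha => by
      rw [Subgroup.mem_comap, Subgroup.mem_subgroupOf] at *
      exact hMn.conj_mem _ ha g
  let act : G → (A ⧸ M.subgroupOf A) →* (A ⧸ M.subgroupOf A) := fun g =>
    QuotientGroup.map _ _ (MulAut.conjNormal g : MulAut A).toMonoidHom (hcomap g)
  have hact : ∀ g (a : A), act g a = ((MulAut.conjNormal g a : A) : A ⧸ M.subgroupOf A) := fun g a => rfl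
  let V := Additive (A ⧸ M.subgroupOf A)
  let ρ : G →* AddMonoid.End V :=
    { toFun := fun g => MonoidHom.toAdditive (act g)
      map_one' := by
        refine AddMonoidHom.ext fun v => ?_
        induction v using Additive.rec with | ofMul x => ?_
        induction x using QuotientGroup.induction_on with | H a => ?_
        change Additive.ofMul (act 1 a) = Additive.ofMul (a : A ⧸ M.subgroupOf A)
        rw [hact, map_one]; rfl
      map_mul' := fun g h => by
        refine AddMonoidHom.ext fun v => ?_
        induction v using Additive.rec with | ofMul x => ?_
        induction x using QuotientGroup.induction_on with | H a => ?_
        change Additive.ofMul (act (g * h) a) = Additive.ofMul (act g (act h a))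
        rw [hact, hact, hact, map_mul]; rfl }
  let π : A → V := fun a => Additive.ofMul (a : A ⧸ M.subgroupOf A)
  have hπ : ∀ a b : A, π a = π b ↔ (a : G)⁻¹ * b ∈ M := fun a b => by
    refine QuotientGroup.eq.trans ?_
    rw [Subgroup.mem_subgroupOf]; rfl
  have hπs : Function.Surjective π := QuotientGroup.mk_surjective
  have hAd : DefP S fun a : G => a ∈ A := by rw [defP_iff]; fun_prop
  let _ : Interp S A := Interp.sub _ hAd
  have hval : DefMap S fun a : A => (a : G) := DefMap.val hAd
  have hπd : DefP S fun p : A × A => π p.1 = π p.2 := by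
    rw [defP_iff]; simp only [hπ]; fun_prop
  let _ : Interp S V := Interp.ofSurj π hπs hπd
  have hπm : DefMap S π := DefMap.ofSurj π hπs hπd
  have : Infinite V := by
    by_contra hcon
    have hcon : Finite (A ⧸ M.subgroupOf A) := not_infinite_iff_finite.1 hcon
    exact Subgroup.index_ne_zero_of_finite (H := M.subgroupOf A) hinf
  refine commutator_mem_of_relation (S := S) hG (V := V) (ρ := ρ) (A := A) (M := M)
    (R := fun g v => ∃ a : A, (a : G) = g ∧ π a = v) ?_ ⟨1, rfl, rfl⟩ ?_ ?_ ?_ ?_ ?_ ?_ ?_ hsimple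
  · fun_prop
  · rintro _ _ _ ⟨a, rfl, rfl⟩ ⟨b, hb, rfl⟩
    rw [Subtype.ext hb]
  · intro v
    obtain ⟨a, rfl⟩ := hπs v
    exact ⟨a, a, rfl, rfl⟩
  · rintro _ _ ⟨a, rfl, rfl⟩; exact a.2
  · exact fun a ha => ⟨_, ⟨a, ha⟩, rfl, rfl⟩
  · rintro _ _ _ _ ⟨a, rfl, rfl⟩ ⟨b, rfl, rfl⟩
    exact ⟨a * b, rfl, rfl⟩
  · intro g
    have h0 : ∀ a : A, π a = 0 ↔ (a : G) ∈ M := fun a => by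
      rw [show (0 : V) = π 1 from rfl, eq_comm, hπ]; simp
    constructor
    · rintro ⟨a, rfl, h⟩; exact (h0 a).1 h
    · intro h; exact ⟨⟨g, hMA h⟩, rfl, (h0 _).2 h⟩
  · rintro g _ _ ⟨a, rfl, rfl⟩
    exact ⟨MulAut.conjNormal g a, rfl, rfl⟩

end Section

section Nilpotency

variable {G : Type*} [Group G]

/-- Finitely many commutations with `D` lead from `M` into `C`. -/
inductive CommutesInto (D C : Subgroup G) : Subgroup G → Prop
  | base {M : Subgroup G} : M ≤ C → CommutesInto D C M
  | step {M M' : Subgroup G} : ⁅M, D⁆ ≤ M' → CommutesInto D C M' → CommutesInto D C M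

theorem CommutesInto.mono {D C M M' : Subgroup G} (h : CommutesInto D C M') (hM : M ≤ M') : CommutesInto D C M := by
  cases h with
  | base h => exact .base (hM.trans h)
  | step h h' => exact .step ((Subgroup.commutator_mono hM le_rfl).trans h) h'

theorem CommutesInto.trans {D B C M : Subgroup G} (h : CommutesInto D B M) (hB : CommutesInto D C B) :
    CommutesInto D C M := by
  induction h with
  | base h => exact hB.mono h
  | step h _ ih => exact .step h ih

theorem CommutesInto.isNilpotent {D : Subgroup G} (h : CommutesInto D ⊥ D) : Group.IsNilpotent D := by
  rw [Subgroup.isNilpotent_iff_lowerCentralSeries]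
  have h1 : ∀ M, CommutesInto D ⊥ M → ∀ k, D.lowerCentralSeries k ≤ M → ∃ n, D.lowerCentralSeries n = ⊥ := by
    intro M hM
    induction hM with
    | base h => exact fun k hk => ⟨k, le_bot_iff.1 (hk.trans h)⟩
    | step h _ ih => exact fun k hk => ih (k + 1) ((Subgroup.commutator_mono hk le_rfl).trans h)
  exact h1 D h 0 le_rfl

end Nilpotency

section Derived

variable {N : Type u} [LinearOrder N] [DenselyOrdered N] [NoMinOrder N] [NoMaxOrder N] [Nonempty N]
  {S : Struc N} {G : Type*} [Group G] [Interp S G] [DefGrp S G]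

instance centMod_normal (M : Subgroup G) [hM : M.Normal] : (centMod M Set.univ).Normal := by
  refine ⟨fun a ha h g _ => ?_⟩
  have h1 : ⁅g, h * a * h⁻¹⁆ = h * ⁅h⁻¹ * g * h, a⁆ * h⁻¹ := by simp only [commutatorElement_def]; group
  rw [h1]
  exact hM.conj_mem _ (ha _ trivial) h

/-- Commutation with the hull of the derived subgroup leads from `B` into `B₁` when `B / B₁` is abelian. -/
theorem commutesInto_of_abelian [DCC S G] (hG : DConn S (⊤ : Subgroup G)) [Group.IsSolvable G]
    {B B₁ : Subgroup G} [hBn : B.Normal] [hB₁n : B₁.Normal] [hBd : DefSub S B] [hB₁d : DefSub S B₁] (hle : B₁ ≤ B)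
    (hab : ⁅B, B⁆ ≤ B₁) : CommutesInto (dcl S (commutator G : Set G)) B₁ B := by
  classical
  set D := dcl S (commutator G : Set G)
  let P : Subgroup G → Prop := fun M => DefSub S M ∧ M.Normal ∧ B₁ ≤ M ∧ M ≤ B ∧ CommutesInto D B₁ M
  have hP0 : P B₁ := ⟨hB₁d, hB₁n, le_rfl, hle, .base le_rfl⟩
  obtain ⟨M, ⟨hMd, hMn, hBM, hMB, hMc⟩, hmax⟩ : ∃ M, P M ∧ ∀ A, P A → M ≤ A → M.relIndex A ≠ 0 := by
    let Q : ℕ → Prop := fun e => ∃ M, P M ∧ CosetDim S e M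
    have hQ : ∀ e, Q e → e ≤ Nat.findGreatest Q (ar S G) := fun e ⟨M, h, h'⟩ =>
      Nat.le_findGreatest h'.le ⟨M, h, h'⟩
    obtain ⟨M, hM, he⟩ := Nat.findGreatest_spec (P := Q) (Nat.zero_le (ar S G)) ⟨B₁, hP0, cosetDim_zero B₁⟩
    refine ⟨M, hM, fun A hA hMA h0 => ?_⟩
    have := hM.1
    have := hA.1
    have h1 := hQ _ ⟨A, hA, he.succ hMA h0⟩
    omega
  have hDle : ∀ {A C : Subgroup G} [C.Normal] [DefSub S C], (∀ g ∈ commutator G, ∀ a ∈ A, ⁅g, a⁆ ∈ C) → ⁅A, D⁆ ≤ C :=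
    fun {A C} _ _ h => (Subgroup.commutator_mono (subset_dcl (S := S) (A : Set G)) le_rfl).trans
      (commutator_dcl_le fun a ha g hg => commutatorElement_mem_symm (h g hg a ha))
  have hfin : ∀ {C : Subgroup G} [C.Normal], M.relIndex C ≠ 0 → ∀ x ∈ C, ∀ g, ⁅x, g⁆ ∈ M := by
    intro C hC h x hx g
    refine hG.commutator_le (M := M) (X := C) (fun x hx => ?_) x hx g trivial
    refine (finite_of_relIndex_ne_zero h).subset ?_
    rintro _ ⟨y, -, rfl⟩
    refine ⟨⁅x, y⁆, ?_, rfl⟩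
    have h1 : ⁅x, y⁆ = x * (y * x⁻¹ * y⁻¹) := by rw [commutatorElement_def]; group
    rw [h1]
    exact C.mul_mem hx (hC.conj_mem _ (C.inv_mem hx) y)
  by_cases h0 : M.relIndex B = 0
  · exfalso
    obtain ⟨A, ⟨hAd, hAn, hMA, hAB, hA0⟩, hAm⟩ := DCC.exists_min (S := S) (G := G)
      (fun A => DefSub S A ∧ A.Normal ∧ M ≤ A ∧ A ≤ B ∧ M.relIndex A = 0) (fun A h => h.1)
      ⟨B, hBd, hBn, hMB, le_rfl, h0⟩
    suffices hc : CommutesInto D M A from hmax A ⟨hAd, hAn, hBM.trans hMA, hAB, hc.trans hMc⟩ hMA hA0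
    set M₀ := A ⊓ centMod M Set.univ with hM₀
    have hM₀D : CommutesInto D M M₀ :=
      .step (hDle fun g _ a ha => ha.2 g trivial) (.base le_rfl)
    have hMM₀ : M ≤ M₀ := fun x hx => ⟨hMA hx, fun g _ => by
      rw [commutatorElement_def]
      exact M.mul_mem (hMn.conj_mem x hx g) (M.inv_mem hx)⟩
    by_cases h1 : M.relIndex M₀ = 0
    · rw [← hAm M₀ ⟨inferInstance, inferInstance, hMM₀, inf_le_left.trans hAB, h1⟩ inf_le_left]
      exact hM₀D
    · refine .step (hDle (commutator_mem_of_minimal hG (M := M₀) inf_le_left ?_ ?_ ?_)) hM₀D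
      · exact (Subgroup.commutator_mono hAB hAB).trans (hab.trans (hBM.trans hMM₀))
      · by_contra h2
        exact Subgroup.relIndex_ne_zero_trans h1 h2 hA0
      · intro C hCd hCn hC hCA
        by_cases h2 : M.relIndex C = 0
        · exact .inr (hAm C ⟨hCd, hCn, hMM₀.trans hC, hCA.trans hAB, h2⟩ hCA)
        · exact .inl (le_antisymm (fun x hx => ⟨hCA hx, fun g _ =>
            commutatorElement_mem_symm (hfin h2 x hx g)⟩) hC)
  · exact .step (hDle fun g _ a ha => commutatorElement_mem_symm (hfin h0 a ha g)) hMc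

/-- The definable hull of the derived subgroup of a connected solvable group is nilpotent. -/
theorem isNilpotent_dcl_commutator [DCC S G] (hG : DConn S (⊤ : Subgroup G)) [Group.IsSolvable G] :
    Group.IsNilpotent (dcl S (commutator G : Set G)) := by
  set D := dcl S (commutator G : Set G)
  have hDn : D.Normal := dcl_normal _
  obtain ⟨B, ⟨hBd, hBn, hB⟩, hmin⟩ := DCC.exists_min (S := S) (G := G)
    (fun B => DefSub S B ∧ B.Normal ∧ CommutesInto D B D) (fun B h => h.1)
    ⟨D, inferInstance, hDn, .base le_rfl⟩
  by_cases h0 : B = ⊥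
  · subst h0; exact hB.isNilpotent
  · exfalso
    have hn : (dcl S ((⁅B, B⁆ : Subgroup G) : Set G)).Normal := dcl_normal _
    have hle : dcl S ((⁅B, B⁆ : Subgroup G) : Set G) ≤ B := dcl_le (Subgroup.commutator_le_left B B)
    refine dcl_commutator_ne h0 (hmin _ ⟨inferInstance, hn, hB.trans ?_⟩ hle)
    exact commutesInto_of_abelian hG hle (subset_dcl _)

end Derived

section Transfer

variable {N : Type u} [LinearOrder N] [DenselyOrdered N] [NoMinOrder N] [NoMaxOrder N] [Nonempty N]
  [TopologicalSpace N] {S : Struc N} {m : ℕ} {U : DefGroup S m}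

/-- The set of tuples underlying a subgroup. -/
def carrierOf (K : Subgroup U.Elt) : Set (Fin m → N) := {x | ∃ a : U.Elt, a ∈ K ∧ a.1 = x}

theorem mem_carrierOf {K : Subgroup U.Elt} {a : U.Elt} : a.1 ∈ carrierOf K ↔ a ∈ K :=
  ⟨fun ⟨_, hb, h⟩ => Subtype.ext h ▸ hb, fun h => ⟨a, h, rfl⟩⟩

theorem isDefSubgroup_carrierOf (K : Subgroup U.Elt) [DefSub S K] : U.IsDefSubgroup (carrierOf K) := by
  refine ⟨?_, ?_, ⟨1, K.one_mem, rfl⟩, ?_, ?_⟩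
  · rintro _ ⟨a, -, rfl⟩; exact a.2
  · have h1 : DefMap S fun a : U.Elt => a.1 := DefMap.val (defP_tuple.2 U.carrier_def)
    have h2 : DefMap S fun x : Fin m → N => ∃ a : U.Elt, a ∈ K ∧ a.1 = x := by fun_prop
    exact defP_tuple.1 (defP_iff.2 h2)
  · rintro _ ⟨a, ha, rfl⟩ _ ⟨b, hb, rfl⟩
    exact ⟨a * b, K.mul_mem ha hb, rfl⟩
  · rintro _ ⟨a, ha, rfl⟩
    exact ⟨a⁻¹, K.inv_mem ha, rfl⟩

/-- The subgroup of elements given by a definable subgroup. -/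
def subgroupOf (H : Set (Fin m → N)) (hH : U.IsDefSubgroup H) : Subgroup U.Elt where
  carrier := {a | a.1 ∈ H}
  one_mem' := hH.2.2.1
  mul_mem' ha hb := hH.2.2.2.1 _ ha _ hb
  inv_mem' ha := hH.2.2.2.2 _ ha

theorem defSub_subgroupOf (H : Set (Fin m → N)) (hH : U.IsDefSubgroup H) : DefSub S (subgroupOf H hH) := by
  have h1 : DefMap S fun a : U.Elt => a.1 := DefMap.val (defP_tuple.2 U.carrier_def)
  exact ⟨DefMap.comp (g := fun a : U.Elt => a.1) (defP_iff.1 (defP_tuple.2 hH.2.1)) h1⟩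

theorem dConn_top (hU : U.DefinablyConnected) : DConn S (⊤ : Subgroup U.Elt) := by
  intro K hK _ hfin
  have h1 := finite_of_relIndex_ne_zero hfin
  rw [Subgroup.coe_top, Set.image_univ] at h1
  have h2 : Finite (U.Elt ⧸ K) := by
    rw [← Set.finite_univ_iff, ← QuotientGroup.mk_surjective.range_eq]
    exact h1
  let _ := Fintype.ofFinite (U.Elt ⧸ K)
  classical
  have h3 := hU (carrierOf K) (isDefSubgroup_carrierOf K)
    ⟨Finset.univ.image fun q : U.Elt ⧸ K => q.out.1, ?_, ?_⟩
  · rw [eq_top_iff]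
    intro a _
    exact mem_carrierOf.1 (h3.symm.subset a.2)
  · intro x hx
    obtain ⟨q, -, rfl⟩ := Finset.mem_image.1 (Finset.mem_coe.1 hx)
    exact q.out.2
  · intro x hx
    let a : U.Elt := ⟨x, hx⟩
    let b : U.Elt := Quotient.out (a : U.Elt ⧸ K)
    refine Set.mem_iUnion₂.2 ⟨b.1, Finset.mem_image.2 ⟨_, Finset.mem_univ _, rfl⟩, (b⁻¹ * a).1, ⟨_, ?_, rfl⟩, ?_⟩
    · exact QuotientGroup.eq.1 (QuotientGroup.out_eq' (a : U.Elt ⧸ K))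
    · exact congrArg Subtype.val (mul_inv_cancel_left b a).symm

end Transfer

end OMin

/-- if `U` is a definably connected definable solvable group then its
derived subgroup `U⁽¹⁾ = [U,U]` is a nilpotent normal subgroup, and `d(U⁽¹⁾)`, the
smallest definable subgroup containing it, is a definable nilpotent normal
subgroup. -/
theorem stmt_14 {N : Type u} [LinearOrder N] [DenselyOrdered N] [NoMinOrder N]
    [NoMaxOrder N] [Nonempty N] [TopologicalSpace N] [OrderTopology N]
    (S : Struc N) {m : ℕ} (U : DefGroup S m) (hconn : U.DefinablyConnected)
    (hsolv : IsSolvable U.Elt) :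
    Group.IsNilpotent ↥(commutator U.Elt) ∧
    ∃ H : Set (Fin m → N),
      U.IsDefSubgroup H ∧
      (∀ g ∈ U.carrier, ∀ h ∈ H, U.mul (U.mul g h) (U.inv g) ∈ H) ∧
      ((commutator U.Elt : Set U.Elt) ⊆ {a : U.Elt | a.1 ∈ H}) ∧
      (∀ H' : Set (Fin m → N), U.IsDefSubgroup H' →
        ((commutator U.Elt : Set U.Elt) ⊆ {a : U.Elt | a.1 ∈ H'}) → H ⊆ H') ∧
      ∃ sub : Subgroup U.Elt, (sub : Set U.Elt) = {a : U.Elt | a.1 ∈ H} ∧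
        Group.IsNilpotent sub := by
  have hsol : Group.IsSolvable U.Elt := hsolv
  have hnil := OMin.isNilpotent_dcl_commutator (OMin.dConn_top hconn)
  have hn := OMin.dcl_normal (S := S) (commutator U.Elt)
  have hsub := OMin.subset_dcl (S := S) (commutator U.Elt : Set U.Elt)
  refine ⟨?_, OMin.carrierOf (OMin.dcl S (commutator U.Elt : Set U.Elt)), OMin.isDefSubgroup_carrierOf _, ?_,
    fun a ha => OMin.mem_carrierOf.2 (hsub ha), fun H' hH' h => ?_, _,
    Set.ext fun a => OMin.mem_carrierOf.symm, hnil⟩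
  · rw [Subgroup.isNilpotent_iff_lowerCentralSeries] at hnil ⊢
    obtain ⟨n, h⟩ := hnil
    exact ⟨n, le_bot_iff.1 ((Subgroup.lowerCentralSeries_mono n hsub).trans_eq h)⟩
  · rintro g hg _ ⟨a, ha, rfl⟩
    exact ⟨_, hn.conj_mem a ha ⟨g, hg⟩, rfl⟩
  · have := OMin.defSub_subgroupOf H' hH'
    have h1 := OMin.dcl_le (S := S) (K := OMin.subgroupOf H' hH') h
    rintro _ ⟨a, ha, rfl⟩
    exact h1 ha
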